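/- arXiv:1402.3383 — 6 statements merged into one kernel-verified Lean document; each statement's English description precedes it below -/
import Mathlib

section
/- Let F be a field with characteristic order p(F) (the additive order of the multiplicative identity, either a prime or infinite). Let n ≥ 1, m ≥ 0, and let S_{ij} (for 1 ≤ i ≠ j ≤ n) be subsets of F each of cardinality m. Let A_1, ..., A_n be finite nonempty subsets of F with |A_j| ∈ {k, k+1} for all j. Define C = {a_1 + ... + a_n : a_j ∈ A_j for all j, and a_i − a_j ∉ S_{ij} whenever i ≠ j}. If p(F) > max{mn, Σ_{j=1}^n(|A_j| − 1) − mn(n−1)}, then |C| ≥ Σ_{j=1}^n(|A_j| − 1) − mn(n−1) + 1. -/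
open Finset

set_option linter.unusedSectionVars false

namespace RSR
open MvPolynomial

variable {σ F : Type*} [DecidableEq σ] [Field F]

noncomputable def Dy (F : Type*) [Field F] (s : Finset σ) (a : σ → ℕ) : MvPolynomial σ F :=
  ∏ j ∈ s, ∏ i ∈ s.erase j, (X i - X j) ^ (a j)

lemma coeff_step (j i : σ) (hij : i ≠ j) (P : MvPolynomial σ F) (d : ℕ)
    (hP : P.degreeOf j ≤ d) (e : σ →₀ ℕ) (he : e j = 0) :
    ((X j - X i) * P).degreeOf j ≤ d + 1 ∧
    coeff (e + Finsupp.single j (d+1)) ((X j - X i) * P) = coeff (e + Finsupp.single j d) P := by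
  have h2 : (X i * P).degreeOf j ≤ d := by
    refine (degreeOf_mul_le _ _ _).trans ?_
    rw [degreeOf_X, if_neg hij.symm]; omega
  constructor
  · rw [sub_mul]
    refine (degreeOf_sub_le _ _ _).trans (max_le ?_ (by omega))
    refine (degreeOf_mul_le _ _ _).trans ?_
    rw [degreeOf_X, if_pos rfl]; omega
  · rw [sub_mul, coeff_sub]
    have h3 : coeff (e + Finsupp.single j (d+1)) (X i * P) = 0 := by
      rw [← notMem_support_iff]
      apply notMem_support_of_degreeOf_lt j
      simp [he]; omega
    rw [h3, sub_zero]
    have : e + Finsupp.single j (d+1) = Finsupp.single j 1 + (e + Finsupp.single j d) := by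
      rw [add_left_comm, ← Finsupp.single_add, add_comm 1 d]
    rw [this, coeff_X_mul]

lemma coeff_step_pow (j i : σ) (hij : i ≠ j) (P : MvPolynomial σ F) (d : ℕ)
    (hP : P.degreeOf j ≤ d) (e : σ →₀ ℕ) (he : e j = 0) (k : ℕ) :
    ((X j - X i) ^ k * P).degreeOf j ≤ d + k ∧
    coeff (e + Finsupp.single j (d+k)) ((X j - X i) ^ k * P) = coeff (e + Finsupp.single j d) P := by
  induction k with
  | zero => simpa using hP
  | succ k ih =>
    have := coeff_step j i hij _ _ ih.1 e he
    rw [pow_succ', mul_assoc]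
    exact ⟨this.1, this.2.trans ih.2⟩

lemma coeff_step_prod (j : σ) (t : Finset σ) (hj : j ∉ t) (a : σ → ℕ) (P : MvPolynomial σ F)
    (hP : P.degreeOf j ≤ 0) (e : σ →₀ ℕ) (he : e j = 0) :
    ((∏ i ∈ t, (X j - X i) ^ (a i)) * P).degreeOf j ≤ ∑ i ∈ t, a i ∧
    coeff (e + Finsupp.single j (∑ i ∈ t, a i)) ((∏ i ∈ t, (X j - X i) ^ (a i)) * P)
      = coeff e P := by
  induction t using Finset.induction_on with
  | empty => simpa using hP
  | insert x t hx ih =>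
    rw [mem_insert, not_or] at hj
    have ih := ih hj.2
    have := coeff_step_pow j x (Ne.symm hj.1) _ _ ih.1 e he (a x)
    rw [prod_insert hx, sum_insert hx, mul_assoc, add_comm (a x)]
    exact ⟨this.1, this.2.trans ih.2⟩

lemma Dy_erase (s : Finset σ) (a : σ → ℕ) (j : σ) (hj : j ∈ s) (ha : a j = 0) :
    Dy F s a = (∏ i ∈ s.erase j, (X j - X i) ^ (a i)) * Dy F (s.erase j) a := by
  unfold Dy
  rw [← prod_mul_distrib,
    ← mul_prod_erase s (fun j => ∏ i ∈ s.erase j, (X i - X j : MvPolynomial σ F) ^ (a j)) hj]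
  simp only [ha, pow_zero, prod_const_one, one_mul]
  refine Finset.prod_congr rfl fun i hi => ?_
  have : j ∈ s.erase i := by simp at hi ⊢; exact ⟨Ne.symm hi.1, hj⟩
  rw [← mul_prod_erase _ _ this, erase_right_comm]

lemma Dy_degreeOf (s : Finset σ) (a : σ → ℕ) (j : σ) (hj : j ∉ s) :
    (Dy F s a).degreeOf j ≤ 0 := by
  unfold Dy
  refine (degreeOf_prod_le _ _ _).trans (sum_nonpos fun k hk => ?_)
  refine (degreeOf_prod_le _ _ _).trans (sum_nonpos fun i hi => ?_)
  refine (degreeOf_pow_le _ _ _).trans ?_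
  have h1 : degreeOf j (X i - X k : MvPolynomial σ F) ≤ 0 := by
    refine (degreeOf_sub_le _ _ _).trans ?_
    rw [degreeOf_X, degreeOf_X, if_neg, if_neg]
    · simp
    · rintro rfl; exact hj hk
    · rintro rfl; exact hj (mem_of_mem_erase hi)
  simp [Nat.le_zero.mp h1]

lemma Dy_pred (s : Finset σ) (a : σ → ℕ) (j : σ) (hj : j ∈ s) (ha : 1 ≤ a j) :
    Dy F s a = (∏ i ∈ s.erase j, (X i - X j)) * Dy F s (Function.update a j (a j - 1)) := by
  unfold Dy
  rw [← mul_prod_erase s (fun k => ∏ i ∈ s.erase k, (X i - X k : MvPolynomial σ F) ^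
      (Function.update a j (a j - 1) k)) hj, ← mul_assoc, ← prod_mul_distrib,
    ← mul_prod_erase s (fun j => ∏ i ∈ s.erase j, (X i - X j : MvPolynomial σ F) ^ (a j)) hj]
  congr 1
  · refine Finset.prod_congr rfl fun i hi => ?_
    rw [Function.update_self, ← pow_succ', Nat.sub_add_cancel ha]
  · refine Finset.prod_congr rfl fun i hi => ?_
    rw [Function.update_of_ne (ne_of_mem_erase hi)]

lemma Dy_good (s : Finset σ) (hs : s.Nonempty) (a : σ → ℕ) (ha : ∀ j ∈ s, 1 ≤ a j) :
    Dy F s a = ∑ j ∈ s, (∏ i ∈ s.erase j, X i) * Dy F s (Function.update a j (a j - 1)) := by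
  let K := FractionRing (MvPolynomial σ F)
  let φ : MvPolynomial σ F →+* K := algebraMap _ _
  have hφ : Function.Injective φ := IsFractionRing.injective (MvPolynomial σ F) K
  let v : σ → K := fun i => φ (X i)
  have hv : Function.Injective v := hφ.comp (X_injective)
  have h1 := congrArg (Polynomial.eval 0) (Lagrange.sum_basis (s := s) (v := v) hv.injOn hs)
  apply hφ
  rw [← mul_one (φ (Dy F s a)), ← (h1.trans Polynomial.eval_one), Polynomial.eval_finsetSum,
    mul_sum, map_sum]
  refine sum_congr rfl fun j hj => ?_
  rw [Dy_pred s a j hj (ha j hj), map_mul, map_mul, mul_right_comm]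
  congr 1
  rw [Lagrange.basis, Polynomial.eval_prod, map_prod, map_prod, ← prod_mul_distrib]
  refine prod_congr rfl fun i hi => ?_
  have : v i - v j ≠ 0 := sub_ne_zero.mpr (hv.ne (ne_of_mem_erase hi))
  have h2 : v j - v i ≠ 0 := sub_ne_zero.mpr (hv.ne (ne_of_mem_erase hi).symm)
  simp only [Lagrange.basisDivisor, map_sub, Polynomial.eval_mul, Polynomial.eval_C,
    Polynomial.eval_sub, Polynomial.eval_X]
  change (v i - v j) * ((v j - v i)⁻¹ * (0 - v i)) = v i
  rw [← mul_assoc, ← neg_sub (v j) (v i), neg_mul, mul_inv_cancel₀ h2]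
  ring

lemma prod_X_eq (t : Finset σ) :
    (∏ i ∈ t, X i : MvPolynomial σ F) = monomial (∑ i ∈ t, Finsupp.single i 1) 1 := by
  induction t using Finset.induction_on with
  | empty => simp
  | insert x t hx ih => rw [prod_insert hx, sum_insert hx, ih, X, monomial_mul, one_mul]

noncomputable def ex (s : Finset σ) (a : σ → ℕ) : σ →₀ ℕ :=
  ∑ i ∈ s, Finsupp.single i (∑ k ∈ s.erase i, a k)

lemma ex_apply (s : Finset σ) (a : σ → ℕ) (i : σ) :
    ex s a i = if i ∈ s then ∑ k ∈ s.erase i, a k else 0 := by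
  simp [ex, Finsupp.finsetSum_apply, Finsupp.single_apply]

lemma dyson (N : ℕ) : ∀ (s : Finset σ) (a : σ → ℕ), ∑ i ∈ s, a i + s.card = N →
    coeff (ex s a) (Dy F s a) * ∏ i ∈ s, ((a i).factorial : F) = ((∑ i ∈ s, a i).factorial : F) := by
  induction N using Nat.strong_induction_on with
  | _ N ih =>
  intro s a hN
  rcases s.eq_empty_or_nonempty with rfl | hs
  · simp [ex, Dy]
  by_cases h0 : ∃ j ∈ s, a j = 0
  · obtain ⟨j, hj, ha⟩ := h0
    have hsum : ∑ i ∈ s.erase j, a i = ∑ i ∈ s, a i := by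
      rw [← add_sum_erase s _ hj, ha, zero_add]
    have hc := card_erase_add_one hj
    have := ih _ (by omega) (s.erase j) a rfl
    rw [hsum] at this
    rw [← this, ← mul_prod_erase s _ hj, ha, Nat.factorial_zero, Nat.cast_one, one_mul]
    congr 1
    rw [Dy_erase s a j hj ha, ← (coeff_step_prod j (s.erase j) (by simp) a _
      (Dy_degreeOf (s.erase j) a j (by simp)) (ex (s.erase j) a) (by simp [ex_apply])).2]
    congr 1
    ext i
    rw [Finsupp.add_apply, ex_apply, ex_apply, Finsupp.single_apply]
    by_cases hij : j = i
    · subst hij; simp [hj]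
    · by_cases his : i ∈ s
      · have hji : j ∈ s.erase i := by simp [hij, hj]
        simp only [his, mem_erase, ne_eq, Ne.symm hij, hij]
        simp only [not_false_eq_true, and_self, if_true, if_false, add_zero]
        rw [← add_sum_erase _ _ hji, ha, zero_add, erase_right_comm]
      · simp [his, hij]
  · push Not at h0
    have h1 : ∀ j ∈ s, 1 ≤ a j := fun j hj => Nat.one_le_iff_ne_zero.mpr (h0 j hj)
    rw [Dy_good s hs a h1, coeff_sum, sum_mul]
    have hpos : 1 ≤ ∑ i ∈ s, a i := by
      obtain ⟨j, hj⟩ := hs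
      exact (h1 j hj).trans (single_le_sum (f := a) (fun _ _ => Nat.zero_le _) hj)
    have key : ∀ j ∈ s, coeff (ex s a) ((∏ i ∈ s.erase j, X i) *
        Dy F s (Function.update a j (a j - 1))) * ∏ i ∈ s, ((a i).factorial : F)
        = (a j : F) * ((∑ i ∈ s, a i - 1).factorial : F) := by
      intro j hj
      have hsum : ∑ i ∈ s, Function.update a j (a j - 1) i = ∑ i ∈ s, a i - 1 := by
        rw [← add_sum_erase s _ hj, ← add_sum_erase s a hj, Function.update_self,
          sum_congr rfl (fun i hi => Function.update_of_ne (ne_of_mem_erase hi) _ _)]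
        have := h1 j hj
        omega
      have := ih _ (by omega) s (Function.update a j (a j - 1)) rfl
      rw [hsum] at this
      rw [← this, prod_X_eq]
      have hex : ex s a = (∑ i ∈ s.erase j, Finsupp.single i 1) +
          ex s (Function.update a j (a j - 1)) := by
        ext i
        rw [Finsupp.add_apply, ex_apply, ex_apply, Finsupp.finsetSum_apply]
        simp only [Finsupp.single_apply, sum_ite_eq']
        by_cases his : i ∈ s
        · by_cases hij : i = j
          · subst hij
            simp only [his, if_true, mem_erase, ne_eq, not_true_eq_false, false_and, if_false,
              zero_add]
            exact sum_congr rfl fun k hk => (Function.update_of_ne (ne_of_mem_erase hk) _ _).symm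
          · have hji : j ∈ s.erase i := by simp [Ne.symm hij, hj]
            simp only [his, if_true, mem_erase, ne_eq, hij, not_false_eq_true, and_self]
            rw [← add_sum_erase _ _ hji, ← add_sum_erase (s.erase i) (Function.update _ _ _) hji,
              Function.update_self,
              sum_congr rfl (fun i hi => Function.update_of_ne (ne_of_mem_erase hi) _ _)]
            have := h1 j hj
            omega
        · simp [his]
      rw [hex, coeff_monomial_mul, one_mul, mul_left_comm]
      congr 1
      rw [← mul_prod_erase s _ hj, ← mul_prod_erase s (fun i =>
        ((Function.update a j (a j - 1) i).factorial : F)) hj, ← mul_assoc, Function.update_self]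
      congr 1
      · rw [← Nat.cast_mul, Nat.mul_factorial_pred (h0 j hj)]
      · exact prod_congr rfl fun i hi => by rw [Function.update_of_ne (ne_of_mem_erase hi)]
    rw [sum_congr rfl key, ← sum_mul, ← Nat.cast_sum, ← Nat.cast_mul,
      Nat.mul_factorial_pred (by omega)]


variable [Fintype σ]

lemma Dy_split (m : ℕ) (i₀ : σ) :
    Dy F univ (fun _ => m) = Dy F (univ.erase i₀) (fun _ => m) *
      ∏ j ∈ univ.erase i₀, ((X i₀ - X j) * (X j - X i₀)) ^ m := by
  unfold Dy
  rw [← prod_mul_distrib,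
    ← mul_prod_erase univ (fun j : σ => ∏ i ∈ univ.erase j,
      (X i - X j : MvPolynomial σ F) ^ m) (mem_univ i₀), ← prod_mul_distrib]
  refine Finset.prod_congr rfl fun i hi => ?_
  have : i₀ ∈ univ.erase i := by simp at hi ⊢; exact Ne.symm hi
  rw [← mul_prod_erase _ _ this, erase_right_comm, mul_pow]
  ring

lemma pderiv_zero (i : σ) (P : MvPolynomial σ F) (h : P.degreeOf i ≤ 0) : pderiv i P = 0 := by
  ext e
  rw [coeff_pderiv, coeff_zero]
  have : coeff (e + Finsupp.single i 1) P = 0 := by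
    rw [← notMem_support_iff]
    apply notMem_support_of_degreeOf_lt i
    simp; omega
  rw [this, zero_mul]

lemma deriv_prod (m : ℕ) (i₀ : σ) (W : MvPolynomial σ F) (hW : pderiv i₀ W = 0)
    (t : Finset σ) (ht : i₀ ∉ t) :
    ∃ Q : σ → MvPolynomial σ F,
      (∀ j ∈ t, (X i₀ - X j) * Q j =
        (m : MvPolynomial σ F) * (W * ∏ j ∈ t, ((X i₀ - X j) * (X j - X i₀)) ^ m)) ∧
      pderiv i₀ (W * ∏ j ∈ t, ((X i₀ - X j) * (X j - X i₀)) ^ m) = 2 * ∑ j ∈ t, Q j := by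
  induction t using Finset.induction_on with
  | empty => exact ⟨0, by simp, by simpa using hW⟩
  | insert x t hx ih =>
    rw [mem_insert, not_or] at ht
    obtain ⟨Q, h1, h2⟩ := ih ht.2
    set U := W * ∏ j ∈ t, ((X i₀ - X j) * (X j - X i₀)) ^ m with hU
    set g : MvPolynomial σ F := (X i₀ - X x) * (X x - X i₀) with hg
    have hUU : W * ∏ j ∈ insert x t, ((X i₀ - X j) * (X j - X i₀)) ^ m = U * g ^ m := by
      rw [prod_insert hx, hU, hg]; ring
    rw [hUU]
    refine ⟨fun j => if j = x then (m : MvPolynomial σ F) * U * (X x - X i₀) * g ^ (m - 1) else Q j * g ^ m, ?_, ?_⟩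
    · intro j hj
      by_cases hjx : j = x
      · subst hjx
        simp only [if_true]
        rcases m with _ | m
        · simp
        · rw [Nat.add_sub_cancel, pow_succ, hg]; ring
      · simp only [hjx, if_false]
        rw [← mul_assoc, h1 j ((mem_insert.mp hj).resolve_left hjx)]; ring
    · rw [sum_insert hx, pderiv_mul, h2, pderiv_pow]
      have e1 : pderiv i₀ g = 2 * (X x - X i₀) := by
        rw [hg, pderiv_mul, map_sub, map_sub, pderiv_X_self, pderiv_X_of_ne (Ne.symm ht.1)]
        ring
      have e2 : ∑ j ∈ t, (if j = x then (m : MvPolynomial σ F) * U * (X x - X i₀) * g ^ (m - 1) else Q j * g ^ m)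
          = (∑ j ∈ t, Q j) * g ^ m := by
        rw [sum_mul]
        refine sum_congr rfl fun j hj => if_neg ?_
        rintro rfl; exact hx hj
      rw [e1, e2]
      simp only [if_true]
      ring

lemma rename_Dy (m : ℕ) (e : Equiv.Perm σ) :
    rename e (Dy F univ (fun _ => m)) = Dy F univ (fun _ => m) := by
  unfold Dy
  rw [map_prod]
  refine Finset.prod_equiv e (by simp) fun j _ => ?_
  rw [map_prod]
  refine Finset.prod_equiv e (by simp) fun i _ => ?_
  simp

lemma antisym (i j : σ) (hij : i ≠ j) (Q G : MvPolynomial σ F) (hQ : (X i - X j) * Q = G)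
    (hG : rename (Equiv.swap i j) G = G) (c : σ →₀ ℕ) (hc : c j = c i ∨ c j = c i + 1) :
    ∃ k : F, 2 * coeff c Q = k * coeff (c + Finsupp.single i 1) G := by
  have h1 : rename (Equiv.swap i j) Q = -Q := by
    have hne : (X i - X j : MvPolynomial σ F) ≠ 0 := sub_ne_zero.mpr (X_injective.ne hij)
    apply mul_left_cancel₀ hne
    have := congrArg (rename (Equiv.swap i j)) hQ
    rw [hG, ← hQ, map_mul, map_sub, rename_X, rename_X, Equiv.swap_apply_left,
      Equiv.swap_apply_right] at this
    linear_combination -this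
  have h2 := coeff_rename_mapDomain (Equiv.swap i j) (Equiv.injective _) Q c
  rw [h1, coeff_neg] at h2
  rcases hc with hc | hc
  · have : c.mapDomain (Equiv.swap i j) = c := by
      ext x
      rw [Finsupp.mapDomain_equiv_apply, Equiv.symm_swap, Equiv.swap_apply_def]
      split_ifs with h h' <;> simp [*]
    rw [this] at h2
    exact ⟨0, by linear_combination -h2⟩
  · have : c + Finsupp.single i 1 = c.mapDomain (Equiv.swap i j) + Finsupp.single j 1 := by
      ext x
      rw [Finsupp.add_apply, Finsupp.add_apply, Finsupp.mapDomain_equiv_apply, Equiv.symm_swap,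
        Equiv.swap_apply_def, Finsupp.single_apply, Finsupp.single_apply]
      split_ifs <;> subst_vars <;> simp_all
    refine ⟨1, ?_⟩
    rw [← hQ, sub_mul, coeff_sub]
    nth_rw 2 [this]
    rw [add_comm c, coeff_X_mul, add_comm (Finsupp.mapDomain _ _), coeff_X_mul]
    linear_combination -h2

lemma step (m N : ℕ) (i₀ : σ) (c : σ →₀ ℕ) (hc : ∀ j, c j = c i₀ ∨ c j = c i₀ + 1) :
    ∃ K : F, ((N : F) + 1) * coeff c (Dy F univ (fun _ => m) * (∑ i, X i) ^ N) =
      K * coeff (c + Finsupp.single i₀ 1) (Dy F univ (fun _ => m) * (∑ i, X i) ^ (N + 1)) := by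
  obtain ⟨Q, h1, h2⟩ := deriv_prod m i₀ (Dy F (univ.erase i₀) (fun _ => m))
    (pderiv_zero _ _ (Dy_degreeOf _ _ _ (by simp))) (univ.erase i₀) (by simp)
  rw [← Dy_split] at h1 h2
  set V := Dy F (univ : Finset σ) (fun _ => m) with hV
  set s : MvPolynomial σ F := ∑ i, X i with hs
  have hds : pderiv i₀ s = 1 := by
    rw [hs, map_sum, Finset.sum_eq_single i₀, pderiv_X_self]
    · intro j _ hj; exact pderiv_X_of_ne hj
    · simp
  have hrs : ∀ e : Equiv.Perm σ, rename e s = s := by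
    intro e
    rw [hs, map_sum]
    simp only [rename_X]
    exact Equiv.sum_comp e (fun i => (X i : MvPolynomial σ F))
  have hk : ∀ j ∈ univ.erase i₀, ∃ k : F, 2 * coeff c (Q j * s ^ (N+1)) =
      k * coeff (c + Finsupp.single i₀ 1) (V * s ^ (N+1)) := by
    intro j hj
    obtain ⟨k, hk⟩ := antisym i₀ j (ne_of_mem_erase hj).symm (Q j * s ^ (N+1))
      (m * V * s ^ (N+1)) (by rw [← mul_assoc, h1 j hj])
      (by simp [hrs, hV, rename_Dy]) c (hc j)
    refine ⟨k * m, ?_⟩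
    rw [hk, mul_assoc, ← C_eq_coe_nat, mul_assoc, coeff_C_mul]
  choose! k hk using hk
  have hd : pderiv i₀ (V * s ^ (N+1)) =
      2 * ∑ j ∈ univ.erase i₀, Q j * s ^ (N+1) + C ((N : F) + 1) * (V * s ^ N) := by
    rw [pderiv_mul, h2, pderiv_pow, hds, Nat.add_sub_cancel, ← sum_mul]
    simp
    ring
  have := congrArg (coeff c) hd
  rw [coeff_pderiv, coeff_add, coeff_C_mul, show (2 : MvPolynomial σ F) = C 2 from (map_ofNat C 2).symm,
    coeff_C_mul, coeff_sum, mul_sum, sum_congr rfl hk, ← sum_mul] at this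
  exact ⟨(c i₀ + 1) - ∑ j ∈ univ.erase i₀, k j, by linear_combination -this⟩

lemma nonvanish [Nonempty σ] (m : ℕ) (hf : (((m * Fintype.card σ).factorial : ℕ) : F) ≠ 0) (N : ℕ) :
    (∀ k : ℕ, 1 ≤ k → k ≤ N → (k : F) ≠ 0) → ∀ (c : σ →₀ ℕ) (b : ℕ),
    (∀ j, c j = b ∨ c j = b + 1) →
    (∑ j, c j = m * Fintype.card σ * (Fintype.card σ - 1) + N) →
    coeff c (Dy F univ (fun _ => m) * (∑ i, X i) ^ N) ≠ 0 := by
  induction N with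
  | zero =>
    intro _ c b hb hsum
    have hce : c = ex univ (fun _ => m) := by
      have hall : ∀ j, m * (Fintype.card σ - 1) = c j := by
        have hs : ∑ j : σ, m * (Fintype.card σ - 1) = ∑ j, c j := by
          rw [hsum]; simp; ring
        rcases le_or_gt (m * (Fintype.card σ - 1)) b with h | h
        · have := (Finset.sum_eq_sum_iff_of_le (s := univ)
            (fun j _ => show m * (Fintype.card σ - 1) ≤ c j by rcases hb j with h | h <;> omega)).mp hs
          exact fun j => this j (mem_univ j)
        · have := (Finset.sum_eq_sum_iff_of_le (s := univ)
            (fun j _ => show c j ≤ m * (Fintype.card σ - 1) by rcases hb j with h | h <;> omega)).mp hs.symm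
          exact fun j => (this j (mem_univ j)).symm
      ext j
      rw [← hall, ex_apply]
      simp [mul_comm]
    have := dyson (F := F) _ (univ : Finset σ) (fun _ => m) rfl
    rw [pow_zero, mul_one, hce]
    intro h0
    rw [h0, zero_mul] at this
    apply hf
    rw [this]
    simp [mul_comm]
  | succ N ih =>
    intro hN c b hb hsum
    obtain ⟨i, -, hi⟩ := exists_max_image (univ : Finset σ) c univ_nonempty
    have hpos : 1 ≤ c i := by
      by_contra h
      have : ∑ j, c j = 0 := sum_eq_zero fun j _ => by have := hi j (mem_univ j); omega
      omega
    let c' : σ →₀ ℕ := c - Finsupp.single i 1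
    have hcc : c = c' + Finsupp.single i 1 := by
      ext x
      simp only [c', Finsupp.add_apply, Finsupp.tsub_apply, Finsupp.single_apply]
      split_ifs with h
      · subst h; omega
      · simp
    have hci : c' i + 1 = c i := by rw [hcc]; simp
    have hcj : ∀ j, j ≠ i → c' j = c j := by
      intro j hj; rw [hcc]; simp [Finsupp.single_apply, Ne.symm hj]
    have hc' : ∀ j, c' j = c' i ∨ c' j = c' i + 1 := by
      intro j
      by_cases hj : j = i
      · simp [hj]
      · rw [hcj j hj]
        have := hi j (mem_univ j)
        have := hb j
        have := hb i
        omega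
    have hs' : ∑ j, c' j = m * Fintype.card σ * (Fintype.card σ - 1) + N := by
      have : ∑ j, c j = ∑ j, c' j + 1 := by
        conv_lhs => rw [hcc]
        simp [sum_add_distrib]
      omega
    have h1 := ih (fun k h1 h2 => hN k h1 (by omega)) c' _ hc' hs'
    obtain ⟨K, hK⟩ := step (F := F) m N i c' hc'
    rw [← hcc] at hK
    intro h0
    rw [h0, mul_zero] at hK
    have := hN (N+1) (by omega) le_rfl
    push_cast at this
    exact (mul_ne_zero this h1) hK

def TopEq (d : ℕ) (P Q : MvPolynomial σ F) : Prop :=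
  P.totalDegree ≤ d ∧ Q.totalDegree ≤ d ∧ (P = Q ∨ (P - Q).totalDegree < d)

lemma TopEq.mul {d e : ℕ} {P Q P' Q' : MvPolynomial σ F} (h : TopEq d P Q) (h' : TopEq e P' Q') :
    TopEq (d + e) (P * P') (Q * Q') := by
  obtain ⟨h1, h2, h3⟩ := h
  obtain ⟨k1, k2, k3⟩ := h'
  refine ⟨(totalDegree_mul _ _).trans (by omega), (totalDegree_mul _ _).trans (by omega), ?_⟩
  have e1 := totalDegree_mul (P - Q) P'
  have e2 := totalDegree_mul Q (P' - Q')
  rcases h3 with rfl | h3 <;> rcases k3 with rfl | k3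
  · exact Or.inl rfl
  · right; rw [← mul_sub]; omega
  · right; rw [← sub_mul]; omega
  · right
    rw [show P * P' - Q * Q' = (P - Q) * P' + Q * (P' - Q') by ring]
    exact (totalDegree_add _ _).trans_lt (max_lt (by omega) (by omega))

lemma TopEq.prod {ι : Type*} (s : Finset ι) (d : ι → ℕ) (P Q : ι → MvPolynomial σ F)
    (h : ∀ i ∈ s, TopEq (d i) (P i) (Q i)) :
    TopEq (∑ i ∈ s, d i) (∏ i ∈ s, P i) (∏ i ∈ s, Q i) := by
  classical
  induction s using Finset.induction_on with
  | empty => exact ⟨by simp, by simp, Or.inl rfl⟩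
  | insert x t hx ih =>
    rw [prod_insert hx, prod_insert hx, sum_insert hx]
    exact (h x (mem_insert_self _ _)).mul (ih fun i hi => h i (mem_insert_of_mem hi))

lemma TopEq.lin (L : MvPolynomial σ F) (hL : L.totalDegree ≤ 1) (a : F) :
    TopEq 1 (L - C a) L := by
  refine ⟨(totalDegree_sub_C_le _ _).trans hL, hL, Or.inr ?_⟩
  rw [sub_sub_cancel_left, totalDegree_neg, totalDegree_C]
  exact Nat.one_pos

end RSR

theorem restricted_sumset_refined {F : Type*} [Field F] [DecidableEq F] (n m k : ℕ)
    (hn : 1 ≤ n)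
    (S : Fin n → Fin n → Finset F) (hS : ∀ i j : Fin n, i ≠ j → (S i j).card = m)
    (A : Fin n → Finset F) (hA : ∀ j, (A j).Nonempty)
    (hAk : ∀ j, (A j).card = k ∨ (A j).card = k + 1)
    (hp : ringChar F = 0 ∨
      max ((m : ℤ) * n) ((∑ j, (((A j).card : ℤ) - 1)) - m * n * (n - 1))
        < (ringChar F : ℤ)) :
    (∑ j, (((A j).card : ℤ) - 1)) - m * n * (n - 1) + 1 ≤
      (((Fintype.piFinset A).filter fun f => ∀ i j : Fin n, i ≠ j → f i - f j ∉ S i j).image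
        fun f => ∑ i, f i).card := by
  set Cs := (((Fintype.piFinset A).filter fun f => ∀ i j : Fin n, i ≠ j → f i - f j ∉ S i j).image
        fun f => ∑ i, f i) with hCs
  by_contra hcon
  push Not at hcon
  have hNe : Nonempty (Fin n) := ⟨⟨0, hn⟩⟩
  have hcard : ∀ j, 1 ≤ (A j).card := fun j => (hA j).card_pos
  let c : Fin n →₀ ℕ := Finsupp.equivFunOnFinite.symm fun j => (A j).card - 1
  have hc : ∀ j, c j = (A j).card - 1 := fun j => rfl
  have hsumc : ∑ j, (((A j).card : ℤ) - 1) = ((∑ j, c j : ℕ) : ℤ) := by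
    push_cast
    refine sum_congr rfl fun j _ => ?_
    have := hcard j
    rw [hc]; omega
  have hn1 : (m : ℤ) * n * (n - 1) = ((m * n * (n - 1) : ℕ) : ℤ) := by
    push_cast [hn]; ring
  rw [hsumc, hn1] at hcon hp
  obtain ⟨N, hN⟩ : ∃ N, ∑ j, c j = m * n * (n - 1) + N := ⟨∑ j, c j - m * n * (n-1), by omega⟩
  have hCN : Cs.card ≤ N := by omega
  have hchar : ∀ q : ℕ, 1 ≤ q → (q ≤ N ∨ q ≤ m * n) → (q : F) ≠ 0 := by
    intro q hq1 hq h0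
    have hdvd := (ringChar.spec F q).mp h0
    rcases hp with hp | hp
    · rw [hp] at hdvd; have := Nat.eq_zero_of_zero_dvd hdvd; omega
    · have := Nat.le_of_dvd (by omega) hdvd
      rw [max_lt_iff] at hp
      have h1 := hp.1
      norm_cast at h1
      omega
  have hfac : (((m * Fintype.card (Fin n)).factorial : ℕ) : F) ≠ 0 := by
    rw [Fintype.card_fin]
    have : ∀ q : ℕ, q ≤ m * n → ((q.factorial : ℕ) : F) ≠ 0 := by
      intro q
      induction q with
      | zero => simp
      | succ q ih =>
        intro hq
        rw [Nat.factorial_succ, Nat.cast_mul]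
        exact mul_ne_zero (hchar _ (by omega) (Or.inr hq)) (ih (by omega))
    exact this _ le_rfl
  have hcb : ∀ j, c j = (k - 1) ∨ c j = (k - 1) + 1 := by
    by_cases hk : k = 0
    · intro j; have := hcard j; have := hAk j; have := hc j; omega
    · intro j; have := hcard j; have := hAk j; have := hc j; omega
  have hnz := RSR.nonvanish (F := F) (σ := Fin n) m hfac N
    (fun q h1 h2 => hchar q h1 (Or.inl h2)) c _ hcb (by rw [Fintype.card_fin]; exact hN)
  let s : MvPolynomial (Fin n) F := ∑ i, MvPolynomial.X i
  have hs1 : s.totalDegree ≤ 1 := by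
    refine (MvPolynomial.totalDegree_finsetSum _ _).trans (Finset.sup_le fun i _ => ?_)
    simp
  let P : MvPolynomial (Fin n) F :=
    (∏ i, ∏ j ∈ univ.erase i, ∏ a ∈ S j i, (MvPolynomial.X j - MvPolynomial.X i - MvPolynomial.C a))
      * ((∏ a ∈ Cs, (s - MvPolynomial.C a)) * s ^ (N - Cs.card))
  have hTop : RSR.TopEq (∑ j, c j) P (RSR.Dy F univ (fun _ => m) * s ^ N) := by
    have t1 : RSR.TopEq (∑ i : Fin n, ∑ j ∈ univ.erase i, ∑ a ∈ S j i, 1)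
      (∏ i, ∏ j ∈ univ.erase i, ∏ a ∈ S j i,
        (MvPolynomial.X j - MvPolynomial.X i - MvPolynomial.C a))
      (∏ i, ∏ j ∈ univ.erase i, ∏ a ∈ S j i,
        (MvPolynomial.X j - MvPolynomial.X i : MvPolynomial (Fin n) F)) := by
      refine RSR.TopEq.prod _ _ _ _ fun i _ => RSR.TopEq.prod _ _ _ _ fun j _ =>
        RSR.TopEq.prod _ _ _ _ fun a _ => RSR.TopEq.lin _ ?_ a
      refine (MvPolynomial.totalDegree_sub _ _).trans ?_
      simp
    have t2 : RSR.TopEq (∑ a ∈ Cs, 1) (∏ a ∈ Cs, (s - MvPolynomial.C a)) (∏ a ∈ Cs, s) :=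
      RSR.TopEq.prod _ _ _ _ fun a _ => RSR.TopEq.lin _ hs1 a
    have t3 : RSR.TopEq (N - Cs.card) (s ^ (N - Cs.card)) (s ^ (N - Cs.card)) := by
      have : (s ^ (N - Cs.card)).totalDegree ≤ N - Cs.card :=
        (MvPolynomial.totalDegree_pow _ _).trans (by nlinarith)
      exact ⟨this, this, Or.inl rfl⟩
    have t := t1.mul (t2.mul t3)
    have e1 : (∏ i, ∏ j ∈ univ.erase i, ∏ a ∈ S j i,
        (MvPolynomial.X j - MvPolynomial.X i : MvPolynomial (Fin n) F))
        = RSR.Dy F univ (fun _ => m) := by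
      unfold RSR.Dy
      refine Finset.prod_congr rfl fun i _ => Finset.prod_congr rfl fun j hj => ?_
      rw [prod_const, hS j i (ne_of_mem_erase hj)]
    have e2 : (∑ i : Fin n, ∑ j ∈ univ.erase i, ∑ a ∈ S j i, 1) = m * n * (n - 1) := by
      have : ∀ i : Fin n, ∑ j ∈ univ.erase i, ∑ a ∈ S j i, 1 = (n - 1) * m := by
        intro i
        rw [sum_congr rfl (g := fun _ => m)
          (fun j hj => by rw [sum_const, hS j i (ne_of_mem_erase hj)]; simp)]
        simp
      rw [sum_congr rfl (fun i _ => this i)]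
      simp; ring
    rw [e1, e2, prod_const, ← pow_add, sum_const, smul_eq_mul, mul_one,
      Nat.add_sub_cancel' hCN, ← hN] at t
    exact t
  have hdeg : c.degree = ∑ j, c j := Finsupp.degree_eq_sum c
  have hcoef : MvPolynomial.coeff c P ≠ 0 := by
    have : MvPolynomial.coeff c P = MvPolynomial.coeff c (RSR.Dy F univ (fun _ => m) * s ^ N) := by
      rcases hTop.2.2 with h | h
      · rw [h]
      · rw [← sub_eq_zero, ← MvPolynomial.coeff_sub]
        apply MvPolynomial.coeff_eq_zero_of_totalDegree_lt
        rw [← hdeg] at h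
        exact h
    rw [this]; exact hnz
  have hPd : P.totalDegree = c.degree := by
    refine le_antisymm (hdeg ▸ hTop.1) ?_
    exact MvPolynomial.le_totalDegree (MvPolynomial.mem_support_iff.mpr hcoef)
  obtain ⟨x, hx, hxP⟩ := MvPolynomial.combinatorial_nullstellensatz_exists_eval_nonzero P c hcoef
    hPd A (fun i => by have := hcard i; rw [hc]; omega)
  apply hxP
  by_cases hgood : ∀ i j : Fin n, i ≠ j → x i - x j ∉ S i j
  · have hmem : ∑ i, x i ∈ Cs :=
      mem_image.mpr ⟨x, mem_filter.mpr ⟨Fintype.mem_piFinset.mpr hx, hgood⟩, rfl⟩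
    have : MvPolynomial.eval x (∏ a ∈ Cs, (s - MvPolynomial.C a)) = 0 := by
      rw [map_prod]
      exact prod_eq_zero hmem (by simp [s])
    simp only [P]
    rw [map_mul, map_mul, this, zero_mul, mul_zero]
  · push Not at hgood
    obtain ⟨i, j, hij, hmem⟩ := hgood
    simp only [P]
    rw [map_mul, map_prod, prod_eq_zero (mem_univ j), zero_mul]
    rw [map_prod]
    refine prod_eq_zero (i := i) (by simp [hij]) ?_
    rw [map_prod]
    exact prod_eq_zero hmem (by simp)
end

section
/- Let F be a field, n ≥ 1, m ≥ 0, and S_{ij} (1 ≤ i ≠ j ≤ n) subsets of F each of cardinality m. Let A_1, ..., A_n be finite subsets of F with |A_1| = ... = |A_n| = k. Define C = {a_1 + ... + a_n : a_j ∈ A_j, a_i − a_j ∉ S_{ij} if i ≠ j}. If p(F) > mn, then |C| ≥ min{p(F), n(k−1) − mn(n−1) + 1}. -/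
section RS
open MvPolynomial

def RSTop {σ R : Type*} [CommRing R] (d : ℕ) (f h : MvPolynomial σ R) : Prop :=
  f.totalDegree ≤ d ∧ h.totalDegree ≤ d ∧ ∀ e : σ →₀ ℕ, e.degree = d → coeff e f = coeff e h

theorem RSTop.one {σ R : Type*} [CommRing R] : RSTop 0 (1 : MvPolynomial σ R) 1 :=
  ⟨by simp, by simp, fun _ _ => rfl⟩

theorem RSTop.mul {σ R : Type*} [CommRing R] {d d' : ℕ} {f h f' h' : MvPolynomial σ R}
    (H : RSTop d f h) (H' : RSTop d' f' h') : RSTop (d + d') (f * f') (h * h') := by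
  classical
  refine ⟨(totalDegree_mul _ _).trans (add_le_add H.1 H'.1),
    (totalDegree_mul _ _).trans (add_le_add H.2.1 H'.2.1), fun e he => ?_⟩
  rw [coeff_mul, coeff_mul]
  refine Finset.sum_congr rfl fun x hx => ?_
  have hs : x.1.degree + x.2.degree = d + d' := by
    rw [← he, ← (Finset.HasAntidiagonal.mem_antidiagonal.1 hx), map_add]
  rcases lt_trichotomy x.1.degree d with h1 | h1 | h1
  · have h2 : d' < x.2.degree := by omega
    rw [coeff_eq_zero_of_totalDegree_lt (f := f') (d := x.2) (lt_of_le_of_lt H'.1 h2),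
      coeff_eq_zero_of_totalDegree_lt (f := h') (d := x.2) (lt_of_le_of_lt H'.2.1 h2)]
    simp
  · rw [H.2.2 _ h1, H'.2.2 _ (by omega)]
  · rw [coeff_eq_zero_of_totalDegree_lt (f := f) (d := x.1) (lt_of_le_of_lt H.1 h1),
      coeff_eq_zero_of_totalDegree_lt (f := h) (d := x.1) (lt_of_le_of_lt H.2.1 h1)]
    simp

theorem RSTop.prod {σ R ι : Type*} [CommRing R] (s : Finset ι) (d : ι → ℕ)
    (f h : ι → MvPolynomial σ R) (H : ∀ i ∈ s, RSTop (d i) (f i) (h i)) :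
    RSTop (∑ i ∈ s, d i) (∏ i ∈ s, f i) (∏ i ∈ s, h i) := by
  classical
  induction s using Finset.induction_on with
  | empty => simpa using RSTop.one
  | insert a s ha ih =>
    rw [Finset.sum_insert ha, Finset.prod_insert ha, Finset.prod_insert ha]
    exact (H a (by simp)).mul (ih fun i hi => H i (by simp [hi]))

theorem RSTop.lin {σ R : Type*} [CommRing R] (l : MvPolynomial σ R) (hl : l.totalDegree ≤ 1)
    (c : R) : RSTop 1 (l - C c) l := by
  classical
  refine ⟨(totalDegree_sub _ _).trans (by simp [hl]), hl, fun e he => ?_⟩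
  rw [coeff_sub, coeff_C, if_neg, sub_zero]
  rintro rfl
  simp at he

theorem RSTop.linprod {σ R ι : Type*} [CommRing R] (l : MvPolynomial σ R) (hl : l.totalDegree ≤ 1)
    (s : Finset ι) (g : ι → R) : RSTop s.card (∏ t ∈ s, (l - C (g t))) (l ^ s.card) := by
  have := RSTop.prod s (fun _ => 1) (fun t => l - C (g t)) (fun _ => l)
    (fun t _ => RSTop.lin l hl (g t))
  simpa using this

theorem RSTop.refl {σ R : Type*} [CommRing R] {d : ℕ} {f : MvPolynomial σ R}
    (h : f.totalDegree ≤ d) : RSTop d f f := ⟨h, h, fun _ _ => rfl⟩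

/-- the top form -/
noncomputable def RSH (R : Type*) [CommRing R] (n m N : ℕ) : MvPolynomial (Fin n) R :=
  (∏ i : Fin n, ∏ j : Fin n, if i = j then 1 else (X i - X j) ^ m) * (∑ i, X i) ^ N

noncomputable def RSG {R ι : Type*} [CommRing R] {n : ℕ} (g : ι → R)
    (T : Fin n → Fin n → Finset ι) (U : Finset ι) (e : ℕ) : MvPolynomial (Fin n) R :=
  (∏ i : Fin n, ∏ j : Fin n, if i = j then 1 else ∏ t ∈ T i j, (X i - X j - C (g t))) *
    ((∏ c ∈ U, (∑ i, X i - C (g c))) * (∑ i, X i) ^ e)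

theorem RSX {R : Type*} [CommRing R] {n : ℕ} (i : Fin n) :
    (X i : MvPolynomial (Fin n) R).totalDegree ≤ 1 := by
  exact (totalDegree_monomial_le _ _).trans (by simp)

theorem RSG_top {R ι : Type*} [CommRing R] {n m : ℕ} (g : ι → R)
    (T : Fin n → Fin n → Finset ι) (hT : ∀ i j, i ≠ j → (T i j).card = m) (U : Finset ι) (e : ℕ) :
    RSTop (m * n * (n - 1) + (U.card + e)) (RSG g T U e) (RSH R n m (U.card + e)) := by
  have hs : (∑ i : Fin n, X i : MvPolynomial (Fin n) R).totalDegree ≤ 1 :=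
    (totalDegree_finsetSum _ _).trans (Finset.sup_le fun i _ => RSX i)
  unfold RSG RSH
  refine RSTop.mul ?_ ?_
  · have key : ∑ i : Fin n, ∑ j : Fin n, (if i = j then 0 else m) = m * n * (n - 1) := by
      have : ∀ i : Fin n, ∑ j : Fin n, (if i = j then 0 else m) = (n - 1) * m := by
        intro i
        rw [← Finset.add_sum_erase _ _ (Finset.mem_univ i),
          Finset.sum_congr rfl (g := fun _ => m)]
        · simp
        · intro j hj
          rw [if_neg (Finset.ne_of_mem_erase hj).symm]
      rw [Finset.sum_congr rfl fun i _ => this i]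
      simp
      ring
    rw [← key]
    refine RSTop.prod _ _ _ _ fun i _ => RSTop.prod _ _ _ _ fun j _ => ?_
    split_ifs with hij
    · exact RSTop.one
    · have := RSTop.linprod (X i - X j : MvPolynomial (Fin n) R)
        ((totalDegree_sub _ _).trans (max_le (RSX i) (RSX j))) (T i j) g
      rwa [hT i j hij] at this
  · rw [pow_add]
    refine RSTop.mul (RSTop.linprod _ hs U g) (RSTop.refl ?_)
    exact (totalDegree_pow _ _).trans (by nlinarith)

theorem RSH_map {R : Type*} [CommRing R] (n m N : ℕ) :
    RSH R n m N = map (Int.castRingHom R) (RSH ℤ n m N) := by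
  unfold RSH
  simp only [map_mul, map_prod, map_pow, map_sum, map_X]
  congr 1
  refine Finset.prod_congr rfl fun i _ => Finset.prod_congr rfl fun j _ => ?_
  split_ifs <;> simp

theorem RSH_coeff {R : Type*} [CommRing R] (n m N : ℕ) (d : Fin n →₀ ℕ) :
    coeff d (RSH R n m N) = ((coeff d (RSH ℤ n m N) : ℤ) : R) := by
  rw [RSH_map, coeff_map]; rfl

theorem RS_null {R : Type*} [CommRing R] [IsDomain R] {n : ℕ} (f : MvPolynomial (Fin n) R)
    (d : Fin n →₀ ℕ) (hd : f.totalDegree ≤ d.degree) (A : Fin n → Finset R)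
    (hA : ∀ i, d i < (A i).card) (h0 : ∀ x : Fin n → R, (∀ i, x i ∈ A i) → eval x f = 0) :
    coeff d f = 0 := by
  by_contra hc
  obtain ⟨s, hs, hs'⟩ := combinatorial_nullstellensatz_exists_eval_nonzero f d hc
    (le_antisymm hd (le_totalDegree (mem_support_iff.2 hc))) A hA
  exact hs' (h0 s hs)

/-- coefficient formula with a single nonvanishing point -/
theorem RS_coeff {n : ℕ} (f : MvPolynomial (Fin n) ℚ)
    (d : Fin n →₀ ℕ) (hd : f.totalDegree ≤ d.degree) (x0 : Fin n → ℕ) (hx0 : ∀ i, x0 i ≤ d i)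
    (h0 : ∀ x : Fin n → ℕ, (∀ i, x i ≤ d i) → x ≠ x0 → eval (fun i => (x i : ℚ)) f = 0) :
    coeff d f * ((∏ i, ∏ s ∈ (Finset.range (d i + 1)).erase (x0 i), ((x0 i : ℤ) - (s : ℤ)) : ℤ) : ℚ)
      = eval (fun i => (x0 i : ℚ)) f := by
  classical
  set q : MvPolynomial (Fin n) ℚ :=
    ∏ i, ∏ s ∈ (Finset.range (d i + 1)).erase (x0 i), (X i - C (s : ℚ)) with hq
  set D : ℤ := ∏ i, ∏ s ∈ (Finset.range (d i + 1)).erase (x0 i), ((x0 i : ℤ) - (s : ℤ)) with hD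
  have hD0 : (D : ℚ) ≠ 0 := by
    rw [Int.cast_ne_zero, hD]
    refine Finset.prod_ne_zero_iff.2 fun i _ => Finset.prod_ne_zero_iff.2 fun s hs => ?_
    have := Finset.ne_of_mem_erase hs
    omega
  have hcard : ∀ i, ((Finset.range (d i + 1)).erase (x0 i)).card = d i := by
    intro i
    rw [Finset.card_erase_of_mem (by simp; have := hx0 i; omega)]
    simp
  have hqe : eval (fun i => (x0 i : ℚ)) q = D := by
    simp [hq, hD, map_prod]
  have hqtop : RSTop d.degree q (monomial d 1) := by
    have := RSTop.prod (Finset.univ : Finset (Fin n)) (fun i => d i)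
      (fun i => ∏ s ∈ (Finset.range (d i + 1)).erase (x0 i), (X i - C (s : ℚ)))
      (fun i => X i ^ d i) (fun i _ => by
        have := RSTop.linprod (X i : MvPolynomial (Fin n) ℚ) (RSX i)
          ((Finset.range (d i + 1)).erase (x0 i)) (fun s : ℕ => (s : ℚ))
        rwa [hcard] at this)
    rw [monomial_eq, Finsupp.prod_fintype _ _ (by simp), Finsupp.degree_eq_sum]
    rw [C_1, one_mul]
    exact this
  have hqc : coeff d q = 1 := by rw [hqtop.2.2 d rfl]; simp
  set c : ℚ := eval (fun i => (x0 i : ℚ)) f / D with hc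
  have := RS_null (f - C c * q) d ?_ (fun i => (Finset.range (d i + 1)).image (fun s : ℕ => (s : ℚ)))
    ?_ ?_
  · rw [coeff_sub, coeff_C_mul, hqc, sub_eq_zero, mul_one] at this
    rw [this, hc]
    field_simp
  · refine (totalDegree_sub _ _).trans (max_le hd ?_)
    refine (totalDegree_mul _ _).trans ?_
    simpa using hqtop.1
  · intro i
    rw [Finset.card_image_of_injective _ Nat.cast_injective]
    simp
  · intro x hx
    simp only [Finset.mem_image, Finset.mem_range] at hx
    choose y hy hyx using hx
    obtain rfl : (fun i => (y i : ℚ)) = x := funext hyx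
    rw [map_sub, map_mul, eval_C]
    by_cases hyx0 : y = x0
    · subst hyx0
      rw [hqe, hc]
      field_simp
      simp
    · rw [h0 y (fun i => by have := hy i; omega) hyx0]
      obtain ⟨i, hi⟩ := Function.ne_iff.1 hyx0
      have : eval (fun i => (y i : ℚ)) q = 0 := by
        rw [hq, map_prod]
        refine Finset.prod_eq_zero (Finset.mem_univ i) ?_
        rw [map_prod]
        refine Finset.prod_eq_zero (i := y i) ?_ (by simp)
        simp [hi, hy i]
      rw [this]; simp
theorem RS_comb {n : ℕ} (m : ℕ) (B x : Fin n → ℕ) (hx : ∀ i, x i ≤ B i)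
    (hB : ∀ i j : Fin n, B j ≤ B i + (if i < j then 0 else 1))
    (hsep : ∀ i j : Fin n, i < j → x j + m + 1 ≤ x i ∨ x i + m ≤ x j) :
    (∑ i : Fin n, m * (i : ℕ) ≤ ∑ i, x i) ∧
    (∑ i, x i + ∑ i : Fin n, m * (i : ℕ) ≤ ∑ i, B i) ∧
    (∑ i, x i = ∑ i : Fin n, m * (i : ℕ) → ∀ i, x i = m * i) := by
  obtain ⟨σ, hσ⟩ : ∃ σ, σ = Tuple.sort x := ⟨_, rfl⟩
  obtain ⟨hmono, hst⟩ := Tuple.eq_sort_iff.1 hσ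
  have step : ∀ s t : Fin n, s < t →
      x (σ s) + m + (if σ s < σ t then 0 else 1) ≤ x (σ t) := by
    intro s t hst'
    have h1 : x (σ s) ≤ x (σ t) := hmono hst'.le
    have h2 := hst s t hst'
    have h3 : σ s ≠ σ t := fun h => hst'.ne (σ.injective h)
    rcases lt_or_gt_of_ne h3 with h | h
    · rw [if_pos h]
      rcases hsep _ _ h with h' | h' <;> omega
    · rw [if_neg h.not_gt]
      rcases hsep _ _ h with h' | h'
      · omega
      · have : x (σ s) ≠ x (σ t) := fun he => absurd (h2 he) h.not_gt
        omega
  have lo : ∀ k (hk : k < n), m * k ≤ x (σ ⟨k, hk⟩) := by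
    intro k
    induction k with
    | zero => simp
    | succ k ih =>
      intro hk
      have := ih (by omega)
      have h2 := step ⟨k, by omega⟩ ⟨k + 1, hk⟩ (by simp [Fin.lt_def])
      rw [mul_add]; omega
  have hi : ∀ k (hk : k < n), x (σ ⟨n - 1 - k, by omega⟩) + m * k ≤ B (σ ⟨n - 1 - k, by omega⟩) := by
    intro k
    induction k with
    | zero => intro hk; simpa using hx _
    | succ k ih =>
      intro hk
      have h1 := ih (by omega)
      have h2 := step ⟨n - 1 - (k + 1), by omega⟩ ⟨n - 1 - k, by omega⟩
        (by simp only [Fin.lt_def]; omega)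
      have h3 := hB (σ ⟨n - 1 - (k + 1), by omega⟩) (σ ⟨n - 1 - k, by omega⟩)
      rw [mul_add]; omega
  have lo' : ∀ t : Fin n, m * (t : ℕ) ≤ x (σ t) := fun t => lo t t.2
  have hi' : ∀ t : Fin n, x (σ t) + m * ((Fin.rev t : Fin n) : ℕ) ≤ B (σ t) := by
    intro t
    have := hi (Fin.rev t) (Fin.rev t).2
    have e : (⟨n - 1 - (Fin.rev t : Fin n), by omega⟩ : Fin n) = t := by
      ext; simp [Fin.val_rev]; omega
    rwa [e] at this
  have sx : ∑ i, x (σ i) = ∑ i, x i := Equiv.sum_comp σ x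
  have sB : ∑ i, B (σ i) = ∑ i, B i := Equiv.sum_comp σ B
  have sr : ∑ t : Fin n, m * ((Fin.rev t : Fin n) : ℕ) = ∑ i : Fin n, m * (i : ℕ) :=
    Equiv.sum_comp Fin.revPerm (fun i : Fin n => m * (i : ℕ))
  refine ⟨?_, ?_, ?_⟩
  · rw [← sx]; exact Finset.sum_le_sum fun t _ => lo' t
  · rw [← sx, ← sB, ← sr, ← Finset.sum_add_distrib]; exact Finset.sum_le_sum fun t _ => hi' t
  · intro heq
    rw [← sx] at heq
    have hall := (Finset.sum_eq_sum_iff_of_le fun t _ => lo' t).1 heq.symm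
    have hs : StrictMono σ := by
      obtain _ | n := n
      · exact fun a => a.elim0
      rw [Fin.strictMono_iff_lt_succ]
      intro i
      by_contra hcon
      have h1 := step i.castSucc i.succ (Fin.castSucc_lt_succ)
      rw [if_neg hcon, ← hall _ (Finset.mem_univ _), ← hall _ (Finset.mem_univ _)] at h1
      simp [mul_add] at h1
    have hid : ∀ t, σ t = t := by
      intro t
      have := Subsingleton.elim (hs.orderIsoOfSurjective σ σ.surjective) (OrderIso.refl _)
      exact congrArg (fun e : Fin n ≃o Fin n => e t) this
    intro i
    have := hall i (Finset.mem_univ i)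
    rw [hid] at this
    exact this.symm

theorem RS_M (n m : ℕ) : (∑ i : Fin n, m * (i : ℕ)) * 2 = m * n * (n - 1) := by
  rw [← Finset.mul_sum, Fin.sum_univ_eq_sum_range (fun i => i) n, mul_assoc,
    Finset.sum_range_id_mul_two, mul_assoc]

theorem RS_int {F : Type*} [Field F] (n m N : ℕ) (d : Fin n →₀ ℕ)
    (h1 : ∀ t : ℕ, 1 ≤ t → t ≤ m * n → (t : F) ≠ 0)
    (h2 : ∀ t : ℕ, 1 ≤ t → t ≤ N → (t : F) ≠ 0)
    (hB : ∀ i j : Fin n, d j ≤ d i + (if i < j then 0 else 1))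
    (hd : ∑ i, d i = m * n * (n - 1) + N) (hx0 : ∀ i : Fin n, m * (i : ℕ) ≤ d i) :
    coeff d (RSH F n m N) ≠ 0 := by
  classical
  have hM := RS_M n m
  set M : ℕ := ∑ i : Fin n, m * (i : ℕ) with hMdef
  set T : Fin n → Fin n → Finset ℤ :=
    fun i j => if i < j then Finset.Icc 1 (m : ℤ) else Finset.Ico 0 (m : ℤ) with hT
  have hTc : ∀ i j, i ≠ j → (T i j).card = m := by
    intro i j _
    simp only [hT]
    split_ifs <;> simp
  set U : Finset ℤ := Finset.Icc ((M : ℤ) + 1) (M + N) with hU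
  have hUc : U.card = N := by simp [hU]
  set G : MvPolynomial (Fin n) ℚ := RSG (fun z : ℤ => (z : ℚ)) T U 0 with hG
  have hdd : d.degree = m * n * (n - 1) + N := by rw [Finsupp.degree_eq_sum, hd]
  have htop := RSG_top (fun z : ℤ => (z : ℚ)) T hTc U 0
  rw [hUc, add_zero, ← hdd] at htop
  have hev : ∀ x : Fin n → ℕ, eval (fun i => (x i : ℚ)) G =
      (((∏ i : Fin n, ∏ j : Fin n, if i = j then 1 else ∏ t ∈ T i j, ((x i : ℤ) - x j - t)) *
        ∏ c ∈ U, (∑ i, (x i : ℤ) - c) : ℤ) : ℚ) := by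
    intro x
    simp only [hG, RSG, map_mul, map_prod, map_sum, map_sub, eval_X, eval_C, pow_zero, mul_one,
      Int.cast_mul, Int.cast_prod, Int.cast_sub, Int.cast_sum, Int.cast_natCast]
    congr 1
    refine Finset.prod_congr rfl fun i _ => Finset.prod_congr rfl fun j _ => ?_
    split_ifs <;> simp
  have key := RS_coeff G d htop.1 (fun i => m * (i : ℕ)) hx0 ?_
  · rw [htop.2.2 d rfl, RSH_coeff, hev, ← Int.cast_mul, Int.cast_inj] at key
    have key' := congrArg (Int.cast : ℤ → F) key
    intro h0
    rw [RSH_coeff] at h0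
    rw [Int.cast_mul, h0, zero_mul] at key'
    refine absurd key'.symm ?_
    have nz : ∀ (K : ℕ), (∀ t : ℕ, 1 ≤ t → t ≤ K → (t : F) ≠ 0) → ∀ z : ℤ, z ≠ 0 → -K ≤ z → z ≤ K →
        (z : F) ≠ 0 := by
      intro K hK z hz hl hu
      rcases le_total 0 z with h | h
      · lift z to ℕ using h
        exact_mod_cast hK z (by omega) (by omega)
      · obtain ⟨w, rfl⟩ : ∃ w : ℕ, z = -w := ⟨z.natAbs, by omega⟩
        rw [Int.cast_neg, Int.cast_natCast]
        exact neg_ne_zero.2 (hK w (by omega) (by omega))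
    rw [Int.cast_mul, Int.cast_prod]
    refine mul_ne_zero ?_ ?_
    · refine Finset.prod_ne_zero_iff.2 fun i _ => ?_
      rw [Int.cast_prod]
      refine Finset.prod_ne_zero_iff.2 fun j _ => ?_
      split_ifs with hij
      · simp
      rw [Int.cast_prod]
      refine Finset.prod_ne_zero_iff.2 fun t ht => ?_
      have bnd : ∀ a b : Fin n, a < b → m * (a : ℕ) + m ≤ m * (b : ℕ) ∧ m * (b : ℕ) + m ≤ m * n := by
        intro a b hab
        have hb := b.2
        rw [Fin.lt_def] at hab
        constructor
        · calc m * (a : ℕ) + m = m * (a + 1) := by ring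
            _ ≤ _ := Nat.mul_le_mul_left _ hab
        · calc m * (b : ℕ) + m = m * (b + 1) := by ring
            _ ≤ _ := Nat.mul_le_mul_left _ hb
      simp only [hT] at ht
      rcases lt_or_gt_of_ne hij with h | h
      · rw [if_pos h, Finset.mem_Icc] at ht
        have := bnd i j h
        apply nz (m * n) h1 <;> omega
      · rw [if_neg h.not_gt, Finset.mem_Ico] at ht
        have := bnd j i h
        apply nz (m * n) h1 <;> omega
    · rw [Int.cast_prod]
      refine Finset.prod_ne_zero_iff.2 fun c hc => ?_
      rw [hU, Finset.mem_Icc] at hc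
      have : ∑ i : Fin n, ((m * (i : ℕ) : ℕ) : ℤ) = M := by rw [hMdef]; push_cast; rfl
      rw [this]
      apply nz N h2 <;> omega
  · intro x hx hne
    rw [hev]
    by_contra hcon
    replace hcon := Int.cast_ne_zero.1 hcon
    obtain ⟨hc1, hc2⟩ := mul_ne_zero_iff.1 hcon
    have hsep : ∀ i j : Fin n, i < j → x j + m + 1 ≤ x i ∨ x i + m ≤ x j := by
      intro i j hij
      by_contra! hns
      have a1 := Finset.prod_ne_zero_iff.1 (Finset.prod_ne_zero_iff.1 hc1 i (Finset.mem_univ _)) j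
        (Finset.mem_univ _)
      have a2 := Finset.prod_ne_zero_iff.1 (Finset.prod_ne_zero_iff.1 hc1 j (Finset.mem_univ _)) i
        (Finset.mem_univ _)
      rw [if_neg hij.ne, Finset.prod_ne_zero_iff] at a1
      rw [if_neg hij.ne', Finset.prod_ne_zero_iff] at a2
      rcases lt_or_ge (x j) (x i) with h | h
      · refine a1 ((x i : ℤ) - x j) ?_ (by ring)
        simp only [hT]
        rw [if_pos hij, Finset.mem_Icc]
        omega
      · refine a2 ((x j : ℤ) - x i) ?_ (by ring)
        simp only [hT]
        rw [if_neg hij.not_gt, Finset.mem_Ico]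
        omega
    obtain ⟨b1, b2, b3⟩ := RS_comb m (fun i => d i) x hx hB hsep
    refine hne (funext (b3 ?_))
    by_contra hne'
    refine Finset.prod_ne_zero_iff.1 hc2 (∑ i, (x i : ℤ)) ?_ (by ring)
    rw [hU, Finset.mem_Icc, ← Nat.cast_sum]
    rw [← hMdef] at b1 b2 hne'
    omega

theorem RS_core {F : Type*} [Field F] [DecidableEq F] (n m k N : ℕ)
    (hn : 1 ≤ n)
    (S : Fin n → Fin n → Finset F) (hS : ∀ i j : Fin n, i ≠ j → (S i j).card = m)
    (A : Fin n → Finset F) (hAk : ∀ j, (A j).card = k)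
    (h1 : ∀ t : ℕ, 1 ≤ t → t ≤ m * n → (t : F) ≠ 0)
    (h2 : ∀ t : ℕ, 1 ≤ t → t ≤ N → (t : F) ≠ 0)
    (hk : 1 ≤ k) (hN : m * n * (n - 1) + N ≤ n * (k - 1)) :
    N + 1 ≤ (((Fintype.piFinset A).filter fun f => ∀ i j : Fin n, i ≠ j → f i - f j ∉ S i j).image
          fun f => ∑ i, f i).card := by
  by_contra! hlt
  set U := ((Fintype.piFinset A).filter fun f => ∀ i j : Fin n, i ≠ j → f i - f j ∉ S i j).image
          fun f => ∑ i, f i with hU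
  obtain ⟨e, he⟩ : ∃ e, U.card + e = N := ⟨N - U.card, by omega⟩
  set W := m * n * (n - 1) + N with hW
  set q := W / n with hq
  set r := W % n with hr
  have hqr : n * q + r = W := Nat.div_add_mod W n
  have hrn : r < n := Nat.mod_lt _ hn
  set d : Fin n →₀ ℕ := Finsupp.equivFunOnFinite.symm (fun i => q + if (i : ℕ) < r then 1 else 0)
    with hd
  have hdi : ∀ i, d i = q + if (i : ℕ) < r then 1 else 0 := fun i => rfl
  have hds : ∑ i, d i = W := by
    simp only [hdi]
    rw [Finset.sum_add_distrib, Fin.sum_univ_eq_sum_range (fun i => if i < r then 1 else 0) n,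
      ← Finset.sum_filter, Finset.sum_const, Finset.sum_const]
    have : (Finset.range n).filter (fun i => i < r) = Finset.range r := by
      ext a; simp; omega
    rw [this]; simp [hqr]
  have hq2 : m * (n - 1) ≤ q := by
    rw [hq, Nat.le_div_iff_mul_le hn, hW]
    nlinarith
  have hdk : ∀ i, d i < (A i).card := by
    intro i
    rw [hAk, hdi]
    have hqk : q ≤ k - 1 := by
      by_contra! h
      have : n * (k - 1 + 1) ≤ n * q := Nat.mul_le_mul_left _ h
      rw [mul_add] at this
      omega
    split_ifs with hir
    · have : q ≠ k - 1 := by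
        intro h
        rw [← h] at hN
        omega
      omega
    · omega
  have hc : coeff d (RSH F n m N) ≠ 0 := by
    refine RS_int n m N d h1 h2 ?_ hds ?_
    · intro i j
      rw [hdi, hdi]
      split_ifs <;> omega
    · intro i
      rw [hdi]
      have := i.2
      have : m * (i : ℕ) ≤ m * (n - 1) := Nat.mul_le_mul_left _ (by omega)
      omega
  have htop := RSG_top (fun z : F => z) S hS U e
  rw [he, ← hW, ← hds, ← Finsupp.degree_eq_sum] at htop
  refine hc ?_
  rw [← htop.2.2 d rfl]
  refine RS_null _ d htop.1 A hdk ?_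
  intro x hx
  by_contra hne
  simp only [RSG, map_mul, map_prod, map_sum, map_sub, eval_X, eval_C] at hne
  obtain ⟨hc1, hc2⟩ := mul_ne_zero_iff.1 hne
  have hc3 := (mul_ne_zero_iff.1 hc2).1
  refine Finset.prod_ne_zero_iff.1 hc3 (∑ i, x i) ?_ (sub_self _)
  rw [hU, Finset.mem_image]
  refine ⟨x, ?_, rfl⟩
  rw [Finset.mem_filter, Fintype.mem_piFinset]
  refine ⟨hx, fun i j hij hmem => ?_⟩
  have a1 := Finset.prod_ne_zero_iff.1 (Finset.prod_ne_zero_iff.1 hc1 i (Finset.mem_univ _)) j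
        (Finset.mem_univ _)
  rw [if_neg hij, map_prod, Finset.prod_ne_zero_iff] at a1
  exact a1 _ hmem (by simp)

end RS



/-- Main theorem (Theorem 3 of Zhao): if `p(F) > mn` then
`|C| ≥ min{p(F), n(k-1) - mn(n-1) + 1}`; `ringChar F = 0` encodes `p(F)` infinite. -/
theorem restricted_sumset_min_bound {F : Type*} [Field F] [DecidableEq F] (n m k : ℕ)
    (hn : 1 ≤ n)
    (S : Fin n → Fin n → Finset F) (hS : ∀ i j : Fin n, i ≠ j → (S i j).card = m)
    (A : Fin n → Finset F) (hAk : ∀ j, (A j).card = k)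
    (hp : ringChar F = 0 ∨ m * n < ringChar F) :
    (ringChar F = 0 →
      (n : ℤ) * (k - 1) - m * n * (n - 1) + 1 ≤
        (((Fintype.piFinset A).filter fun f => ∀ i j : Fin n, i ≠ j → f i - f j ∉ S i j).image
          fun f => ∑ i, f i).card) ∧
    (ringChar F ≠ 0 →
      min ((ringChar F : ℤ)) ((n : ℤ) * (k - 1) - m * n * (n - 1) + 1) ≤
        (((Fintype.piFinset A).filter fun f => ∀ i j : Fin n, i ≠ j → f i - f j ∉ S i j).image
          fun f => ∑ i, f i).card) := by
  have hk : ∀ N : ℕ, (N : ℤ) ≤ (n : ℤ) * (k - 1) - m * n * (n - 1) →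
      1 ≤ k ∧ m * n * (n - 1) + N ≤ n * (k - 1) := by
    intro N hN
    obtain ⟨n, rfl⟩ : ∃ n', n = n' + 1 := ⟨n - 1, by omega⟩
    have h1 : 1 ≤ k := by
      by_contra! h
      obtain rfl : k = 0 := by omega
      push_cast at hN
      have : (0 : ℤ) ≤ m * (n + 1) * n := by positivity
      nlinarith
    refine ⟨h1, ?_⟩
    obtain ⟨k, rfl⟩ : ∃ k', k = k' + 1 := ⟨k - 1, by omega⟩
    push_cast at hN
    simp only [Nat.add_sub_cancel]
    zify
    linarith
  have hchar : ∀ t : ℕ, (t : F) = 0 → ringChar F ∣ t := fun t => (ringChar.spec F t).1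
  have h1 : ∀ t : ℕ, 1 ≤ t → t ≤ m * n → (t : F) ≠ 0 := by
    intro t ht ht' h0
    rcases hp with hp | hp
    · have := hchar t h0
      rw [hp, zero_dvd_iff] at this
      omega
    · have := Nat.le_of_dvd ht (hchar t h0)
      omega
  constructor
  · intro h0
    rcases lt_or_ge ((n : ℤ) * (k - 1) - m * n * (n - 1)) 0 with hneg | hpos
    · exact le_trans (by omega) (Int.natCast_nonneg _)
    · obtain ⟨N, hN⟩ := Int.eq_ofNat_of_zero_le hpos
      obtain ⟨ha, hb⟩ := hk N hN.ge
      have := RS_core n m k N hn S hS A hAk h1 (fun t ht _ h => by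
        have := hchar t h
        rw [h0, zero_dvd_iff] at this
        omega) ha hb
      rw [hN]
      exact_mod_cast this
  · intro h0
    rcases lt_or_ge ((n : ℤ) * (k - 1) - m * n * (n - 1)) 0 with hneg | hpos
    · exact le_trans (min_le_right _ _) (le_trans (by omega) (Int.natCast_nonneg _))
    · obtain ⟨N, hN⟩ := Int.eq_ofNat_of_zero_le hpos
      obtain ⟨ha, hb⟩ := hk (min N (ringChar F - 1)) (by rw [hN]; exact_mod_cast min_le_left _ _)
      have := RS_core n m k (min N (ringChar F - 1)) hn S hS A hAk h1 (fun t ht ht' h => by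
        have := Nat.le_of_dvd ht (hchar t h)
        have := ht'.trans (min_le_right _ _)
        omega) ha hb
      rw [hN]
      refine le_trans ?_ (Int.ofNat_le.2 this)
      omega
end

section
/- Let p be a prime, F = Z/pZ, S ⊆ F with |S| = m ≥ 1, and A ⊆ F with |A| ≥ √(4mp + 4m(m−3) + 2) − m + 1. Set n = ⌊(|A| − 1 + m)/(2m)⌋. Then every element of F can be written as a_1 + ... + a_n with all a_j ∈ A and a_i − a_j ∉ S whenever 1 ≤ i ≠ j ≤ n. -/
open Finset

namespace ZRep
open MvPolynomial

set_option linter.unusedSectionVars false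
set_option linter.unusedSimpArgs false

variable {σ : Type} [Fintype σ] [DecidableEq σ] {R : Type} [CommRing R]

def asc (a : R) (k : ℕ) : R := ∏ j ∈ range k, (a + j)

lemma asc_zero (a : R) : asc a 0 = 1 := by simp [asc]

lemma asc_succ (a : R) (k : ℕ) : asc a (k+1) = asc a k * (a + k) := by
  simp [asc, prod_range_succ]

lemma asc_succ' (a : R) (k : ℕ) : asc a (k+1) = a * asc (a+1) k := by
  induction k with
  | zero => simp [asc]
  | succ k ih => rw [asc_succ, ih, asc_succ]; push_cast; ring

lemma asc_shift (a : R) (k : ℕ) : asc (a+1) (k+1) = asc a (k+1) + (k+1) * asc (a+1) k := by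
  rw [asc_succ, asc_succ']; ring

noncomputable def E (b : σ → R) : MvPolynomial σ R →ₗ[R] R :=
  (basisMonomials σ R).constr R (fun α => ∏ i, asc (b i) (α i))

lemma E_monomial (b : σ → R) (α : σ →₀ ℕ) (r : R) :
    E b (monomial α r) = r * ∏ i, asc (b i) (α i) := by
  have h : monomial α r = r • (basisMonomials σ R α) := by simp [smul_monomial]
  rw [h, map_smul, E, Module.Basis.constr_basis, smul_eq_mul]

lemma E_X_mul (b : σ → R) (i : σ) (f : MvPolynomial σ R) :
    E b (X i * f) = b i * E (b + Pi.single i 1) f := by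
  have hci : (b + Pi.single i 1 : σ → R) i = b i + 1 := by simp
  have hcj : ∀ x, x ≠ i → (b + Pi.single i 1 : σ → R) x = b x := fun x hx => by simp [hx]
  generalize b + Pi.single i 1 = c at hci hcj ⊢
  induction f using MvPolynomial.induction_on' with
  | add p q hp hq => rw [mul_add, map_add, map_add, hp, hq, mul_add]
  | monomial α r =>
    have h : X i * monomial α r = monomial (α + Finsupp.single i 1) r := by
      rw [X, monomial_mul, one_mul, add_comm]
    rw [h, E_monomial, E_monomial, ← mul_prod_erase univ _ (mem_univ i),
      ← mul_prod_erase univ (fun j => asc (c j) (α j)) (mem_univ i)]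
    have h2 : ∏ x ∈ univ.erase i, asc (b x) ((α + Finsupp.single i 1 : σ →₀ ℕ) x)
        = ∏ x ∈ univ.erase i, asc (c x) (α x) := by
      refine prod_congr rfl fun x hx => ?_
      have hx := ne_of_mem_erase hx
      simp [hcj x hx, Finsupp.single_apply, hx.symm]
    rw [h2]
    simp only [Finsupp.add_apply, Finsupp.single_eq_same, hci, asc_succ']
    ring

lemma E_pd (b : σ → R) (i : σ) (f : MvPolynomial σ R) :
    E (b + Pi.single i 1) f = E b f + E (b + Pi.single i 1) (pderiv i f) := by
  have hci : (b + Pi.single i 1 : σ → R) i = b i + 1 := by simp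
  have hcj : ∀ x, x ≠ i → (b + Pi.single i 1 : σ → R) x = b x := fun x hx => by simp [hx]
  generalize b + Pi.single i 1 = c at hci hcj ⊢
  induction f using MvPolynomial.induction_on' with
  | add p q hp hq => rw [map_add, map_add, map_add, hp, hq, map_add]; ring
  | monomial α r =>
    rw [pderiv_monomial, E_monomial, E_monomial, E_monomial,
      ← mul_prod_erase univ (fun j => asc (b j) (α j)) (mem_univ i),
      ← mul_prod_erase univ (fun j => asc (c j) (α j)) (mem_univ i),
      ← mul_prod_erase univ (fun j => asc (c j) ((α - Finsupp.single i 1 : σ →₀ ℕ) j)) (mem_univ i)]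
    have h1 : ∏ x ∈ univ.erase i, asc (c x) (α x)
        = ∏ x ∈ univ.erase i, asc (b x) (α x) := by
      refine prod_congr rfl fun x hx => ?_
      rw [hcj x (ne_of_mem_erase hx)]
    have h2 : ∏ x ∈ univ.erase i, asc (c x) ((α - Finsupp.single i 1 : σ →₀ ℕ) x)
        = ∏ x ∈ univ.erase i, asc (b x) (α x) := by
      refine prod_congr rfl fun x hx => ?_
      have hx := ne_of_mem_erase hx
      simp [hcj x hx, Finsupp.single_apply, hx.symm]
    rw [h1, h2]
    simp only [Finsupp.tsub_apply, Finsupp.single_eq_same, hci]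
    cases h : α i with
    | zero => simp [asc_zero]
    | succ k => rw [asc_shift]; push_cast; ring

lemma E_rename (b : σ → R) (e : Equiv.Perm σ) (f : MvPolynomial σ R) :
    E b (rename e f) = E (b ∘ e) f := by
  induction f using MvPolynomial.induction_on' with
  | add p q hp hq => rw [map_add, map_add, map_add, hp, hq]
  | monomial α r =>
    rw [rename_monomial, E_monomial, E_monomial]
    congr 1
    rw [← Equiv.prod_comp e]
    refine prod_congr rfl fun x _ => ?_
    rw [Finsupp.mapDomain_apply e.injective]; rfl

lemma E_swap (b : σ → R) (i j : σ) (h : b i = b j) (f : MvPolynomial σ R) :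
    E b (rename (Equiv.swap i j) f) = E b f := by
  rw [E_rename]
  congr 1
  congr 1
  funext x
  simp only [Function.comp, Equiv.swap_apply_def]
  split_ifs with h1 h2 <;> simp_all

/-- discriminant -/
noncomputable def D (R : Type) [CommRing R] (I : Finset σ) : MvPolynomial σ R :=
  ∏ x ∈ I.offDiag, (X x.1 - X x.2)

lemma D_insert (I : Finset σ) (l : σ) (hl : l ∉ I) :
    D R (insert l I) = D R I * ∏ j ∈ I, (-(X l - X j)^2) := by
  rw [D, offDiag_insert hl, prod_union, prod_union, ← D, mul_assoc]
  · congr 1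
    rw [singleton_product, product_singleton, prod_map, prod_map, ← prod_mul_distrib]
    refine prod_congr rfl fun j _ => ?_
    simp; ring
  · rw [disjoint_left]
    rintro ⟨x, y⟩ h1 h2
    simp at h1 h2
    grind
  · rw [disjoint_left]
    rintro ⟨x, y⟩ h1 h2
    simp at h1 h2
    grind

lemma D_swap (I : Finset σ) (i j : σ) (hi : i ∈ I) (hj : j ∈ I) :
    rename (Equiv.swap i j) (D R I) = D R I := by
  have hI : ∀ x, Equiv.swap i j x ∈ I ↔ x ∈ I := by
    intro x
    simp only [Equiv.swap_apply_def]
    split_ifs with h1 h2 <;> simp_all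
  rw [D, map_prod]
  refine prod_equiv ((Equiv.swap i j).prodCongr (Equiv.swap i j)) ?_ ?_
  · rintro ⟨x, y⟩
    simp [hI]
  · rintro ⟨x, y⟩ _
    simp

lemma pderiv_D_notMem (I : Finset σ) (i : σ) (hi : i ∉ I) : pderiv i (D R I) = 0 := by
  induction I using Finset.induction_on with
  | empty => simp [D]
  | insert l I hl ih =>
    have h : ∀ J : Finset σ, i ∉ J → l ≠ i → pderiv i (∏ j ∈ J, (-(X l - X j : MvPolynomial σ R)^2)) = 0 := by
      intro J hJ hli
      induction J using Finset.induction_on with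
      | empty => simp
      | insert k J hk ihJ =>
        simp only [mem_insert, not_or] at hJ
        rw [prod_insert hk, pderiv_mul, ihJ hJ.2]
        simp [pderiv_pow, pderiv_X_of_ne hli, pderiv_X_of_ne (Ne.symm hJ.1)]
    simp only [mem_insert, not_or] at hi
    rw [D_insert _ _ hl, pderiv_mul, ih hi.2, h I hi.2 (Ne.symm hi.1)]
    simp

/-- `W` are the quotients `V/(x_i-x_j)`. -/
lemma exists_W (I : Finset σ) (i : σ) (hi : i ∈ I) (m : ℕ) (hm : 1 ≤ m) :
    ∃ W : σ → MvPolynomial σ R, (∀ j ∈ I.erase i, (X i - X j) * W j = D R I ^ m) ∧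
      pderiv i (D R I ^ m) = ∑ j ∈ I.erase i, ((2 * m : ℕ) : MvPolynomial σ R) * W j := by
  have hI : D R I = D R (I.erase i) * ∏ j ∈ I.erase i, (-(X i - X j)^2) := by
    rw [← D_insert _ _ (notMem_erase i I), insert_erase hi]
  have key : ∀ J : Finset σ, i ∉ J → ∃ U : σ → MvPolynomial σ R,
      (∀ j ∈ J, (X i - X j) * U j = ∏ j ∈ J, (-(X i - X j)^2)) ∧
      pderiv i (∏ j ∈ J, (-(X i - X j : MvPolynomial σ R)^2)) = ∑ j ∈ J, 2 * U j := by
    intro J hJ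
    induction J using Finset.induction_on with
    | empty => exact ⟨0, by simp, by simp⟩
    | insert k J hk ih =>
      simp only [mem_insert, not_or] at hJ
      obtain ⟨U, h1, h2⟩ := ih hJ.2
      refine ⟨fun j => if j = k then -(X i - X k) * ∏ j ∈ J, (-(X i - X j)^2) else -(X i - X k)^2 * U j, ?_, ?_⟩
      · intro j hj
        rw [prod_insert hk]
        by_cases hjk : j = k
        · subst hjk; simp; ring
        · have : j ∈ J := by simpa [hjk] using hj
          simp only [hjk, if_false]
          rw [← h1 j this]; ring
      · rw [prod_insert hk, sum_insert hk, pderiv_mul, h2]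
        simp only [if_true]
        have : ∑ x ∈ J, 2 * (if x = k then -(X i - X k) * ∏ j ∈ J, (-(X i - X j)^2) else -(X i - X k)^2 * U x)
          = ∑ x ∈ J, -(X i - X k)^2 * (2 * U x) := by
          refine sum_congr rfl fun x hx => ?_
          have : x ≠ k := fun h => hk (h ▸ hx)
          simp only [this, if_false]; ring
        rw [this, ← mul_sum J (fun x => 2 * U x) (-(X i - X k)^2)]
        have h3 : pderiv i (-(X i - X k : MvPolynomial σ R)^2) = -2 * (X i - X k) := by
          rw [map_neg, pderiv_pow, map_sub, pderiv_X_self, pderiv_X_of_ne (Ne.symm hJ.1)]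
          push_cast
          ring
        rw [h3]
        ring
  obtain ⟨U, h1, h2⟩ := key (I.erase i) (notMem_erase i I)
  obtain ⟨m, rfl⟩ : ∃ k, m = k + 1 := ⟨m - 1, by omega⟩
  refine ⟨fun j => D R I ^ m * (D R (I.erase i) * U j), ?_, ?_⟩
  · intro j hj
    have := h1 j hj
    rw [pow_succ]
    nth_rw 3 [hI]
    rw [← this]; ring
  · rw [pderiv_pow]
    nth_rw 2 [hI]
    rw [pderiv_mul, h2, pderiv_D_notMem _ _ (notMem_erase i I), zero_mul, zero_add, mul_sum, mul_sum]
    refine sum_congr rfl fun j _ => ?_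
    push_cast
    ring

lemma W_anti [IsDomain R] (I : Finset σ) (i j : σ) (hi : i ∈ I) (hj : j ∈ I) (hij : i ≠ j) (m : ℕ)
    (W : MvPolynomial σ R) (hW : (X i - X j) * W = D R I ^ m) :
    rename (Equiv.swap i j) W = - W := by
  have h := congrArg (rename (Equiv.swap i j)) hW
  rw [map_pow, D_swap I i j hi hj, ← hW] at h
  simp only [map_mul, map_sub, rename_X, Equiv.swap_apply_left, Equiv.swap_apply_right] at h
  have hne : (X i - X j : MvPolynomial σ R) ≠ 0 := by
    rw [sub_ne_zero]
    exact fun h => hij (X_injective h)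
  apply mul_left_cancel₀ hne
  linear_combination -h

/-- cancellation of derivative terms -/
lemma two_E_W [IsDomain R] (I : Finset σ) (i j : σ) (hi : i ∈ I) (hj : j ∈ I) (hij : i ≠ j) (m : ℕ)
    (W : MvPolynomial σ R) (hW : (X i - X j) * W = D R I ^ m) (b : σ → R) (hb : b i = b j) :
    2 * E b W = 0 := by
  have h := E_swap b i j hb W
  rw [W_anti I i j hi hj hij m W hW, map_neg] at h
  linear_combination -h

lemma two_E_XW [IsDomain R] (I : Finset σ) (i j : σ) (hi : i ∈ I) (hj : j ∈ I) (hij : i ≠ j) (m : ℕ)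
    (W : MvPolynomial σ R) (hW : (X i - X j) * W = D R I ^ m) (b : σ → R) (hb : b i = b j) :
    2 * E b (X i * W) = E b (D R I ^ m) := by
  have h := E_swap b i j hb (X i * W)
  rw [map_mul, W_anti I i j hi hj hij m W hW, rename_X, Equiv.swap_apply_left, mul_neg, map_neg] at h
  rw [← hW, sub_mul, map_sub]
  linear_combination -h

lemma step [IsDomain R] (I T : Finset σ) (i : σ) (hi : i ∈ I) (hT : T ⊆ I.erase i) (m : ℕ)
    (hm : 1 ≤ m) (a : R) (b : σ → R) (hbT : ∀ j ∈ T, b j = a + 1)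
    (hb : ∀ j ∈ I, j ∉ T → b j = a) :
    a * E (b + Pi.single i 1) (D R I ^ m) =
      (a + m * ((I.card - 1 - T.card : ℕ) : R)) * E b (D R I ^ m) := by
  obtain ⟨W, h1, h2⟩ := exists_W (R := R) I i hi m hm
  have hiT : i ∉ T := fun h => notMem_erase i I (hT h)
  have hbi : b i = a := hb i hi hiT
  have hsum : a * E (b + Pi.single i 1) (pderiv i (D R I ^ m)) =
      ∑ j ∈ I.erase i, if j ∈ T then 0 else m * E b (D R I ^ m) := by
    rw [h2, map_sum, mul_sum]
    refine sum_congr rfl fun j hj => ?_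
    have hji := ne_of_mem_erase hj
    have hjI := mem_of_mem_erase hj
    rw [← nsmul_eq_mul, map_nsmul, nsmul_eq_mul]
    push_cast
    split_ifs with hjT
    · have := two_E_W I i j hi hjI hji.symm m (W j) (h1 j hj) (b + Pi.single i 1)
        (by simp [hbi, hji, hbT j hjT])
      linear_combination a * m * this
    · have h3 := two_E_XW I i j hi hjI hji.symm m (W j) (h1 j hj) b (by rw [hbi, hb j hjI hjT])
      rw [E_X_mul, hbi] at h3
      linear_combination (m : R) * h3
  have hs2 : (∑ j ∈ I.erase i, if j ∈ T then (0 : R) else m * E b (D R I ^ m)) =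
      ∑ j ∈ (I.erase i) \ T, m * E b (D R I ^ m) := by
    rw [← filter_notMem_eq_sdiff, sum_filter]
    refine sum_congr rfl fun j _ => ?_
    by_cases h : j ∈ T <;> simp [h]
  rw [E_pd, mul_add, hsum, hs2, sum_const, card_sdiff_of_subset hT,
    card_erase_of_mem hi, nsmul_eq_mul]
  ring

lemma step0 [IsDomain R] (I : Finset σ) (i : σ) (hi : i ∈ I) (m : ℕ)
    (hm : 1 ≤ m) (b : σ → R) (hb : ∀ j ∈ I, j ≠ i → b j = b i + 1) :
    E (b + Pi.single i 1) (D R I ^ m) = E b (D R I ^ m) := by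
  obtain ⟨W, h1, h2⟩ := exists_W (R := R) I i hi m hm
  have hsum : E (b + Pi.single i 1) (pderiv i (D R I ^ m)) = 0 := by
    rw [h2, map_sum]
    refine sum_eq_zero fun j hj => ?_
    have hji := ne_of_mem_erase hj
    have hjI := mem_of_mem_erase hj
    rw [← nsmul_eq_mul, map_nsmul, nsmul_eq_mul]
    push_cast
    have := two_E_W I i j hi hjI hji.symm m (W j) (h1 j hj) (b + Pi.single i 1)
        (by simp [hji, hb j hjI hji])
    linear_combination m * this
  rw [E_pd, hsum, add_zero]


lemma chain1 [IsDomain R] (I T : Finset σ) (hT : T ⊆ I) (m : ℕ)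
    (hm : 1 ≤ m) (a : R) (b : σ → R) (hb : ∀ j ∈ I, b j = a) (h0 : E b (D R I ^ m) ≠ 0)
    (hs : ∀ s, s < I.card → I.card - T.card ≤ s → a + m * (s : R) ≠ 0) :
    E (b + fun j => if j ∈ T then 1 else 0) (D R I ^ m) ≠ 0 := by
  induction T using Finset.induction_on with
  | empty =>
    have : (b + fun j => if j ∈ (∅ : Finset σ) then (1 : R) else 0) = b := by
      funext j; simp
    rwa [this]
  | insert l T hl ih =>
    rw [insert_subset_iff] at hT
    rw [card_insert_of_notMem hl] at hs
    have ih := ih hT.2 (fun s h1 h2 => hs s h1 (by omega))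
    have hTc : T.card + 1 ≤ I.card := by
      rw [← card_insert_of_notMem hl]
      exact card_le_card (insert_subset_iff.2 hT)
    have h := step I T l hT.1 (fun x hx => mem_erase.2 ⟨fun h => hl (h ▸ hx), hT.2 hx⟩) m hm a
      (b + fun j => if j ∈ T then 1 else 0)
      (fun j hj => by simp [hj, hb j (hT.2 hj)])
      (fun j hj hjT => by simp [hjT, hb j hj])
    have h2 := mul_ne_zero (hs (I.card - 1 - T.card) (by omega) (by omega)) ih
    rw [← h] at h2
    have h3 := right_ne_zero_of_mul h2
    convert h3 using 2
    congr 1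
    funext j
    by_cases hj : j = l
    · subst hj; simp [hl]
    · simp [hj]

lemma chain2 {p : ℕ} [Fact p.Prime] (I : Finset σ) (m : ℕ) (hm : 1 ≤ m)
    (h1 : ∀ b : σ → ZMod p, (∀ j ∈ I, b j = 1) → E b (D (ZMod p) I ^ m) ≠ 0)
    (k : ℕ) (hk : ∀ s < I.card, k + m * s < p) :
    ∀ b : σ → ZMod p, (∀ j ∈ I, b j = 1 + k) → E b (D (ZMod p) I ^ m) ≠ 0 := by
  induction k with
  | zero => simpa using h1
  | succ k ih =>
    have ih := ih (fun s hs => by have := hk s hs; omega)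
    intro b hb
    have h2 := chain1 I I subset_rfl m hm (1 + k : ZMod p) (b - fun j => if j ∈ I then 1 else 0)
      (fun j hj => by simp [hj, hb j hj]; ring)
      (ih _ (fun j hj => by simp [hj, hb j hj]; ring))
      (fun s hs _ => by
        have := hk s hs
        have h3 : (1 + k : ZMod p) + m * s = ((1 + k + m * s : ℕ) : ZMod p) := by push_cast; rfl
        rw [h3, Ne, ZMod.natCast_eq_zero_iff]
        exact Nat.not_dvd_of_pos_of_lt (by omega) (by omega))
    rwa [sub_add_cancel] at h2

lemma E_pow_mul (b : σ → R) (i : σ) (k : ℕ) (f : MvPolynomial σ R) :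
    E b (X i ^ k * f) = asc (b i) k * E (b + Pi.single i (k : R)) f := by
  induction k generalizing b with
  | zero => simp [asc]
  | succ k ih =>
    rw [pow_succ', mul_assoc, E_X_mul, ih, asc_succ', mul_assoc]
    congr 2
    · simp
    · congr 2
      rw [add_assoc, ← Pi.single_add]
      congr 2
      push_cast; ring

lemma E_prod_sq [IsDomain R] (J : Finset σ) (m : ℕ) (f : MvPolynomial σ R) (c : σ → R)
    (h1 : ∀ j ∈ J, asc (c j) (2 * m) ≠ 0)
    (h2 : E (c + fun j => if j ∈ J then ((2 * m : ℕ) : R) else 0) f ≠ 0) :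
    E c (f * ∏ j ∈ J, (-(X j)^2)^m) ≠ 0 := by
  induction J using Finset.induction_on generalizing c with
  | empty =>
    have : (c + fun j => if j ∈ (∅ : Finset σ) then ((2 * m : ℕ) : R) else 0) = c := by
      funext j; simp
    rw [this] at h2
    simpa using h2
  | insert k J hk ih =>
    have e : f * ∏ j ∈ insert k J, (-(X j : MvPolynomial σ R)^2)^m =
        ((-1 : R) ^ m) • (X k ^ (2 * m) * (f * ∏ j ∈ J, (-(X j)^2)^m)) := by
      rw [prod_insert hk, smul_eq_C_mul, neg_pow, pow_mul]
      simp only [map_pow, map_neg, map_one]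
      ring
    rw [e, map_smul, E_pow_mul, smul_eq_mul]
    refine mul_ne_zero (pow_ne_zero _ (by simp)) (mul_ne_zero (h1 k (mem_insert_self _ _)) ?_)
    apply ih
    · intro j hj
      have : j ≠ k := fun h => hk (h ▸ hj)
      simpa [this] using h1 j (mem_insert_of_mem hj)
    · convert h2 using 2
      congr 1
      funext j
      by_cases hj : j = k
      · subst hj; simp [hk]
      · simp [hj]

lemma asc_one (k : ℕ) : asc (1 : R) k = (k.factorial : R) := by
  induction k with
  | zero => simp [asc]
  | succ k ih => rw [asc_succ, ih, Nat.factorial_succ]; push_cast; ring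

lemma dvd_aux (l : σ) (m : ℕ) (J : Finset σ) :
    (X l : MvPolynomial σ R) ∣ ∏ j ∈ J, (-(X l - X j)^2)^m - ∏ j ∈ J, (-(X j)^2)^m := by
  induction J using Finset.induction_on with
  | empty => simp
  | insert k J hk ih =>
    rw [prod_insert hk, prod_insert hk]
    have h1 : (X l : MvPolynomial σ R) ∣ (-(X l - X k)^2)^m - (-(X k)^2)^m :=
      dvd_trans ⟨-X l + 2 * X k, by ring⟩ (sub_dvd_pow_sub_pow _ _ m)
    obtain ⟨u, hu⟩ := h1
    obtain ⟨v, hv⟩ := ih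
    refine ⟨u * ∏ j ∈ J, (-(X l - X j)^2)^m + (-(X k)^2)^m * v, ?_⟩
    linear_combination (∏ j ∈ J, (-(X l - X j)^2)^m) * hu + (-(X k)^2)^m * hv

lemma base {p : ℕ} [Fact p.Prime] (I : Finset σ) (m : ℕ) (hm : 1 ≤ m) (hI : m * I.card < p) :
    ∀ b : σ → ZMod p, (∀ j ∈ I, b j = 1) → E b (D (ZMod p) I ^ m) ≠ 0 := by
  induction I using Finset.induction_on with
  | empty =>
    intro b _
    have h : (D (ZMod p) (∅ : Finset σ)) ^ m = monomial 0 1 := by simp [D]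
    rw [h, E_monomial]
    simp [asc]
  | insert l I hl ih =>
    intro b hb
    rw [card_insert_of_notMem hl, mul_add, mul_one] at hI
    have ih := ih (by omega)
    set c : σ → ZMod p := b - Pi.single l 1 with hc
    have hbc : b = c + Pi.single l 1 := by simp [hc]
    have hcl : c l = 0 := by simp [hc, hb l]
    have hcI : ∀ j ∈ I, c j = 1 := by
      intro j hj
      have : j ≠ l := fun h => hl (h ▸ hj)
      simp [hc, this, hb j (mem_insert_of_mem hj)]
    rw [hbc, step0 (insert l I) l (mem_insert_self _ _) m hm c]
    · rw [D_insert _ _ hl, mul_pow, ← prod_pow]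
      obtain ⟨u, hu⟩ := dvd_aux (R := ZMod p) l m I
      rw [sub_eq_iff_eq_add] at hu
      rw [hu, mul_add, map_add, mul_left_comm, E_X_mul, hcl, zero_mul, zero_add]
      apply E_prod_sq
      · intro j hj
        rw [hcI j hj, asc_one, Ne, ZMod.natCast_eq_zero_iff, (Fact.out : p.Prime).dvd_factorial]
        have : 1 ≤ I.card := card_pos.2 ⟨j, hj⟩
        nlinarith
      · apply chain2 I m hm ih (2 * m)
        · intro s hs
          nlinarith
        · intro j hj
          simp [hj, hcI j hj]
    · intro j hj hjl
      have : j ∈ I := by simpa [hjl] using hj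
      rw [hcI j this, hcl, zero_add]

lemma asc_neg_lt (t k : ℕ) (h : t < k) : asc (-(t : R)) k = 0 := by
  rw [asc]
  exact prod_eq_zero (mem_range.2 h) (by simp)

lemma asc_neg_le (t k : ℕ) (h : k ≤ t) :
    ((t - k).factorial : R) * asc (-(t : R)) k = (-1)^k * (t.factorial : R) := by
  induction k with
  | zero => simp [asc]
  | succ k ih =>
    have ih := ih (by omega)
    rw [asc_succ, pow_succ]
    have h1 : t - k = (t - (k+1)) + 1 := by omega
    have h2 : (t : R) = ((t - (k+1) : ℕ) : R) + k + 1 := by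
      rw [Nat.cast_sub h]; push_cast; ring
    rw [h1, Nat.factorial_succ] at ih
    push_cast at ih
    have h3 : -(t : R) + k = -(((t - (k+1) : ℕ) : R) + 1) := by rw [h2]; simp; ring
    rw [h3]
    linear_combination - ih

lemma coeff_monomial_aux (t α : σ →₀ ℕ) (r : R) (N : ℕ) (h : t.degree = N + α.degree) :
    (∏ i, ((t i).factorial : R)) * coeff t ((∑ i, X i) ^ N * monomial α r) =
      (N.factorial : R) * (-1) ^ α.degree * E (fun i => -(t i : R)) (monomial α r) := by
  rw [coeff_mul_monomial', E_monomial]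
  split_ifs with hle
  · rw [coeff_sum_X_pow_of_fintype]
    have hd : (t - α).degree = N := by
      have : (t - α).degree + α.degree = t.degree := by
        rw [← map_add, tsub_add_cancel_of_le hle]
      omega
    have hd' : ((t - α).sum fun _ m => m) = N := hd
    rw [if_pos hd']
    have hmul : (∏ i, ((t - α) i).factorial) * (t - α).multinomial = N.factorial := by
      rw [Finsupp.multinomial_eq_of_support_subset (subset_univ _), Nat.multinomial_spec]
      congr 1
      rw [← hd, Finsupp.degree_eq_sum]
    have h2 : (-1 : R) ^ α.degree * ∏ i, ((t i).factorial : R) =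
        (∏ i, (((t - α) i).factorial : R)) * ∏ i, asc (-(t i : R)) (α i) := by
      rw [Finsupp.degree_eq_sum, ← prod_pow_eq_pow_sum, ← prod_mul_distrib, ← prod_mul_distrib]
      exact prod_congr rfl fun i _ => (asc_neg_le _ _ (hle i)).symm
    have h3 : (-1 : R) ^ α.degree * (-1) ^ α.degree = 1 := by
      rw [← mul_pow]; simp
    rw [← hmul]
    rw [Nat.cast_mul, Nat.cast_prod]
    set M : R := ((t - α).multinomial : R)
    linear_combination (-(∏ i, ((t i).factorial : R)) * M * r) * h3 + (-1) ^ α.degree * M * r * h2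
  · have : ∃ i, t i < α i := by
      by_contra hcon
      push Not at hcon
      exact hle hcon
    obtain ⟨i, hi⟩ := this
    have h0 : ∏ i, asc (-(t i : R)) (α i) = 0 :=
      prod_eq_zero (mem_univ i) (asc_neg_lt (R := R) _ _ hi)
    rw [h0]
    simp

lemma coeff_aux (t : σ →₀ ℕ) (f : MvPolynomial σ R) (N d : ℕ) (hf : f.IsHomogeneous d)
    (h : t.degree = N + d) :
    (∏ i, ((t i).factorial : R)) * coeff t ((∑ i, X i) ^ N * f) =
      (N.factorial : R) * (-1) ^ d * E (fun i => -(t i : R)) f := by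
  conv_lhs => rw [f.as_sum]
  conv_rhs => rw [f.as_sum]
  rw [mul_sum, coeff_sum, mul_sum, map_sum, mul_sum]
  refine sum_congr rfl fun α hα => ?_
  have hd : α.degree = d := by
    have : Finsupp.weight (fun _ => 1) α = d := hf (mem_support_iff.1 hα)
    rwa [← Finsupp.degree_eq_weight_one] at this
  rw [coeff_monomial_aux t α _ N (by rw [hd, h]), hd]

def Low (d : ℕ) (f : MvPolynomial σ R) : Prop := ∀ s ∈ f.support, s.degree < d

lemma Low.add {d : ℕ} {f g : MvPolynomial σ R} (hf : Low d f) (hg : Low d g) : Low d (f + g) := by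
  intro s hs
  rcases mem_union.1 (support_add hs) with h | h
  · exact hf s h
  · exact hg s h

lemma Low.mul {d e : ℕ} {f g : MvPolynomial σ R} (hf : Low d f)
    (hg : ∀ s ∈ g.support, s.degree ≤ e) : Low (d + e) (f * g) := by
  intro s hs
  obtain ⟨x, hx, y, hy, rfl⟩ := mem_add.1 (support_mul f g hs)
  rw [map_add]
  have := hf x hx
  have := hg y hy
  omega

lemma hom_deg {d : ℕ} {f : MvPolynomial σ R} (hf : f.IsHomogeneous d) :
    ∀ s ∈ f.support, s.degree ≤ d := by
  intro s hs
  have : Finsupp.weight (fun _ => 1) s = d := hf (mem_support_iff.1 hs)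
  rw [← Finsupp.degree_eq_weight_one] at this
  exact le_of_eq this

def Lead (g h : MvPolynomial σ R) (d : ℕ) : Prop := h.IsHomogeneous d ∧ Low d (g - h)

lemma Lead.mul {g h g' h' : MvPolynomial σ R} {d d' : ℕ} (H : Lead g h d) (H' : Lead g' h' d') :
    Lead (g * g') (h * h') (d + d') := by
  refine ⟨H.1.mul H'.1, ?_⟩
  have e : g * g' - h * h' = (g - h) * (g' - h') + ((g - h) * h' + (g' - h') * h) := by ring
  rw [e]
  refine (H.2.mul fun s hs => (H'.2 s hs).le).add ((H.2.mul (hom_deg H'.1)).add ?_)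
  rw [add_comm d]
  exact H'.2.mul (hom_deg H.1)

lemma Lead.one : Lead (1 : MvPolynomial σ R) 1 0 :=
  ⟨isHomogeneous_one _ _, by simp [Low]⟩

lemma Lead.prod {ι : Type} [DecidableEq ι] (I : Finset ι) (g h : ι → MvPolynomial σ R) (d : ι → ℕ)
    (H : ∀ i ∈ I, Lead (g i) (h i) (d i)) : Lead (∏ i ∈ I, g i) (∏ i ∈ I, h i) (∑ i ∈ I, d i) := by
  induction I using Finset.induction_on with
  | empty => simpa using Lead.one
  | insert k I hk ih =>
    rw [prod_insert hk, prod_insert hk, sum_insert hk]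
    exact (H k (mem_insert_self _ _)).mul (ih fun i hi => H i (mem_insert_of_mem hi))

lemma low_C (c : R) (d : ℕ) (hd : 0 < d) : Low d (C c : MvPolynomial σ R) := by
  intro s hs
  have : s = 0 := by
    by_contra h
    rw [mem_support_iff, coeff_C, if_neg (Ne.symm h)] at hs
    exact hs rfl
  simpa [this] using hd

lemma Lead.sub_C {g h : MvPolynomial σ R} {d : ℕ} (H : Lead g h d) (hd : 0 < d) (c : R) :
    Lead (g - C c) h d := by
  refine ⟨H.1, ?_⟩
  have : g - C c - h = (g - h) + C (-c) := by rw [map_neg]; ring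
  rw [this]
  exact H.2.add (low_C _ _ hd)

lemma Lead.refl {h : MvPolynomial σ R} {d : ℕ} (H : h.IsHomogeneous d) : Lead h h d :=
  ⟨H, by simp [Low]⟩

lemma Lead.pow {g h : MvPolynomial σ R} {d : ℕ} (H : Lead g h d) (k : ℕ) :
    Lead (g ^ k) (h ^ k) (k * d) := by
  simpa using Lead.prod (range k) (fun _ => g) (fun _ => h) (fun _ => d) (fun _ _ => H)

lemma Lead.coeff {g h : MvPolynomial σ R} {d : ℕ} (H : Lead g h d) (t : σ →₀ ℕ)
    (ht : t.degree = d) : coeff t g = coeff t h := by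
  by_contra hne
  have := H.2 t (by rw [mem_support_iff, coeff_sub, sub_ne_zero]; exact hne)
  omega

lemma Lead.totalDegree {g h : MvPolynomial σ R} {d : ℕ} (H : Lead g h d) : g.totalDegree ≤ d := by
  refine Finset.sup_le fun s hs => ?_
  change s.degree ≤ d
  have e : g = (g - h) + h := by ring
  rw [e] at hs
  rcases mem_union.1 (support_add hs) with h1 | h1
  · exact (H.2 s h1).le
  · exact hom_deg H.1 s h1

lemma D_hom (I : Finset σ) : (D R I).IsHomogeneous (I.card * (I.card - 1)) := by
  have h := IsHomogeneous.prod I.offDiag (fun x => (X x.1 - X x.2 : MvPolynomial σ R)) (fun _ => 1)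
    (fun x _ => (isHomogeneous_X R x.1).sub (isHomogeneous_X R x.2))
  rw [sum_const, smul_eq_mul, mul_one, offDiag_card] at h
  rwa [Nat.mul_sub, mul_one]

lemma arith (p m k : ℕ) (hp : p.Prime) (hm : 1 ≤ m) (hmp : m ≤ p) (hkp : k ≤ p)
    (hA : Real.sqrt (4 * m * p + 4 * m * ((m : ℝ) - 3) + 2) - m + 1 ≤ (k : ℝ)) :
    1 ≤ k ∧ 1 ≤ (k - 1 + m) / (2 * m) ∧ m * ((k - 1 + m) / (2 * m)) < p ∧
    ∃ u r : ℕ, 1 ≤ u ∧ r ≤ (k - 1 + m) / (2 * m) ∧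
      m * ((k - 1 + m) / (2 * m) - 1) + u + 1 ≤ k ∧
      (k - 1 + m) / (2 * m) * u = p - 1 + r := by
  have hp2 := hp.two_le
  have h1 : Real.sqrt (4 * m * p + 4 * m * ((m : ℝ) - 3) + 2) ≤ (k : ℝ) - 1 + m := by linarith
  rw [Real.sqrt_le_iff] at h1
  obtain ⟨h0, h1⟩ := h1
  have hz : 4 * (m : ℤ) * p + 4 * m * ((m : ℤ) - 3) + 2 ≤ ((k : ℤ) - 1 + m) ^ 2 := by
    exact_mod_cast h1
  have hmz : (1 : ℤ) ≤ m := by exact_mod_cast hm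
  have hpz : (2 : ℤ) ≤ p := by exact_mod_cast hp2
  have hk1 : 1 ≤ k := by
    by_contra hk
    have : k = 0 := by omega
    subst this
    push_cast at hz
    nlinarith
  have hkz : (1 : ℤ) ≤ k := by exact_mod_cast hk1
  have hkpz : (k : ℤ) ≤ p := by exact_mod_cast hkp
  have hmp' : m < p := by
    rcases hmp.lt_or_eq with h | h
    · exact h
    · subst h
      nlinarith
  obtain ⟨y, hy⟩ : ∃ y, y = k - 1 + m := ⟨_, rfl⟩
  have hyz : (y : ℤ) = k - 1 + m := by omega
  rw [← hyz] at hz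
  rw [← hy]
  obtain ⟨n, hn⟩ : ∃ n, n = y / (2 * m) := ⟨_, rfl⟩
  obtain ⟨ρ, hρ⟩ : ∃ ρ, ρ = y % (2 * m) := ⟨_, rfl⟩
  have hdm := Nat.div_add_mod y (2 * m)
  have hlt := Nat.mod_lt y (show 2 * m > 0 by omega)
  rw [← hn, ← hρ] at hdm
  rw [← hρ] at hlt
  rw [← hn]
  have hdz : (y : ℤ) = 2 * m * n + ρ := by exact_mod_cast hdm.symm
  have hρz : (ρ : ℤ) ≤ 2 * m - 1 := by omega
  have hρ0 : (0 : ℤ) ≤ ρ := by positivity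
  -- main bound
  have hmain : (p : ℤ) - 1 ≤ n * (m * n + ρ) := by
    by_contra hcon
    push Not at hcon
    have hcon : (n : ℤ) * (m * n + ρ) ≤ p - 2 := by omega
    have h3 : (ρ : ℤ) ^ 2 ≤ (2 * m - 1) ^ 2 := by nlinarith
    have h4 : (4 * m : ℤ) * (n * (m * n + ρ)) ≤ 4 * m * (p - 2) := by
      apply mul_le_mul_of_nonneg_left hcon; positivity
    rw [hdz] at hz
    nlinarith
  have hmainN : p - 1 ≤ n * (m * n + ρ) := by zify [hp.one_le]; exact hmain
  have hn1 : 1 ≤ n := by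
    rcases Nat.eq_zero_or_pos n with h | h
    · subst h; simp at hmainN; omega
    · exact h
  have hmn : m * n < p := by nlinarith
  refine ⟨hk1, hn1, hmn, (p - 1 + (n - 1)) / n, n * ((p - 1 + (n - 1)) / n) - (p - 1), ?_, ?_, ?_, ?_⟩
  · rw [Nat.le_div_iff_mul_le hn1]; omega
  · have := Nat.mul_div_le (p - 1 + (n - 1)) n
    omega
  · have h5 : (p - 1 + (n - 1)) / n ≤ m * n + ρ := by
      rw [← Nat.lt_succ_iff, Nat.div_lt_iff_lt_mul hn1]
      have : (m * n + ρ).succ * n = n * (m * n + ρ) + n := by rw [Nat.succ_mul]; ring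
      omega
    have h6 : m * (n - 1) + m = m * n := by
      obtain ⟨q, rfl⟩ : ∃ q, n = q + 1 := ⟨n - 1, by omega⟩
      simp; ring
    have h7 : 2 * m * n = m * n + m * n := by ring
    omega
  · have h8 := Nat.div_add_mod (p - 1 + (n - 1)) n
    have h9 := Nat.mod_lt (p - 1 + (n - 1)) hn1
    omega

end ZRep

open MvPolynomial ZRep in
theorem zmod_representation {p : ℕ} (hp : p.Prime) (m : ℕ) (hm : 1 ≤ m)
    (S : Finset (ZMod p)) (hS : S.card = m)
    (A : Finset (ZMod p))
    (hA : Real.sqrt (4 * m * p + 4 * m * ((m : ℝ) - 3) + 2) - m + 1 ≤ (A.card : ℝ)) :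
    ∀ c : ZMod p, ∃ a : Fin ((A.card - 1 + m) / (2 * m)) → ZMod p,
      (∀ i, a i ∈ A) ∧
      (∀ i j, i ≠ j → a i - a j ∉ S) ∧
      ∑ i, a i = c := by
  intro c
  have : Fact p.Prime := ⟨hp⟩
  have hp2 := hp.two_le
  have hcard : ∀ B : Finset (ZMod p), B.card ≤ p := fun B => by
    simpa [ZMod.card] using card_le_univ B
  obtain ⟨hk1, hn1, hmn, u, r, hu, hr, hK, hur⟩ :=
    arith p m A.card hp hm (hS ▸ hcard S) (hcard A) hA
  have hkp := hcard A
  generalize (A.card - 1 + m) / (2 * m) = n at *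
  obtain ⟨T, -, hT⟩ := exists_subset_card_eq (s := (univ : Finset (Fin n))) (n := r) (by simpa using hr)
  obtain ⟨K, hKdef⟩ : ∃ K, K = m * (n - 1) + u := ⟨_, rfl⟩
  let t : Fin n →₀ ℕ := Finsupp.equivFunOnFinite.symm fun i => K - if i ∈ T then 1 else 0
  have ht : ∀ i, t i = K - if i ∈ T then 1 else 0 := fun i => rfl
  have hms : ∀ s < n, m * s ≤ m * (n - 1) := fun s hs => Nat.mul_le_mul_left m (by omega)
  -- nonvanishing
  have hE : E (fun i => -(t i : ZMod p)) (D (ZMod p) univ ^ m) ≠ 0 := by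
    have h1 := chain2 (univ : Finset (Fin n)) m hm
      (base (p := p) univ m hm (by simpa using hmn)) (p - K - 1)
      (fun s hs => by
        have := hms s (by simpa using hs)
        omega)
    have h2 := chain1 univ T (subset_univ T) m hm (-(K : ZMod p)) (fun _ => -(K : ZMod p))
      (fun _ _ => rfl) (h1 _ (fun _ _ => by
        have : ((K + (1 + (p - K - 1)) : ℕ) : ZMod p) = 0 := by
          rw [show K + (1 + (p - K - 1)) = p by omega]; simp
        push_cast at this
        linear_combination -this))
      (fun s hs _ => by
        have := hms s (by simpa using hs)
        have h3 : (-(K : ZMod p)) + m * s = - ((K - m * s : ℕ) : ZMod p) := by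
          rw [Nat.cast_sub (by omega)]; push_cast; ring
        rw [h3, neg_ne_zero, Ne, ZMod.natCast_eq_zero_iff]
        exact Nat.not_dvd_of_pos_of_lt (by omega) (by omega))
    convert h2 using 2
    congr 1
    funext i
    simp only [ht, Pi.add_apply]
    rw [Nat.cast_sub (by split_ifs <;> omega)]
    split_ifs <;> simp
    ring
  have hdeg : t.degree = (p - 1) + m * (n * (n - 1)) := by
    rw [Finsupp.degree_eq_sum]
    have h1 : ∑ i, t i + ∑ i, (if i ∈ T then 1 else 0) = n * K := by
      rw [← sum_add_distrib]
      have : ∀ i ∈ (univ : Finset (Fin n)), t i + (if i ∈ T then 1 else 0) = K := by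
        intro i _
        rw [ht]
        split_ifs <;> omega
      rw [sum_congr rfl this]; simp
    have h2 : ∑ i, (if i ∈ T then 1 else 0) = r := by simp [hT]
    have h3 : n * K = m * (n * (n - 1)) + n * u := by rw [hKdef]; ring
    omega
  have hhom : (D (ZMod p) (univ : Finset (Fin n)) ^ m).IsHomogeneous (m * (n * (n - 1))) := by
    have := (D_hom (R := ZMod p) (univ : Finset (Fin n))).pow m
    simpa [mul_comm] using this
  have hco : coeff t ((∑ i, X i) ^ (p - 1) * D (ZMod p) (univ : Finset (Fin n)) ^ m) ≠ 0 := by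
    intro h0
    have h := coeff_aux t _ (p - 1) _ hhom hdeg
    rw [h0, mul_zero] at h
    refine mul_ne_zero (mul_ne_zero ?_ ?_) hE h.symm
    · rw [Ne, ZMod.natCast_eq_zero_iff, hp.dvd_factorial]; omega
    · exact pow_ne_zero _ (by simp)
  -- the polynomial
  let G : MvPolynomial (Fin n) (ZMod p) := ((∑ i, X i - C c) ^ (p - 1) - C 1) *
    ∏ x ∈ (univ : Finset (Fin n)).offDiag, ∏ s ∈ S, (X x.1 - X x.2 - C s)
  have hlead : Lead G ((∑ i, X i) ^ (p - 1) * D (ZMod p) (univ : Finset (Fin n)) ^ m)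
      ((p - 1) + m * (n * (n - 1))) := by
    refine Lead.mul ?_ ?_
    · refine Lead.sub_C ?_ (by omega) _
      have h1 : (∑ i, X i : MvPolynomial (Fin n) (ZMod p)).IsHomogeneous 1 :=
        IsHomogeneous.sum _ _ _ fun i _ => isHomogeneous_X _ i
      simpa using ((Lead.refl h1).sub_C one_pos c).pow (p - 1)
    · have h2 := Lead.prod (univ : Finset (Fin n)).offDiag
        (fun x => ∏ s ∈ S, (X x.1 - X x.2 - C s : MvPolynomial (Fin n) (ZMod p)))
        (fun x => ∏ s ∈ S, (X x.1 - X x.2 : MvPolynomial (Fin n) (ZMod p)))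
        (fun x => ∑ s ∈ S, 1)
        (fun x _ => Lead.prod S _ _ _ fun s _ =>
          (Lead.refl ((isHomogeneous_X _ x.1).sub (isHomogeneous_X _ x.2))).sub_C one_pos s)
      simp only [prod_const, hS, sum_const, smul_eq_mul, mul_one, offDiag_card, prod_pow] at h2
      rw [← D] at h2
      convert h2 using 1
      simp [Nat.mul_sub, mul_comm]
  have hGc : coeff t G ≠ 0 := by rw [hlead.coeff t hdeg]; exact hco
  have hGd : G.totalDegree = t.degree := by
    apply le_antisymm
    · rw [hdeg]; exact hlead.totalDegree
    · exact le_totalDegree (mem_support_iff.2 hGc)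
  obtain ⟨a, haA, ha⟩ := combinatorial_nullstellensatz_exists_eval_nonzero G t hGc hGd (fun _ => A)
    (fun i => by rw [ht]; omega)
  refine ⟨a, haA, ?_, ?_⟩
  · intro i j hij hmem
    apply ha
    simp only [G, map_mul, map_prod]
    rw [mul_eq_zero]
    right
    exact prod_eq_zero (i := (i, j)) (by simp [hij]) (prod_eq_zero hmem (by simp))
  · by_contra hne
    apply ha
    simp only [G, map_mul]
    rw [mul_eq_zero]
    left
    have : (∑ i, a i - c) ≠ 0 := sub_ne_zero.2 hne
    simp [ZMod.pow_card_sub_one_eq_one this]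
end

section
/- Let m ∈ ℕ and k, n positive integers, with k_j ∈ {k, k+1} for 1 ≤ j ≤ n, and suppose k > m(n−1). Let s = |{j : k_j = k+1}|. Then the coefficient of x_1^{k_1−1}···x_n^{k_n−1} in the polynomial ∏_{1≤i≠j≤n}(x_i − x_j)^m · (x_1 + ... + x_n)^{Σ_j(k_j−1) − mn(n−1)} over ℤ (or ℚ) equals (∏_{j=0}^{s−1} 1/(k − jm)) · (Σ_j k_j − mn² + mn − n)!/(m!)^n · ∏_{j=1}^n (jm)!/(k − 1 − jm + m)!. -/
open Finset MvPolynomial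

noncomputable def dyP {ι : Type*} [DecidableEq ι] (s : Finset ι) (a : ι → ℕ) : MvPolynomial ι ℚ :=
  ∏ j ∈ s, ∏ i ∈ s.erase j, (X i - X j) ^ a j

lemma dy_degreeOf_le {ι : Type*} [DecidableEq ι] (i : ι) (p : MvPolynomial ι ℚ) (hp : degreeOf i p = 0)
    (t : Finset ι) (a : ι → ℕ) :
    degreeOf i (p * ∏ j ∈ t, (X i - X j) ^ a j) ≤ ∑ j ∈ t, a j := by
  refine (degreeOf_mul_le _ _ _).trans ?_
  rw [hp, zero_add]
  refine (degreeOf_prod_le _ _ _).trans (Finset.sum_le_sum fun j _ => ?_)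
  refine (degreeOf_pow_le _ _ _).trans ?_
  have : degreeOf i (X i - X j : MvPolynomial ι ℚ) ≤ 1 := by
    refine (degreeOf_sub_le _ _ _).trans ?_
    rw [degreeOf_X, degreeOf_X]
    split_ifs <;> simp
  nlinarith

lemma dy_step {ι : Type*} [DecidableEq ι] (i j : ι) (hij : j ≠ i) (r : MvPolynomial ι ℚ) (A : ℕ)
    (hr : degreeOf i r ≤ A) (d : ι →₀ ℕ) (hd : d i = A) (b : ℕ) :
    coeff (d + Finsupp.single i b) (r * (X i - X j) ^ b) = coeff d r := by
  induction b generalizing r A d with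
  | zero => simp
  | succ b ih =>
    rw [pow_succ', ← mul_assoc, add_comm b 1, Finsupp.single_add, ← add_assoc]
    rw [ih (r * (X i - X j)) (A + 1) _ _ (by simp [hd])]
    · rw [mul_sub, coeff_sub, coeff_mul_X, sub_eq_self, coeff_mul_X']
      split_ifs
      · by_contra h
        have h1 := (degreeOf_le_iff.1 hr) _ (mem_support_iff.2 h)
        simp [hd, hij] at h1
      · rfl
    · refine (degreeOf_mul_le _ _ _).trans (add_le_add hr ?_)
      refine (degreeOf_sub_le _ _ _).trans ?_
      rw [degreeOf_X, degreeOf_X]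
      split_ifs <;> simp

lemma dy_zero {ι : Type*} [DecidableEq ι] (i : ι) (p : MvPolynomial ι ℚ) (hp : degreeOf i p = 0)
    (t : Finset ι) (hit : i ∉ t) (a : ι → ℕ) (d : ι →₀ ℕ) (hd : d i = 0) :
    coeff (d + Finsupp.single i (∑ j ∈ t, a j)) (p * ∏ j ∈ t, (X i - X j) ^ a j) = coeff d p := by
  induction t using Finset.induction_on with
  | empty => simp
  | insert j t hj ih =>
    simp only [mem_insert, not_or] at hit
    rw [prod_insert hj, sum_insert hj, mul_comm (_ ^ _), ← mul_assoc, add_comm (a j), Finsupp.single_add,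
      ← add_assoc, dy_step i j (Ne.symm hit.1) _ _ (dy_degreeOf_le i p hp t a) _ (by simp [hd]), ih hit.2]

lemma dy_field {K : Type*} [Field K] (x y : K) (h : x - y ≠ 0) : (x - y)⁻¹ * (0 - y) * (y - x) = y := by
  field_simp
  ring

lemma dy_lagrange {ι : Type*} [DecidableEq ι] (s : Finset ι) (hs : s.Nonempty) (a : ι → ℕ)
    (ha : ∀ i ∈ s, 1 ≤ a i) :
    dyP s a = ∑ i ∈ s, (∏ j ∈ s.erase i, X j) * dyP s (Function.update a i (a i - 1)) := by
  have h1 : ∀ i ∈ s, dyP s a = (∏ j ∈ s.erase i, (X j - X i)) * dyP s (Function.update a i (a i - 1)) := by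
    intro i hi
    unfold dyP
    rw [← mul_prod_erase s (fun j => ∏ i ∈ s.erase j, (X i - X j : MvPolynomial ι ℚ) ^ a j) hi,
      ← mul_prod_erase s (fun j => ∏ l ∈ s.erase j, (X l - X j : MvPolynomial ι ℚ) ^ (Function.update a i (a i - 1) j)) hi,
      ← mul_assoc]
    congr 1
    · rw [← prod_mul_distrib]
      refine prod_congr rfl fun j _ => ?_
      rw [Function.update_self, ← pow_succ', Nat.sub_add_cancel (ha i hi)]
    · refine prod_congr rfl fun j hj => ?_
      rw [Function.update_of_ne (ne_of_mem_erase hj)]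
  let K := FractionRing (MvPolynomial ι ℚ)
  let φ := algebraMap (MvPolynomial ι ℚ) K
  have hφ : Function.Injective φ := IsFractionRing.injective _ _
  apply hφ
  have hX : Function.Injective (fun i : ι => φ (X i)) := fun i j h => X_injective (hφ h)
  have hL := congrArg (Polynomial.eval 0) (Lagrange.sum_basis (v := fun i : ι => φ (X i)) (s := s) hX.injOn hs)
  rw [Polynomial.eval_finsetSum, Polynomial.eval_one] at hL
  rw [← one_mul (φ (dyP s a)), ← hL, sum_mul, map_sum]
  refine sum_congr rfl fun i hi => ?_
  rw [h1 i hi, map_mul, map_mul, ← mul_assoc]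
  congr 1
  rw [Lagrange.basis, Polynomial.eval_prod, map_prod, map_prod, ← prod_mul_distrib]
  refine prod_congr rfl fun j hj => ?_
  have : φ (X i) - φ (X j) ≠ 0 := sub_ne_zero.2 fun h => ne_of_mem_erase hj (hX h).symm
  simp only [Lagrange.basisDivisor, Polynomial.eval_mul, Polynomial.eval_C, Polynomial.eval_sub, Polynomial.eval_X, map_sub]
  exact dy_field _ _ this

lemma dyson {ι : Type*} [DecidableEq ι] (M : ℕ) : ∀ (s : Finset ι) (a : ι → ℕ),
    (s.card + ∑ i ∈ s, a i = M) → ∀ d : ι →₀ ℕ, (∀ i ∈ s, d i = ∑ j ∈ s.erase i, a j) →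
    (∀ i, i ∉ s → d i = 0) →
    coeff d (dyP s a) = ((∑ i ∈ s, a i).factorial : ℚ) / ∏ i ∈ s, ((a i).factorial : ℚ) := by
  induction M using Nat.strong_induction_on with
  | _ M ih =>
  intro s a hM d hd hd0
  rcases s.eq_empty_or_nonempty with rfl | hs
  · have : d = 0 := by ext i; simpa using hd0 i (by simp)
    simp [dyP, this]
  by_cases ha : ∀ i ∈ s, 1 ≤ a i
  · have hterm : ∀ i ∈ s, coeff d ((∏ j ∈ s.erase i, X j) * dyP s (Function.update a i (a i - 1)))
        = ((∑ i ∈ s, a i - 1).factorial : ℚ) / (∏ i ∈ s, ((a i).factorial : ℚ)) * a i := by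
      intro i hi
      have hu : ∀ t : Finset ι, i ∉ t → ∀ j ∈ t, Function.update a i (a i - 1) j = a j := by
        intro t hit j hj
        refine Function.update_of_ne ?_ _ _
        rintro rfl
        exact hit hj
      have hsum : ∑ j ∈ s, Function.update a i (a i - 1) j = ∑ j ∈ s, a j - 1 := by
        have h2 : a i + ∑ j ∈ s.erase i, a j = ∑ j ∈ s, a j := add_sum_erase s a hi
        have h3 : ∑ j ∈ s.erase i, Function.update a i (a i - 1) j = ∑ j ∈ s.erase i, a j :=
          sum_congr rfl (hu _ (notMem_erase i s))
        rw [← add_sum_erase _ _ hi, h3,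
          Function.update_self]
        have := ha i hi
        omega
      have hpos : 1 ≤ ∑ j ∈ s, a j := (ha i hi).trans (single_le_sum (fun _ _ => Nat.zero_le _) hi)
      have hprod : (∏ j ∈ s, ((a j).factorial : ℚ)) = a i * ∏ j ∈ s, ((Function.update a i (a i - 1) j).factorial : ℚ) := by
        rw [← mul_prod_erase _ _ hi, ← mul_prod_erase s (fun j => ((Function.update a i (a i - 1) j).factorial : ℚ)) hi, ← mul_assoc]
        congr 1
        · rw [Function.update_self]
          exact_mod_cast (Nat.mul_factorial_pred (by have := ha i hi; omega)).symm
        · exact prod_congr rfl fun j hj => by rw [hu _ (notMem_erase i s) j hj]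
      set e : ι →₀ ℕ := ∑ j ∈ s.erase i, Finsupp.single j 1 with he
      have hei : ∀ l, e l = if l ∈ s.erase i then 1 else 0 := by
        intro l
        rw [he, Finsupp.finsetSum_apply]
        simp [Finsupp.single_apply]
      have hX : (∏ j ∈ s.erase i, X j : MvPolynomial ι ℚ) = monomial e 1 := by
        rw [he, monomial_sum_one]; rfl
      have hle : e ≤ d := by
        intro l
        rw [hei]
        split_ifs with hl
        · rw [hd l (mem_of_mem_erase hl)]
          exact (ha i hi).trans (single_le_sum (f := a) (fun _ _ => Nat.zero_le _) (mem_erase.2 ⟨(ne_of_mem_erase hl).symm, hi⟩))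
        · simp
      rw [hX, coeff_monomial_mul', if_pos hle, one_mul]
      rw [ih (M - 1) (by omega) s _ (by rw [hsum]; omega), hsum, hprod]
      · have : (a i : ℚ) ≠ 0 := by have := ha i hi; positivity
        have : (∏ j ∈ s, ((Function.update a i (a i - 1) j).factorial : ℚ)) ≠ 0 :=
          prod_ne_zero_iff.2 fun j _ => by positivity
        field_simp
      · intro l hl
        rw [Finsupp.tsub_apply, hei, hd l hl]
        by_cases hli : l = i
        · subst hli
          simp only [notMem_erase, if_false, Nat.sub_zero]
          exact (sum_congr rfl (hu _ (notMem_erase _ s))).symm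
        · rw [if_pos (mem_erase.2 ⟨hli, hl⟩)]
          have hi' : i ∈ s.erase l := mem_erase.2 ⟨Ne.symm hli, hi⟩
          have h2 : a i + ∑ j ∈ (s.erase l).erase i, a j = ∑ j ∈ s.erase l, a j := add_sum_erase _ a hi'
          have h3 : ∑ j ∈ (s.erase l).erase i, Function.update a i (a i - 1) j = ∑ j ∈ (s.erase l).erase i, a j :=
            sum_congr rfl (hu _ (notMem_erase i _))
          rw [← add_sum_erase (s.erase l) (Function.update a i (a i - 1)) hi', h3,
            Function.update_self]
          have := ha i hi
          omega
      · intro l hl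
        rw [Finsupp.tsub_apply, hd0 l hl, Nat.zero_sub]
    rw [dy_lagrange s hs a ha, coeff_sum, sum_congr rfl hterm, ← mul_sum]
    obtain ⟨i, hi⟩ := hs
    have hpos : ∑ j ∈ s, a j ≠ 0 := by
      have : 1 ≤ ∑ j ∈ s, a j := (ha i hi).trans (single_le_sum (fun _ _ => Nat.zero_le _) hi)
      omega
    rw [← Nat.mul_factorial_pred hpos]
    push_cast
    ring
  · push Not at ha
    obtain ⟨i, hi, hai⟩ := ha
    have hai : a i = 0 := by omega
    have hP : dyP s a = dyP (s.erase i) a * ∏ j ∈ s.erase i, (X i - X j) ^ a j := by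
      unfold dyP
      rw [← mul_prod_erase _ _ hi]
      simp only [hai, pow_zero, prod_const_one, one_mul]
      rw [← prod_mul_distrib]
      refine prod_congr rfl fun j hj => ?_
      rw [← mul_prod_erase (s.erase j) _ (mem_erase.2 ⟨(ne_of_mem_erase hj).symm, hi⟩), erase_right_comm, mul_comm]
    have hdeg : degreeOf i (dyP (s.erase i) a) = 0 := by
      refine Nat.le_zero.1 ((degreeOf_prod_le _ _ _).trans (Nat.le_zero.2 (sum_eq_zero fun j hj => ?_)))
      refine Nat.le_zero.1 ((degreeOf_prod_le _ _ _).trans (Nat.le_zero.2 (sum_eq_zero fun l hl => ?_)))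
      refine Nat.le_zero.1 ((degreeOf_pow_le _ _ _).trans ?_)
      have : degreeOf i (X l - X j : MvPolynomial ι ℚ) ≤ 0 := by
        refine (degreeOf_sub_le _ _ _).trans ?_
        rw [degreeOf_X, degreeOf_X, if_neg, if_neg]
        · simp
        · exact (ne_of_mem_erase hj).symm
        · exact (ne_of_mem_erase (mem_of_mem_erase hl)).symm
      nlinarith
    have hdd : d = d.erase i + Finsupp.single i (∑ j ∈ s.erase i, a j) := by
      rw [← hd i hi, Finsupp.erase_add_single]
    have hcard := card_erase_add_one hi
    have hsum : ∑ j ∈ s.erase i, a j = ∑ j ∈ s, a j := by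
      rw [← add_sum_erase s a hi, hai, zero_add]
    rw [hP, hdd, dy_zero i _ hdeg _ (notMem_erase i s) _ _ (by simp), ih (M - 1) (by omega) (s.erase i) a (by omega), hsum,
      ← mul_prod_erase s _ hi, hai]
    · simp
    · intro l hl
      rw [Finsupp.erase_ne (ne_of_mem_erase hl), hd l (mem_of_mem_erase hl), erase_right_comm,
        ← add_sum_erase (s.erase l) a (mem_erase.2 ⟨(ne_of_mem_erase hl).symm, hi⟩), hai, zero_add]
    · intro l hl
      by_cases hli : l = i
      · simp [hli]
      · rw [Finsupp.erase_ne hli]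
        exact hd0 l fun h => hl (mem_erase.2 ⟨hli, h⟩)

lemma ao_euler {n : ℕ} (i : Fin n) (d : Fin n →₀ ℕ) (q : MvPolynomial (Fin n) ℚ) :
    coeff d (X i * pderiv i q) = d i * coeff d q := by
  induction q using MvPolynomial.induction_on' with
  | add p q hp hq => rw [map_add, mul_add, coeff_add, hp, hq, coeff_add, mul_add]
  | monomial u r =>
    rw [X_mul_pderiv_monomial, coeff_smul, coeff_monomial]
    split_ifs with h
    · subst h; simp
    · simp

noncomputable def aoV (n : ℕ) : MvPolynomial (Fin n) ℚ :=
  ∏ p ∈ (Finset.univ : Finset (Fin n)).offDiag, (X p.1 - X p.2)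

noncomputable def aoQ {n : ℕ} (q : Fin n × Fin n) : MvPolynomial (Fin n) ℚ :=
  ∏ p ∈ ((Finset.univ : Finset (Fin n)).offDiag).erase q, (X p.1 - X p.2)

lemma aoQ_mul {n : ℕ} {i j : Fin n} (h : i ≠ j) : (X i - X j) * aoQ (i, j) = aoV n := by
  have hm : (i, j) ∈ (Finset.univ : Finset (Fin n)).offDiag := by simpa using h
  rw [aoV, ← mul_prod_erase _ _ hm, aoQ]

lemma ao_X_sub_ne {n : ℕ} {i j : Fin n} (h : i ≠ j) : (X i - X j : MvPolynomial (Fin n) ℚ) ≠ 0 :=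
  sub_ne_zero.2 fun h' => h (X_injective h')

lemma aoQ_swap {n : ℕ} {i j : Fin n} (h : i ≠ j) : aoQ (j, i) = - aoQ (i, j) := by
  apply mul_left_cancel₀ (ao_X_sub_ne h.symm)
  rw [aoQ_mul h.symm, ← aoQ_mul h]
  ring

lemma ao_pderiv_prod {ι : Type*} [DecidableEq ι] {n : ℕ} (i : Fin n) (s : Finset ι) (f : ι → MvPolynomial (Fin n) ℚ) :
    pderiv i (∏ p ∈ s, f p) = ∑ p ∈ s, pderiv i (f p) * ∏ q ∈ s.erase p, f q := by
  induction s using Finset.induction_on with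
  | empty => simp
  | insert a s ha ih =>
    rw [prod_insert ha, pderiv_mul, ih, sum_insert ha, erase_insert ha, mul_sum]
    congr 1
    refine sum_congr rfl fun p hp => ?_
    have hpa : a ≠ p := fun h => ha (h ▸ hp)
    rw [erase_insert_of_ne hpa, prod_insert (fun h => ha (mem_of_mem_erase h))]
    ring

lemma ao_pderiv_V {n : ℕ} (i : Fin n) : pderiv i (aoV n) = ∑ j ∈ univ.erase i, 2 * aoQ (i, j) := by
  have hz : ∀ p : Fin n × Fin n, pderiv i (X p.1 - X p.2 : MvPolynomial (Fin n) ℚ)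
      = (if p.1 = i then 1 else 0) - (if p.2 = i then 1 else 0) := by
    intro p
    rw [map_sub, pderiv_X, pderiv_X]
    simp [Pi.single_apply]
  have h1 : ∑ p ∈ (univ : Finset (Fin n)).offDiag, (if p.1 = i then 1 else 0) * aoQ p
      = ∑ j ∈ univ.erase i, aoQ (i, j) := by
    simp only [ite_mul, one_mul, zero_mul]
    rw [← sum_filter]
    refine sum_bij' (fun p _ => p.2) (fun j _ => (i, j)) ?_ ?_ ?_ ?_ ?_ <;> aesop
  have h2 : ∑ p ∈ (univ : Finset (Fin n)).offDiag, (if p.2 = i then 1 else 0) * aoQ p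
      = ∑ j ∈ univ.erase i, aoQ (j, i) := by
    simp only [ite_mul, one_mul, zero_mul]
    rw [← sum_filter]
    refine sum_bij' (fun p _ => p.1) (fun j _ => (j, i)) ?_ ?_ ?_ ?_ ?_ <;> aesop
  rw [aoV, ao_pderiv_prod]
  calc _ = ∑ p ∈ (univ : Finset (Fin n)).offDiag, ((if p.1 = i then 1 else 0) * aoQ p - (if p.2 = i then 1 else 0) * aoQ p) := by
        refine sum_congr rfl fun p _ => ?_
        rw [hz, sub_mul]; rfl
    _ = _ := by
        rw [sum_sub_distrib, h1, h2, ← sum_sub_distrib]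
        refine sum_congr rfl fun j hj => ?_
        rw [aoQ_swap (ne_of_mem_erase hj).symm]
        ring

lemma ao_pderiv_D {n : ℕ} (m : ℕ) (i : Fin n) :
    pderiv i (aoV n ^ m) = (m : MvPolynomial (Fin n) ℚ) * ∑ j ∈ univ.erase i, aoV n ^ (m - 1) * (2 * aoQ (i, j)) := by
  rw [pderiv_pow, ao_pderiv_V, mul_sum, mul_sum]
  exact sum_congr rfl fun j _ => by ring

lemma ao_rename_V {n : ℕ} (τ : Equiv.Perm (Fin n)) : rename τ (aoV n) = aoV n := by
  unfold aoV
  rw [map_prod]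
  refine prod_bij' (fun p _ => (τ p.1, τ p.2)) (fun p _ => (τ.symm p.1, τ.symm p.2)) ?_ ?_ ?_ ?_ ?_ <;> simp

lemma ao_rename_Q {n : ℕ} {i j : Fin n} (h : i ≠ j) : rename (Equiv.swap i j) (aoQ (i, j)) = - aoQ (i, j) := by
  have h1 := congrArg (rename (Equiv.swap i j)) (aoQ_mul h)
  rw [ao_rename_V, map_mul, map_sub, rename_X, rename_X, Equiv.swap_apply_left, Equiv.swap_apply_right, ← aoQ_mul h] at h1
  apply mul_left_cancel₀ (ao_X_sub_ne h.symm)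
  rw [h1]; ring

noncomputable def aoE (n a N : ℕ) (p : MvPolynomial (Fin n) ℚ) : ℚ :=
  coeff (Finsupp.equivFunOnFinite.symm fun _ => a) (p * (∑ j, X j) ^ N)

lemma aoE_rename {n a N : ℕ} (τ : Equiv.Perm (Fin n)) (p : MvPolynomial (Fin n) ℚ) :
    aoE n a N (rename τ p) = aoE n a N p := by
  have h : (∑ j, X j : MvPolynomial (Fin n) ℚ) = rename τ (∑ j, X j) := by
    rw [map_sum]
    simp only [rename_X]
    exact (Equiv.sum_comp τ (fun j => (X j : MvPolynomial (Fin n) ℚ))).symm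
  unfold aoE
  conv_lhs => rw [h]
  rw [← map_pow, ← map_mul]
  have hd : (Finsupp.equivFunOnFinite.symm fun _ => a : Fin n →₀ ℕ) =
      (Finsupp.equivFunOnFinite.symm fun _ => a : Fin n →₀ ℕ).mapDomain τ := by
    ext i
    rw [Finsupp.mapDomain_equiv_apply]
    simp
  conv_lhs => rw [hd]
  rw [coeff_rename_mapDomain _ τ.injective]

lemma aoE_add {n a N : ℕ} (p q : MvPolynomial (Fin n) ℚ) : aoE n a N (p + q) = aoE n a N p + aoE n a N q := by
  simp [aoE, add_mul]
lemma aoE_sub {n a N : ℕ} (p q : MvPolynomial (Fin n) ℚ) : aoE n a N (p - q) = aoE n a N p - aoE n a N q := by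
  simp [aoE, sub_mul]
lemma aoE_neg {n a N : ℕ} (p : MvPolynomial (Fin n) ℚ) : aoE n a N (-p) = - aoE n a N p := by
  simp [aoE]
lemma aoE_nat {n a N : ℕ} (c : ℕ) (p : MvPolynomial (Fin n) ℚ) : aoE n a N (c * p) = c * aoE n a N p := by
  have : (c : MvPolynomial (Fin n) ℚ) = C (c : ℚ) := by simp
  rw [aoE, this, mul_assoc, coeff_C_mul, aoE]
lemma aoE_sum {n a N : ℕ} {ι : Type*} (s : Finset ι) (f : ι → MvPolynomial (Fin n) ℚ) :
    aoE n a N (∑ i ∈ s, f i) = ∑ i ∈ s, aoE n a N (f i) := by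
  simp [aoE, sum_mul, coeff_sum]

lemma ao_ibp {n a N : ℕ} (i : Fin n) (p : MvPolynomial (Fin n) ℚ) :
    a * aoE n a N p = aoE n a N (X i * pderiv i p) + N * aoE n a (N - 1) (X i * p) := by
  have h := ao_euler i (Finsupp.equivFunOnFinite.symm fun _ => a) (p * (∑ j, X j) ^ N)
  have hs : pderiv i (∑ j, X j : MvPolynomial (Fin n) ℚ) = 1 := by
    rw [map_sum]; simp [pderiv_X, Pi.single_apply]
  rw [pderiv_mul, pderiv_pow, hs, mul_one] at h
  have h2 : X i * (pderiv i p * (∑ j, X j) ^ N + p * ((N : MvPolynomial (Fin n) ℚ) * (∑ j, X j) ^ (N - 1)))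
    = X i * pderiv i p * (∑ j, X j) ^ N + (N : MvPolynomial (Fin n) ℚ) * (X i * p) * (∑ j, X j) ^ (N - 1) := by ring
  rw [h2, coeff_add] at h
  rw [← aoE_nat (N := N - 1)]
  exact h.symm

lemma ao_rename_T {n : ℕ} (T : Finset (Fin n)) (τ : Equiv.Perm (Fin n)) (h : ∀ l, τ l ∈ T ↔ l ∈ T) :
    rename τ (∏ l ∈ T, X l : MvPolynomial (Fin n) ℚ) = ∏ l ∈ T, X l := by
  rw [map_prod]
  simp only [rename_X]
  refine prod_bij' (fun l _ => τ l) (fun l _ => τ.symm l) ?_ ?_ ?_ ?_ ?_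
  · intro l hl; exact (h l).2 hl
  · intro l hl; rw [← h]; simpa using hl
  all_goals simp

lemma ao_swap_mem {n : ℕ} (T : Finset (Fin n)) (i j : Fin n) (h : i ∈ T ↔ j ∈ T) (l : Fin n) :
    Equiv.swap i j l ∈ T ↔ l ∈ T := by
  rw [Equiv.swap_apply_def]
  split_ifs with h1 h2
  · rw [h1, h]
  · rw [h2, h]
  · rfl

lemma ao_pair {n a N m : ℕ} (hm : 1 ≤ m) (T : Finset (Fin n)) (i j : Fin n) (hi : i ∉ T) (hij : i ≠ j) :
    aoE n a N (X i * (∏ l ∈ T, X l) * (aoV n ^ (m - 1) * (2 * aoQ (i, j)))) =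
      if j ∈ T then 0 else aoE n a N ((∏ l ∈ T, X l) * aoV n ^ m) := by
  split_ifs with hj
  · have h := aoE_rename (a := a) (N := N) (Equiv.swap i j) (X i * (∏ l ∈ T, X l) * (aoV n ^ (m - 1) * (2 * aoQ (i, j))))
    have hT : rename (Equiv.swap i j) (X i * (∏ l ∈ T, X l) : MvPolynomial (Fin n) ℚ) = X i * ∏ l ∈ T, X l := by
      rw [← prod_insert hi]
      exact ao_rename_T _ _ (ao_swap_mem _ _ _ (by simp [hj]))
    rw [map_mul, hT, map_mul, map_mul, map_pow, ao_rename_V, ao_rename_Q hij, map_ofNat, mul_neg, mul_neg, mul_neg, aoE_neg] at h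
    linarith
  · have h := aoE_rename (a := a) (N := N) (Equiv.swap i j) (X i * (∏ l ∈ T, X l) * (aoV n ^ (m - 1) * (2 * aoQ (i, j))))
    have hT : rename (Equiv.swap i j) (∏ l ∈ T, X l : MvPolynomial (Fin n) ℚ) = ∏ l ∈ T, X l := 
      ao_rename_T _ _ (ao_swap_mem _ _ _ (by simp [hj, hi]))
    rw [map_mul, map_mul, hT, map_mul, map_mul, map_pow, ao_rename_V, ao_rename_Q hij, map_ofNat, rename_X, Equiv.swap_apply_left, mul_neg, mul_neg, mul_neg, aoE_neg] at h
    have h2 : X i * (∏ l ∈ T, X l) * (aoV n ^ (m - 1) * (2 * aoQ (i, j))) - X j * (∏ l ∈ T, X l) * (aoV n ^ (m - 1) * (2 * aoQ (i, j)))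
        = ((2 : ℕ) : MvPolynomial (Fin n) ℚ) * ((∏ l ∈ T, X l) * aoV n ^ m) := by
      obtain ⟨m, rfl⟩ : ∃ m', m = m' + 1 := ⟨m - 1, by omega⟩
      rw [Nat.add_sub_cancel, pow_succ]
      nth_rewrite 4 [← aoQ_mul hij]
      push_cast
      ring
    have h3 := congrArg (aoE n a N) h2
    rw [aoE_sub, aoE_nat] at h3
    push_cast at h3
    linarith

lemma ao_rec {n a N m : ℕ} (T : Finset (Fin n)) (i : Fin n) (hi : i ∉ T) :
    ((a : ℚ) - m * ((n - 1 - T.card : ℕ) : ℚ)) * aoE n a N ((∏ l ∈ T, X l) * aoV n ^ m)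
      = N * aoE n a (N - 1) ((∏ l ∈ insert i T, X l) * aoV n ^ m) := by
  have h := ao_ibp (a := a) (N := N) i ((∏ l ∈ T, X l) * aoV n ^ m)
  have hT : pderiv i (∏ l ∈ T, X l : MvPolynomial (Fin n) ℚ) = 0 := by
    rw [ao_pderiv_prod]
    refine sum_eq_zero fun l hl => ?_
    have hli : l ≠ i := by
      rintro rfl
      exact hi hl
    rw [pderiv_X_of_ne hli, zero_mul]
  rw [pderiv_mul, hT, zero_mul, zero_add, ao_pderiv_D] at h
  have h2 : X i * ((∏ l ∈ T, X l) * ((m : MvPolynomial (Fin n) ℚ) * ∑ j ∈ univ.erase i, aoV n ^ (m - 1) * (2 * aoQ (i, j))))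
     = (m : MvPolynomial (Fin n) ℚ) * ∑ j ∈ univ.erase i, X i * (∏ l ∈ T, X l) * (aoV n ^ (m - 1) * (2 * aoQ (i, j))) := by
    simp only [mul_sum]
    exact sum_congr rfl fun j _ => by ring
  have h3 : (m : ℚ) * aoE n a N (∑ j ∈ univ.erase i, X i * (∏ l ∈ T, X l) * (aoV n ^ (m - 1) * (2 * aoQ (i, j))))
     = m * (((n - 1 - T.card : ℕ) : ℚ) * aoE n a N ((∏ l ∈ T, X l) * aoV n ^ m)) := by
    rcases Nat.eq_zero_or_pos m with rfl | hm
    · simp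
    congr 1
    rw [aoE_sum, sum_congr rfl fun j hj => ao_pair hm T i j hi (ne_of_mem_erase hj).symm]
    rw [sum_ite, sum_const_zero, zero_add, sum_const, nsmul_eq_mul]
    congr 2
    have : (univ.erase i).filter (fun j => j ∉ T) = univ \ insert i T := by
      ext j; simp
    rw [this, card_sdiff_of_subset (subset_univ _), card_insert_of_notMem hi, card_univ, Fintype.card_fin]
    omega
  rw [h2, aoE_nat, h3, ← mul_assoc (X i), ← prod_insert hi] at h
  linarith

lemma ao_T_coeff {n a N : ℕ} (ha : 1 ≤ a) (T : Finset (Fin n)) (p : MvPolynomial (Fin n) ℚ) :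
    aoE n a N ((∏ l ∈ T, X l) * p) =
      coeff (Finsupp.equivFunOnFinite.symm fun j => if j ∈ T then a - 1 else a) (p * (∑ j, X j) ^ N) := by
  have hX : (∏ j ∈ T, X j : MvPolynomial (Fin n) ℚ) = monomial (∑ j ∈ T, Finsupp.single j 1) 1 := by
    rw [monomial_sum_one]; rfl
  have hd : (Finsupp.equivFunOnFinite.symm fun _ => a : Fin n →₀ ℕ) = (∑ j ∈ T, Finsupp.single j 1)
      + (Finsupp.equivFunOnFinite.symm fun j => if j ∈ T then a - 1 else a) := by
    ext l
    rw [Finsupp.add_apply, Finsupp.finsetSum_apply]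
    simp only [Finsupp.single_apply, Finsupp.equivFunOnFinite_symm_apply_apply, sum_ite_eq']
    split_ifs <;> omega
  rw [aoE, hd, hX, mul_assoc, coeff_monomial_mul, one_mul]

noncomputable def aoR (n m k s : ℕ) : ℚ :=
  (∏ j ∈ Finset.range s, (1 : ℚ) / ((k : ℚ) - j * m)) *
    ((Nat.factorial (n * k - (n - s) - m * n * (n - 1)) : ℚ) / (m.factorial : ℚ) ^ n) *
    ∏ j ∈ Finset.range n, ((((j + 1) * m).factorial : ℚ) / ((k - 1 - j * m).factorial : ℚ))

lemma ao_bound {n m k : ℕ} (hkm : m * (n - 1) < k) : m * n * (n - 1) + n ≤ n * k := by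
  have : n * (m * (n - 1) + 1) ≤ n * k := Nat.mul_le_mul_left _ hkm
  nlinarith

lemma ao_ne {n m k s : ℕ} (hs : s < n) (hkm : m * (n - 1) < k) : (k : ℚ) - s * m ≠ 0 := by
  have h1 : s * m ≤ m * (n - 1) := by rw [mul_comm]; exact Nat.mul_le_mul_left _ (by omega)
  have h2 : s * m < k := by omega
  have h3 : ((s : ℚ) * m) < k := by exact_mod_cast h2
  linarith

lemma aoR_step {n m k s : ℕ} (hs : s < n) (hkm : m * (n - 1) < k) :
    ((k : ℚ) - m * s) * aoR n m k (s + 1) = ((n * k - (n - (s + 1)) - m * n * (n - 1) : ℕ) : ℚ) * aoR n m k s := by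
  have hb := ao_bound hkm
  have h0 := ao_ne hs hkm
  have hN : n * k - (n - (s + 1)) - m * n * (n - 1) = (n * k - (n - s) - m * n * (n - 1)) + 1 := by omega
  unfold aoR
  rw [hN, prod_range_succ, Nat.factorial_succ, mul_comm (m : ℚ) s]
  push_cast
  field_simp

lemma aoR_shift {n m k : ℕ} (hkm : m * (n - 1) < k) : aoR n m (k + 1) 0 = aoR n m k n := by
  unfold aoR
  have h : n * (k + 1) - (n - 0) - m * n * (n - 1) = n * k - (n - n) - m * n * (n - 1) := by
    rw [mul_add]; omega
  rw [h, prod_range_zero, one_mul, mul_comm (∏ j ∈ range n, (1 : ℚ) / _), mul_assoc (_ / _), ← prod_mul_distrib]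
  congr 1
  refine prod_congr rfl fun j hj => ?_
  have hj := mem_range.1 hj
  have h0 := ao_ne hj hkm
  have h1 : j * m ≤ m * (n - 1) := by rw [mul_comm]; exact Nat.mul_le_mul_left _ (by omega)
  have h2 : k + 1 - 1 - j * m = (k - 1 - j * m) + 1 := by omega
  have h3 : ((k - 1 - j * m : ℕ) : ℚ) + 1 = k - j * m := by
    rw [eq_sub_iff_add_eq]
    exact_mod_cast (by omega : k - 1 - j * m + 1 + j * m = k)
  rw [h2, Nat.factorial_succ]
  push_cast
  rw [h3]
  field_simp

lemma aoR_base {n m : ℕ} (hn : 1 ≤ n) : aoR n m (m * (n - 1) + 1) 0 = ((n * m).factorial : ℚ) / (m.factorial : ℚ) ^ n := by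
  unfold aoR
  have h : n * (m * (n - 1) + 1) - (n - 0) - m * n * (n - 1) = 0 := by
    have : n * (m * (n - 1) + 1) = m * n * (n - 1) + n := by ring
    omega
  rw [h, prod_range_zero, prod_div_distrib]
  have h2 : ∏ j ∈ range n, ((m * (n - 1) + 1 - 1 - j * m).factorial : ℚ) = ∏ j ∈ range n, ((j * m).factorial : ℚ) := by
    rw [← prod_range_reflect (fun j => ((j * m).factorial : ℚ))]
    refine prod_congr rfl fun j _ => ?_
    rw [Nat.add_sub_cancel, mul_comm j m, ← Nat.mul_sub, mul_comm]
  have h3 := prod_range_succ (fun j => ((j * m).factorial : ℚ)) n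
  rw [prod_range_succ'] at h3
  have h4 : ∏ j ∈ range n, ((j * m).factorial : ℚ) ≠ 0 := prod_ne_zero_iff.2 fun j _ => by positivity
  simp only [zero_mul, Nat.factorial_zero, Nat.cast_one, mul_one] at h3
  rw [h2, h3]
  field_simp
  simp

lemma dyP_univ (n m : ℕ) : dyP (univ : Finset (Fin n)) (fun _ => m) = aoV n ^ m := by
  unfold dyP aoV
  rw [← prod_pow, prod_sigma']
  refine prod_bij' (fun p _ => (p.2, p.1)) (fun p _ => ⟨p.2, p.1⟩) ?_ ?_ ?_ ?_ ?_ <;> simp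

lemma ao_dyson (n m : ℕ) : aoE n (m * (n - 1)) 0 (aoV n ^ m) = ((n * m).factorial : ℚ) / (m.factorial : ℚ) ^ n := by
  rw [aoE, pow_zero, mul_one, ← dyP_univ, dyson _ univ _ rfl]
  · simp
  · intro i _
    simp [card_erase_of_mem, mul_comm]
  · simp


lemma ao_main_step {n m k : ℕ} (s : ℕ) (hkm : m * (n - 1) < k)
    (ih : s ≤ n → ∀ T : Finset (Fin n), T.card + s = n →
      aoE n k (n * k - (n - s) - m * n * (n - 1)) ((∏ l ∈ T, X l) * aoV n ^ m) = aoR n m k s) :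
    s + 1 ≤ n → ∀ T : Finset (Fin n), T.card + (s + 1) = n →
      aoE n k (n * k - (n - (s + 1)) - m * n * (n - 1)) ((∏ l ∈ T, X l) * aoV n ^ m) = aoR n m k (s + 1) := by
  intro hs T hT
  have hex : ∃ i, i ∉ T := by
    by_contra h
    push Not at h
    have : T = univ := eq_univ_iff_forall.2 h
    rw [this, card_univ, Fintype.card_fin] at hT
    omega
  obtain ⟨i, hi⟩ := hex
  have h := ao_rec (a := k) (N := n * k - (n - (s + 1)) - m * n * (n - 1)) (m := m) T i hi
  have hb := ao_bound hkm
  have hN : n * k - (n - (s + 1)) - m * n * (n - 1) - 1 = n * k - (n - s) - m * n * (n - 1) := by omega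
  have hc : n - 1 - T.card = s := by omega
  have h0 := ao_ne (s := s) (by omega) hkm
  rw [hN, hc, ih (by omega) (insert i T) (by rw [card_insert_of_notMem hi]; omega), ← aoR_step (by omega) hkm] at h
  rw [mul_comm (s : ℚ)] at h0
  exact mul_left_cancel₀ h0 h

lemma ao_main {n m : ℕ} (hn : 1 ≤ n) (e : ℕ) : ∀ s ≤ n, ∀ T : Finset (Fin n), T.card + s = n →
    aoE n (m * (n - 1) + 1 + e) (n * (m * (n - 1) + 1 + e) - (n - s) - m * n * (n - 1)) ((∏ l ∈ T, X l) * aoV n ^ m)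
      = aoR n m (m * (n - 1) + 1 + e) s := by
  induction e with
  | zero => 
    intro s
    induction s with
    | zero =>
      intro _ T hT
      have hT : T = univ := by
        rw [← card_eq_iff_eq_univ, Fintype.card_fin]; simpa using hT
      subst hT
      have h : n * (m * (n - 1) + 1 + 0) - (n - 0) - m * n * (n - 1) = 0 := by
        have : n * (m * (n - 1) + 1) = m * n * (n - 1) + n := by ring
        rw [add_zero]
        omega
      rw [h, add_zero, aoR_base hn, ← ao_dyson, ao_T_coeff (by omega)]
      simp [aoE]
    | succ s ih => exact ao_main_step s (by omega) ih
  | succ e ihe =>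
    intro s
    induction s with
    | zero =>
      intro _ T hT
      have hT : T = univ := by
        rw [← card_eq_iff_eq_univ, Fintype.card_fin]; simpa using hT
      subst hT
      have h := ihe n le_rfl ∅ (by simp)
      rw [← add_assoc, aoR_shift (by omega), ← h, ao_T_coeff (by omega)]
      have h : n * (m * (n - 1) + 1 + e + 1) - (n - 0) - m * n * (n - 1) =
          n * (m * (n - 1) + 1 + e) - (n - n) - m * n * (n - 1) := by
        rw [mul_add n _ 1]; omega
      rw [h]
      simp [aoE]
    | succ s ih => exact ao_main_step s (by omega) ih

/-- Proposition 1 of Zhao (from Aomoto's identity): the coefficient of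
`x_1^{k_1-1} ⋯ x_n^{k_n-1}` in `∏_{i≠j} (x_i - x_j)^m (x_1 + ⋯ + x_n)^{Σ(k_j-1) - mn(n-1)}`. -/
theorem aomoto_coefficient {n : ℕ} (hn : 1 ≤ n) (m k : ℕ) (hk : 1 ≤ k)
    (kk : Fin n → ℕ) (hkk : ∀ j, kk j = k ∨ kk j = k + 1)
    (hkm : m * (n - 1) < k) :
    MvPolynomial.coeff (Finsupp.equivFunOnFinite.symm fun j => kk j - 1)
      ((∏ p ∈ Finset.univ.offDiag, (X p.1 - X p.2 : MvPolynomial (Fin n) ℚ) ^ m) *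
        (∑ j, X j) ^ ((∑ j, (kk j - 1)) - m * n * (n - 1))) =
      (∏ j ∈ Finset.range ((Finset.univ.filter fun j => kk j = k + 1).card),
          (1 : ℚ) / ((k : ℚ) - j * m)) *
        ((Nat.factorial ((∑ j, (kk j - 1)) - m * n * (n - 1)) : ℚ) / (m.factorial : ℚ) ^ n) *
        ∏ j ∈ Finset.range n,
          ((((j + 1) * m).factorial : ℚ) / ((k - 1 - j * m).factorial : ℚ)) := by
  have hset : ∀ j, kk j - 1 = if j ∈ (univ.filter fun j => kk j = k) then k - 1 else k := by
    intro j
    rcases hkk j with h | h <;> simp [h]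
  set T := univ.filter fun j => kk j = k with hT
  have hcard : T.card + (univ.filter fun j => kk j = k + 1).card = n := by
    have h1 : (univ.filter fun j => kk j = k + 1) = univ.filter fun j => ¬ kk j = k := by
      ext j
      rcases hkk j with h | h <;> simp [h]
    rw [h1, hT, card_filter_add_card_filter_not, card_univ, Fintype.card_fin]
  set s := (univ.filter fun j => kk j = k + 1).card with hs
  have hsum : ∑ j, (kk j - 1) = n * k - (n - s) := by
    have h1 : ∑ j, (kk j - 1) + T.card = n * k := by
      have h2 : T.card = ∑ j, if j ∈ T then 1 else 0 := by simp
      rw [h2, ← sum_add_distrib]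
      have h3 : ∀ j, kk j - 1 + (if j ∈ T then 1 else 0) = k := by
        intro j
        rw [hset j]
        split_ifs <;> omega
      simp [h3]
    omega
  obtain ⟨e, rfl⟩ : ∃ e, k = m * (n - 1) + 1 + e := ⟨k - (m * (n - 1) + 1), by omega⟩
  have h := ao_main (m := m) hn e s (by omega) T hcard
  rw [ao_T_coeff (by omega)] at h
  rw [hsum, prod_pow]
  simp only [hset]
  exact h
end

section
/- Let m, k, n be positive integers with k > m(n−1). Then the coefficient of x_1^{k−1}···x_n^{k−1} in ∏_{1≤i≠j≤n}(x_i − x_j)^m · (x_1 + ... + x_n)^{n(k−1) − mn(n−1)} over ℚ equals (n(k−1) − mn(n−1))!/(m!)^n · ∏_{j=1}^n (jm)!/(k − 1 − (j−1)m)!; in particular this coefficient is nonzero. -/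
open Finset MvPolynomial

/-- `q` is the top form of `p` in degree `N`. -/
def AoTop {n : ℕ} (p q : MvPolynomial (Fin n) ℚ) (N : ℕ) : Prop :=
  (∀ d : Fin n →₀ ℕ, N < d.degree → coeff d p = 0 ∧ coeff d q = 0) ∧
    ∀ d : Fin n →₀ ℕ, d.degree = N → coeff d p = coeff d q

theorem AoTop.mul {n : ℕ} {p q p' q' : MvPolynomial (Fin n) ℚ} {N N' : ℕ}
    (h : AoTop p q N) (h' : AoTop p' q' N') : AoTop (p * p') (q * q') (N + N') := by
  constructor
  · intro d hd
    rw [coeff_mul, coeff_mul]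
    constructor <;>
    · apply Finset.sum_eq_zero
      rintro ⟨a, b⟩ hab
      rw [HasAntidiagonal.mem_antidiagonal] at hab
      simp only at hab ⊢
      subst hab
      rw [map_add] at hd
      by_cases ha : N < a.degree
      · simp [(h.1 a ha).1, (h.1 a ha).2]
      · have hb : N' < b.degree := by omega
        simp [(h'.1 b hb).1, (h'.1 b hb).2]
  · intro d hd
    rw [coeff_mul, coeff_mul]
    apply Finset.sum_congr rfl
    rintro ⟨a, b⟩ hab
    rw [HasAntidiagonal.mem_antidiagonal] at hab
    simp only at hab ⊢
    subst hab
    rw [map_add] at hd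
    by_cases ha : N < a.degree
    · simp [(h.1 a ha).1, (h.1 a ha).2]
    · by_cases hb : N' < b.degree
      · simp [(h'.1 b hb).1, (h'.1 b hb).2]
      · rw [h.2 a (by omega), h'.2 b (by omega)]

theorem AoTop.one {n : ℕ} : AoTop (1 : MvPolynomial (Fin n) ℚ) 1 0 := by
  constructor
  · intro d hd
    have : (0 : Fin n →₀ ℕ) ≠ d := by rintro rfl; simp at hd
    simp [coeff_one, this]
  · intros; rfl

theorem AoTop.prod {n : ℕ} {ι : Type*} (s : Finset ι) (p q : ι → MvPolynomial (Fin n) ℚ)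
    (N : ι → ℕ) (h : ∀ i ∈ s, AoTop (p i) (q i) (N i)) :
    AoTop (∏ i ∈ s, p i) (∏ i ∈ s, q i) (∑ i ∈ s, N i) := by
  classical
  induction s using Finset.induction_on with
  | empty => simpa using AoTop.one
  | insert a s ha ih =>
    rw [prod_insert ha, prod_insert ha, sum_insert ha]
    exact (h a (mem_insert_self _ _)).mul (ih fun i hi => h i (mem_insert_of_mem hi))

theorem AoTop.lin {n : ℕ} {q : MvPolynomial (Fin n) ℚ} (hq : q.IsHomogeneous 1) (c : ℚ) :
    AoTop (q - C c) q 1 := by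
  have hz : ∀ d : Fin n →₀ ℕ, 1 ≤ d.degree → coeff d (C c : MvPolynomial (Fin n) ℚ) = 0 := by
    intro d hd
    have : (0 : Fin n →₀ ℕ) ≠ d := by rintro rfl; simp at hd
    simp [coeff_C, this]
  constructor
  · intro d hd
    have : coeff d q = 0 := hq.coeff_eq_zero (by omega)
    simp [this, hz d hd.le]
  · intro d hd
    simp [hz d hd.ge]

/-- interpolation weights -/
def aoW (K c : ℕ) : ℚ := (-1) ^ (K - c) / (c.factorial * (K - c).factorial)

theorem aoW_sum (K a : ℕ) (ha : a ≤ K) :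
    ∑ c ∈ range (K + 1), aoW K c * (c : ℚ) ^ a = if a = K then 1 else 0 := by
  have key : ∀ f : ℚ → ℚ, ∑ c ∈ range (K + 1), aoW K c * f c =
      (fwdDiff (1:ℚ))^[K] f 0 / K.factorial := by
    intro f
    rw [fwdDiff_iter_eq_sum_shift, Finset.sum_div]
    apply Finset.sum_congr rfl
    intro c hc
    have hc' : c ≤ K := by simpa [Nat.lt_succ_iff] using hc
    rw [aoW, zsmul_eq_mul]
    push_cast
    rw [Nat.cast_choose ℚ hc']
    have := Nat.factorial_ne_zero K
    have := Nat.factorial_ne_zero c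
    have := Nat.factorial_ne_zero (K - c)
    simp only [zero_add, nsmul_eq_mul, mul_one]
    field_simp
  rw [key (fun x => x ^ a)]
  split_ifs with h
  · subst h
    rw [fwdDiff_iter_eq_factorial]
    have := Nat.factorial_ne_zero a
    simp [this]
  · rw [fwdDiff_iter_pow_eq_zero_of_lt (by omega)]
    simp

theorem ao_null {n K : ℕ} (p : MvPolynomial (Fin n) ℚ)
    (hp : ∀ d : Fin n →₀ ℕ, n * K < d.degree → coeff d p = 0) :
    coeff (Finsupp.equivFunOnFinite.symm fun _ : Fin n => K) p =
      ∑ c ∈ Fintype.piFinset (fun _ : Fin n => range (K + 1)),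
        (∏ i, aoW K (c i)) * eval (fun i => (c i : ℚ)) p := by
  simp_rw [eval_eq', Finset.mul_sum]
  rw [Finset.sum_comm]
  have h1 : ∀ d ∈ p.support, (∑ c ∈ Fintype.piFinset (fun _ : Fin n => range (K + 1)),
      (∏ i, aoW K (c i)) * (coeff d p * ∏ i, (c i : ℚ) ^ d i)) =
      if d = (Finsupp.equivFunOnFinite.symm fun _ : Fin n => K) then coeff d p else 0 := by
    intro d hd
    have h2 : (∑ c ∈ Fintype.piFinset (fun _ : Fin n => range (K + 1)),
      (∏ i, aoW K (c i)) * (coeff d p * ∏ i, (c i : ℚ) ^ d i)) =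
      coeff d p * ∏ i, ∑ c ∈ range (K + 1), aoW K c * (c : ℚ) ^ d i := by
      rw [Finset.prod_univ_sum, Finset.mul_sum]
      apply Finset.sum_congr rfl
      intro c _
      rw [Finset.prod_mul_distrib]
      ring
    rw [h2]
    split_ifs with h
    · subst h
      have : ∀ i : Fin n, ∑ c ∈ range (K + 1), aoW K c * (c : ℚ) ^
          ((Finsupp.equivFunOnFinite.symm fun _ : Fin n => K) i) = 1 := by
        intro i
        rw [aoW_sum] <;> simp
      simp only [this]
      simp
    · have hdeg : d.degree ≤ n * K := by
        by_contra hc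
        exact (mem_support_iff.mp hd) (hp d (by omega))
      obtain ⟨i, hi⟩ : ∃ i, d i < K := by
        by_contra! hc
        apply h
        have hsum : ∑ i, d i ≤ ∑ i : Fin n, K := by
          rw [Finsupp.degree_eq_sum] at hdeg
          simpa using hdeg
        have := (Finset.sum_eq_sum_iff_of_le (fun i _ => hc i)).1
          (le_antisymm (Finset.sum_le_sum fun i _ => hc i) hsum)
        ext i
        simpa using (this i (mem_univ i)).symm
      rw [Finset.prod_eq_zero (mem_univ i), mul_zero]
      rw [aoW_sum _ _ hi.le, if_neg hi.ne]
  rw [Finset.sum_congr rfl h1]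
  rw [Finset.sum_ite_eq']
  split_ifs with h
  · rfl
  · simpa using h

theorem ao_sorted {n m K : ℕ} (b : Fin n → ℕ) (hbK : ∀ i, b i ≤ K)
    (hb : ∀ i j : Fin n, i < j → b i + m ≤ b j) (i : Fin n) :
    i.val * m ≤ b i ∧ b i + (n - 1 - i.val) * m ≤ K := by
  constructor
  · obtain ⟨i, hi⟩ := i
    simp only
    induction i with
    | zero => simp
    | succ i ih =>
      have := ih (by omega)
      have := hb ⟨i, by omega⟩ ⟨i + 1, hi⟩ (by simp)
      rw [add_mul]; omega
  · have : ∀ t, ∀ i : Fin n, n - 1 - i.val = t → b i + t * m ≤ K := by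
      intro t
      induction t with
      | zero => intro i _; simpa using hbK i
      | succ t ih =>
        intro i hi
        have := ih ⟨i.val + 1, by omega⟩ (by simp only; omega)
        have := hb i ⟨i.val + 1, by omega⟩ (by simp [Fin.lt_def])
        rw [add_mul]; omega
    exact this _ i rfl

theorem ao_unique {n m K : ℕ} (hm : 1 ≤ m) (c : Fin n → ℕ)
    (hcK : ∀ i, c i ≤ K)
    (hc : ∀ i j : Fin n, i < j → c i + m ≤ c j ∨ c j + m + 1 ≤ c i)
    (hs : ∑ i, c i ≤ (∑ i : Fin n, i.val * m) ∨
      (∑ i : Fin n, (K - (n - 1 - i.val) * m)) < ∑ i, c i) :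
    ∀ i, c i = i.val * m := by
  set σ := Tuple.sort c with hσ
  have hmono : Monotone (c ∘ σ) := Tuple.monotone_sort c
  have hne : ∀ i j, i ≠ j → c i + m ≤ c j ∨ c j + m ≤ c i := by
    intro i j hij
    rcases lt_or_gt_of_ne hij with h | h
    · have := hc i j h; omega
    · have := hc j i h; omega
  have hb : ∀ i j : Fin n, i < j → (c ∘ σ) i + m ≤ (c ∘ σ) j := by
    intro i j hij
    have h1 := hmono hij.le
    have h2 := hne (σ i) (σ j) (fun h => hij.ne (σ.injective h))
    simp only [Function.comp] at *
    omega
  have hsort := ao_sorted (c ∘ σ) (fun i => hcK _) hb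
  have hsum : ∑ i, (c ∘ σ) i = ∑ i, c i := Equiv.sum_comp σ c
  have hupper : ∑ i, c i ≤ ∑ i : Fin n, (K - (n - 1 - i.val) * m) := by
    rw [← hsum]
    apply Finset.sum_le_sum
    intro i _
    have := (hsort i).2
    omega
  have hle : ∑ i, (c ∘ σ) i ≤ ∑ i : Fin n, i.val * m := by rw [hsum]; omega
  have heq : ∀ i, i.val * m = (c ∘ σ) i := by
    have := (Finset.sum_eq_sum_iff_of_le (fun i _ => (hsort i).1)).1
          (le_antisymm (Finset.sum_le_sum fun i _ => (hsort i).1) hle)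
    intro i
    exact this i (mem_univ i)
  have hstep : StrictMono σ := by
    cases n with
    | zero => intro i; exact i.elim0
    | succ n =>
    rw [Fin.strictMono_iff_lt_succ]
    intro i
    by_contra hcon
    have hne' : σ i.castSucc ≠ σ i.succ := fun h => (Fin.castSucc_lt_succ (i := i)).ne (σ.injective h)
    have hlt : σ i.succ < σ i.castSucc := lt_of_le_of_ne (not_lt.mp hcon) hne'.symm
    have h1 := hc _ _ hlt
    have h2 := heq i.castSucc
    have h3 := heq i.succ
    simp only [Function.comp, Fin.val_succ, Fin.val_castSucc, add_mul] at h2 h3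
    omega
  have hid : (σ : Fin n → Fin n) = id := by
    have h := Subsingleton.elim (StrictMono.orderIsoOfSurjective σ hstep σ.surjective)
      (OrderIso.refl (Fin n))
    ext i
    have := DFunLike.congr_fun h i
    simpa using congrArg Fin.val this
  intro i
  have := heq i
  simp only [Function.comp, hid, id] at this
  exact this.symm

theorem ao_prod_pairs (n : ℕ) (f : ℕ → ℕ → ℚ) :
    ∏ i ∈ range n, ∏ j ∈ range n, (if i = j then 1 else f i j) =
      ∏ i ∈ range n, ∏ j ∈ range i, (f i j * f j i) := by
  induction n with
  | zero => simp
  | succ n ih =>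
    rw [prod_range_succ, prod_range_succ (fun i => ∏ j ∈ range i, (f i j * f j i)), ← ih]
    simp_rw [prod_range_succ]
    rw [Finset.prod_mul_distrib, Finset.prod_mul_distrib]
    have h1 : ∏ x ∈ range n, (if x = n then (1:ℚ) else f x n) = ∏ x ∈ range n, f x n :=
      prod_congr rfl fun x hx => if_neg (by simp at hx; omega)
    have h2 : ∏ x ∈ range n, (if n = x then (1:ℚ) else f n x) = ∏ x ∈ range n, f n x :=
      prod_congr rfl fun x hx => if_neg (by simp at hx; omega)
    rw [h1, h2]
    simp
    ring

theorem ao_offDiag (n : ℕ) (f : ℕ → ℕ → ℚ) :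
    ∏ p ∈ (univ : Finset (Fin n)).offDiag, f p.1 p.2 =
      ∏ i ∈ range n, ∏ j ∈ range i, (f i j * f j i) := by
  rw [← ao_prod_pairs]
  have : (univ : Finset (Fin n)).offDiag = univ.filter (fun p : Fin n × Fin n => p.1 ≠ p.2) := by
    ext; simp
  rw [this, Finset.prod_filter, Fintype.prod_prod_type, Finset.prod_range]
  apply prod_congr rfl
  intro i _
  rw [Finset.prod_range]
  apply prod_congr rfl
  intro j _
  simp [Fin.ext_iff]

theorem ao_pair1 (m d : ℕ) : ∏ l ∈ range m, (((d + 1) * m : ℕ) - (l : ℚ)) =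
    (((d + 1) * m).factorial : ℚ) / (d * m).factorial := by
  rw [eq_div_iff (by exact_mod_cast Nat.factorial_ne_zero _)]
  have h : ((d + 1) * m).descFactorial m = ∏ l ∈ range m, ((d + 1) * m - l) :=
    Nat.descFactorial_eq_prod_range _ _
  have h2 := Nat.factorial_mul_descFactorial (n := (d + 1) * m) (k := m) (by nlinarith)
  have h3 : (d + 1) * m - m = d * m := by rw [add_mul]; omega
  rw [h3, h] at h2
  rw [← h2]
  push_cast
  rw [mul_comm]
  congr 1
  apply prod_congr rfl
  intro l hl
  rw [Nat.cast_sub]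
  · push_cast; ring
  · have := mem_range.1 hl
    nlinarith

theorem ao_pair2 (m d : ℕ) : ∏ l ∈ range m, (-(d * m : ℕ) - ((l : ℚ) + 1)) =
    (-1) ^ m * ((((d + 1) * m).factorial : ℚ) / (d * m).factorial) := by
  rw [← ao_pair1, ← Finset.prod_range_reflect]
  rw [← Finset.card_range m, ← Finset.prod_const, Finset.card_range, ← Finset.prod_mul_distrib]
  apply prod_congr rfl
  intro l hl
  have := mem_range.1 hl
  have h : ((m - 1 - l : ℕ) : ℚ) = m - 1 - l := by
    rw [Nat.cast_sub (by omega), Nat.cast_sub (by omega)]; simp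
  rw [h]
  push_cast
  ring

theorem ao_tele (m a : ℕ) : ∏ j ∈ range a, (((((a - j) + 1) * m).factorial : ℚ) /
      ((a - j - 1) * m).factorial) =
    ((a + 1) * m).factorial * (a * m).factorial / m.factorial := by
  rw [← Finset.prod_range_reflect]
  have : ∀ j ∈ range a, ((((a - (a - 1 - j)) + 1) * m).factorial : ℚ) /
      ((a - (a - 1 - j) - 1) * m).factorial = ((j + 2) * m).factorial / (j * m).factorial := by
    intro j hj
    have := mem_range.1 hj
    have : a - (a - 1 - j) = j + 1 := by omega
    rw [this]
    simp
  rw [prod_congr rfl this]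
  clear this
  induction a with
  | zero => simp [Nat.factorial_ne_zero]
  | succ a ih =>
    rw [prod_range_succ, ih]
    have := Nat.factorial_ne_zero (a * m)
    have := Nat.factorial_ne_zero m
    field_simp

theorem ao_final_pairs (n m : ℕ) :
    ∏ p ∈ (univ : Finset (Fin n)).offDiag, ∏ l ∈ range m,
      ((((p.1.val * m : ℕ) : ℚ)) - ((p.2.val * m : ℕ) : ℚ) -
        ((l : ℚ) + if p.1 < p.2 then 1 else 0)) =
    (-1) ^ (∑ i : Fin n, i.val * m) *
      ∏ i ∈ range n, ((((i + 1) * m).factorial : ℚ) * (i * m).factorial / m.factorial) := by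
  have := ao_offDiag n (fun i j => ∏ l ∈ range m, ((((i * m : ℕ) : ℚ)) - ((j * m : ℕ) : ℚ) -
        ((l : ℚ) + if i < j then 1 else 0)))
  simp only [Fin.lt_def]
  rw [this, ← Finset.sum_range (fun i => i * m), ← Finset.prod_pow_eq_pow_sum,
    ← Finset.prod_mul_distrib]
  apply prod_congr rfl
  intro a _
  rw [← ao_tele]
  have : ((-1 : ℚ)) ^ (a * m) = ∏ j ∈ range a, (-1) ^ m := by
    rw [prod_const, card_range, ← pow_mul, mul_comm]
  rw [this, ← Finset.prod_mul_distrib]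
  apply prod_congr rfl
  intro j hj
  obtain ⟨d, rfl⟩ : ∃ d, a = j + d + 1 := ⟨a - j - 1, by have := mem_range.1 hj; omega⟩
  have e1 := ao_pair1 m d
  have e2 := ao_pair2 m (d + 1)
  have h1 : ∏ l ∈ range m, ((((j + d + 1) * m : ℕ) : ℚ) - ((j * m : ℕ) : ℚ) -
        ((l : ℚ) + if j + d + 1 < j then 1 else 0)) = ∏ l ∈ range m, (((d + 1) * m : ℕ) - (l : ℚ)) := by
    apply prod_congr rfl
    intro l _
    rw [if_neg (by omega)]
    push_cast; ring
  have h2 : ∏ l ∈ range m, (((j * m : ℕ) : ℚ) - (((j + d + 1) * m : ℕ) : ℚ)  -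
        ((l : ℚ) + if j < j + d + 1 then 1 else 0)) =
        ∏ l ∈ range m, (-((d + 1) * m : ℕ) - ((l : ℚ) + 1)) := by
    apply prod_congr rfl
    intro l _
    rw [if_pos (by omega)]
    push_cast; ring
  rw [h1, h2, e1, e2]
  have h3 : j + d + 1 - j = d + 1 := by omega
  rw [h3]
  have := Nat.factorial_ne_zero (d * m)
  have := Nat.factorial_ne_zero ((d + 1) * m)
  simp only [Nat.add_sub_cancel]
  field_simp

theorem ao_main_s4 {n m K : ℕ} (hm : 1 ≤ m) (hK : m * (n - 1) ≤ K) :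
    MvPolynomial.coeff (Finsupp.equivFunOnFinite.symm fun _ : Fin n => K)
        ((∏ p ∈ Finset.univ.offDiag, (X p.1 - X p.2 : MvPolynomial (Fin n) ℚ) ^ m) *
          (∑ j, X j) ^ (n * K - m * n * (n - 1))) =
      ((n * K - m * n * (n - 1)).factorial : ℚ) / (m.factorial : ℚ) ^ n *
        ∏ j ∈ Finset.range n,
          ((((j + 1) * m).factorial : ℚ) / ((K - j * m).factorial : ℚ)) := by
  have hle : m * n * (n - 1) ≤ n * K := by
    calc m * n * (n - 1) = n * (m * (n - 1)) := by ring
      _ ≤ n * K := Nat.mul_le_mul_left _ hK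
  obtain ⟨N, hN⟩ : ∃ N, N = n * K - m * n * (n - 1) := ⟨_, rfl⟩
  obtain ⟨S, hS⟩ : ∃ S, S = ∑ i : Fin n, i.val * m := ⟨_, rfl⟩
  rw [← hN]
  have hS2 : 2 * S = m * n * (n - 1) := by
    rw [hS, ← Finset.sum_range (fun i => i * m), ← Finset.sum_mul]
    have := Finset.sum_range_id_mul_two n
    calc _ = ((∑ i ∈ range n, i) * 2) * m := by ring
      _ = _ := by rw [this]; ring
  have him : ∀ i : ℕ, i < n → i * m ≤ K := by
    intro i hi
    calc i * m ≤ (n - 1) * m := Nat.mul_le_mul_right _ (by omega)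
      _ ≤ K := by rw [mul_comm]; exact hK
  have hup : ∑ i : Fin n, (K - (n - 1 - i.val) * m) = S + N := by
    have h1 : ∑ i : Fin n, (n - 1 - i.val) * m = S := by
      rw [hS, ← Finset.sum_range (fun i => i * m), ← Finset.sum_range_reflect,
        ← Finset.sum_range (fun i => (n - 1 - i) * m)]
    have h2 : ∑ i : Fin n, (K - (n - 1 - i.val) * m) + ∑ i : Fin n, (n - 1 - i.val) * m = n * K := by
      rw [← Finset.sum_add_distrib]
      rw [Finset.sum_congr rfl (fun i _ => Nat.sub_add_cancel (him (n - 1 - i.val) (by omega)))]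
      simp
    omega
  have hdeg : (∑ p ∈ (univ : Finset (Fin n)).offDiag, ∑ l ∈ range m, 1) + ∑ s ∈ range N, 1 = n * K := by
    simp only [sum_const, offDiag_card, card_univ, Fintype.card_fin, card_range, smul_eq_mul, mul_one]
    have : (n * n - n) * m = m * n * (n - 1) := by
      rw [← Nat.mul_sub_one]; ring
    omega
  have htop := (AoTop.prod (univ : Finset (Fin n)).offDiag
      (fun p => ∏ l ∈ range m, ((X p.1 - X p.2 : MvPolynomial (Fin n) ℚ) -
        C ((l : ℚ) + if p.1 < p.2 then 1 else 0)))
      (fun p => ∏ l ∈ range m, (X p.1 - X p.2 : MvPolynomial (Fin n) ℚ))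
      (fun p => ∑ l ∈ range m, 1)
      (fun p _ => AoTop.prod _ _ _ _ (fun l _ => AoTop.lin
        ((isHomogeneous_X ℚ p.1).sub (isHomogeneous_X ℚ p.2)) _))).mul
    (AoTop.prod (range N) (fun s => (∑ j, X j : MvPolynomial (Fin n) ℚ) - C ((S : ℚ) + (s + 1)))
      (fun s => (∑ j, X j : MvPolynomial (Fin n) ℚ)) (fun _ => 1)
      (fun s _ => AoTop.lin (IsHomogeneous.sum _ _ _ fun i _ => isHomogeneous_X ℚ i) _))
  rw [hdeg] at htop
  simp only [prod_const, card_range] at htop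
  rw [← htop.2 _ (by simp [Finsupp.degree_eq_sum]), ao_null _ (fun d hd => (htop.1 d hd).1)]
  clear htop
  rw [Finset.sum_eq_single (fun i : Fin n => i.val * m)]
  · simp only [map_mul, map_prod, map_sub, map_sum, eval_X, eval_C]
    rw [ao_final_pairs, ← Nat.cast_sum, ← hS]
    have h1 : ∏ s ∈ range N, ((S : ℚ) - ((S : ℚ) + ((s : ℚ) + 1))) = (-1) ^ N * N.factorial := by
      rw [← Finset.prod_range_add_one_eq_factorial]
      push_cast
      rw [← Finset.card_range N, ← Finset.prod_const, Finset.card_range, ← Finset.prod_mul_distrib]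
      apply prod_congr rfl
      intro s _
      ring
    rw [h1]
    have h2 : ∏ i : Fin n, aoW K (i.val * m) = (-1) ^ (S + N) *
        ∏ i ∈ range n, (1 / (((i * m).factorial : ℚ) * (K - i * m).factorial)) := by
      rw [← Finset.prod_range (fun i => aoW K (i * m))]
      have : S + N = ∑ i ∈ range n, (K - i * m) := by
        rw [← hup, ← Finset.sum_range (fun i => K - (n - 1 - i) * m),
          Finset.sum_range_reflect (fun i => K - i * m)]
      rw [this, ← Finset.prod_pow_eq_pow_sum, ← Finset.prod_mul_distrib]
      apply prod_congr rfl
      intro i _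
      rw [aoW]; ring
    rw [h2]
    have hsgn : ((-1 : ℚ) ^ (S + N)) * ((-1) ^ S * (-1) ^ N) = 1 := by
      rw [← pow_add, ← pow_add, ← two_mul, pow_mul]; simp
    have hprod : (∏ i ∈ range n, (1 / (((i * m).factorial : ℚ) * (K - i * m).factorial))) *
        ∏ i ∈ range n, ((((i + 1) * m).factorial : ℚ) * (i * m).factorial / m.factorial) =
        1 / (m.factorial : ℚ) ^ n * ∏ j ∈ Finset.range n,
          ((((j + 1) * m).factorial : ℚ) / ((K - j * m).factorial : ℚ)) := by
      have : 1 / (m.factorial : ℚ) ^ n = ∏ i ∈ range n, (1 / (m.factorial : ℚ)) := by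
        simp
      rw [this, ← Finset.prod_mul_distrib, ← Finset.prod_mul_distrib]
      apply prod_congr rfl
      intro i _
      have := Nat.factorial_ne_zero (i * m)
      have := Nat.factorial_ne_zero m
      have := Nat.factorial_ne_zero (K - i * m)
      field_simp
    linear_combination (N.factorial : ℚ) * hprod + ((N.factorial : ℚ) * ((∏ i ∈ range n, (1 / (((i * m).factorial : ℚ) * (K - i * m).factorial))) *
        ∏ i ∈ range n, ((((i + 1) * m).factorial : ℚ) * (i * m).factorial / m.factorial))) * hsgn
  · intro c hc hne
    simp only [Fintype.mem_piFinset, mem_range] at hc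
    by_contra h0
    apply hne
    have h1 := right_ne_zero_of_mul h0
    simp only [map_mul, map_prod, map_sub, map_sum, eval_X, eval_C] at h1
    have hp := left_ne_zero_of_mul h1
    have hs := right_ne_zero_of_mul h1
    rw [Finset.prod_ne_zero_iff] at hp hs
    funext i
    refine ao_unique (K := K) hm c (fun i => by have := hc i; omega) ?_ ?_ i
    · intro i j hij
      have p1 := hp (i, j) (by simp [hij.ne])
      have p2 := hp (j, i) (by simp [hij.ne'])
      rw [Finset.prod_ne_zero_iff] at p1 p2
      by_contra! hcon
      obtain ⟨q1, q2⟩ := hcon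
      rcases le_or_gt (c i) (c j) with h | h
      · apply p2 (c j - c i) (by simp; omega)
        simp [hij.not_gt, Nat.cast_sub h]
      · apply p1 (c i - c j - 1) (by simp; omega)
        simp only [hij, if_true]
        rw [Nat.cast_sub (by omega), Nat.cast_sub h.le]
        push_cast; ring
    · rw [hup, ← hS]
      by_contra! hcon
      obtain ⟨q1, q2⟩ := hcon
      apply hs ((∑ i, c i) - S - 1) (by simp; omega)
      rw [Nat.cast_sub (by omega), Nat.cast_sub q1.le]
      push_cast; ring
  · intro h
    exfalso
    apply h
    simp only [Fintype.mem_piFinset, mem_range]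
    intro i
    have := him i i.2
    omega

/-- The `s = 0` case of the Aomoto-derived coefficient identity: the coefficient of
`x_1^{k-1} ⋯ x_n^{k-1}` in `∏_{i≠j}(x_i - x_j)^m (x_1 + ⋯ + x_n)^{n(k-1) - mn(n-1)}`,
which in particular is nonzero. -/
theorem aomoto_coefficient_equal_case {n m k : ℕ} (hn : 1 ≤ n) (hm : 1 ≤ m) (hk : 1 ≤ k)
    (hkm : m * (n - 1) < k) :
    MvPolynomial.coeff (Finsupp.equivFunOnFinite.symm fun _ : Fin n => k - 1)
        ((∏ p ∈ Finset.univ.offDiag, (X p.1 - X p.2 : MvPolynomial (Fin n) ℚ) ^ m) *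
          (∑ j, X j) ^ (n * (k - 1) - m * n * (n - 1))) =
      ((n * (k - 1) - m * n * (n - 1)).factorial : ℚ) / (m.factorial : ℚ) ^ n *
        ∏ j ∈ Finset.range n,
          ((((j + 1) * m).factorial : ℚ) / ((k - 1 - j * m).factorial : ℚ)) ∧
    MvPolynomial.coeff (Finsupp.equivFunOnFinite.symm fun _ : Fin n => k - 1)
        ((∏ p ∈ Finset.univ.offDiag, (X p.1 - X p.2 : MvPolynomial (Fin n) ℚ) ^ m) *
          (∑ j, X j) ^ (n * (k - 1) - m * n * (n - 1))) ≠ 0 := by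
  have h := ao_main_s4 (n := n) (m := m) (K := k - 1) hm (by omega)
  refine ⟨h, ?_⟩
  rw [h]
  have hf : ∀ a : ℕ, (a.factorial : ℚ) ≠ 0 := fun a => by exact_mod_cast Nat.factorial_ne_zero a
  exact mul_ne_zero (div_ne_zero (hf _) (pow_ne_zero _ (hf _)))
    (Finset.prod_ne_zero_iff.2 fun j _ => div_ne_zero (hf _) (hf _))
end

section
/- (Dias da Silva–Hamidoune) Let F be a field, A a finite subset of F, and n ≤ |A|. Let n^∧A = {a_1 + ... + a_n : a_1, ..., a_n ∈ A pairwise distinct}. Then |n^∧A| ≥ min{p(F), n|A| − n² + 1}. -/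
open Finset

namespace DDH
open MvPolynomial

variable {F : Type*} [Field F]

lemma coeff_term {n : ℕ} (m : ℕ) (c : Fin n →₀ ℕ) (e : Fin n →₀ ℕ)
    (h : ∑ i, c i = m + ∑ i, e i) :
    ((∏ i, (c i).factorial : ℕ) : F) * coeff c (monomial e 1 * (∑ i, X i : MvPolynomial (Fin n) F) ^ m)
      = (m.factorial : F) * ∏ i, ((c i).descFactorial (e i) : F) := by
  rw [coeff_monomial_mul']
  split_ifs with hle
  · have hle' : ∀ i, e i ≤ c i := hle
    have hd : ∑ i, (c - e) i = m := by
      have : ∑ i, (c - e) i + ∑ i, e i = ∑ i, c i := by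
        rw [← sum_add_distrib]
        refine sum_congr rfl fun i _ => ?_
        have := hle' i
        simp only [Finsupp.tsub_apply]; omega
      omega
    have hms := Nat.multinomial_spec (univ : Finset (Fin n)) (fun i => (c - e) i)
    rw [hd] at hms
    rw [coeff_sum_X_pow_of_fintype, if_pos (by rw [Finsupp.sum_fintype _ _ (by simp)]; exact hd),
      Finsupp.multinomial_eq_of_support_subset (subset_univ _), one_mul]
    rw [← hms]
    have : ∀ i, (c i).factorial = ((c - e) i).factorial * (c i).descFactorial (e i) := fun i => by
      rw [Finsupp.tsub_apply, Nat.factorial_mul_descFactorial (hle' i)]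
    simp_rw [this]
    push_cast
    rw [prod_mul_distrib]
    ring
  · rw [mul_zero]
    have : ∃ i, c i < e i := by
      by_contra! hc
      exact hle hc
    obtain ⟨i, hi⟩ := this
    rw [prod_eq_zero (mem_univ i), mul_zero]
    rw [Nat.descFactorial_eq_zero_iff_lt.2 hi, Nat.cast_zero]

noncomputable def ex {n : ℕ} (σ : Equiv.Perm (Fin n)) : Fin n →₀ ℕ :=
  Finsupp.equivFunOnFinite.symm fun i => ((σ i : Fin n) : ℕ)

lemma sum_ex {n : ℕ} (σ : Equiv.Perm (Fin n)) : ∑ i, ex σ i = ∑ i : Fin n, (i : ℕ) := by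
  simp only [ex, Finsupp.equivFunOnFinite_symm_apply_apply]
  exact Equiv.sum_comp σ (fun i : Fin n => (i : ℕ))

noncomputable def V (F : Type*) [Field F] (n : ℕ) : MvPolynomial (Fin n) F :=
  (Matrix.vandermonde (X : Fin n → MvPolynomial (Fin n) F)).det

lemma V_eq (n : ℕ) : V F n = ∑ σ : Equiv.Perm (Fin n),
    ((Equiv.Perm.sign σ : ℤ) : F) • monomial (ex σ) 1 := by
  rw [V, ← Matrix.det_transpose, Matrix.det_apply']
  refine sum_congr rfl fun σ _ => ?_
  rw [MvPolynomial.smul_eq_C_mul]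
  congr 1
  rw [monomial_eq, Finsupp.prod_fintype _ _ (by simp)]
  simp [ex, Matrix.vandermonde_apply]

lemma V_hom (n : ℕ) : (V F n).IsHomogeneous (∑ i : Fin n, (i : ℕ)) := by
  rw [V_eq]
  refine IsHomogeneous.sum _ _ _ fun σ _ => ?_
  rw [MvPolynomial.smul_eq_C_mul, C_mul_monomial]
  apply isHomogeneous_monomial
  rw [Finsupp.degree_eq_sum, sum_ex]

lemma coeff_V {n : ℕ} (m : ℕ) (c : Fin n →₀ ℕ)
    (h : ∑ i, c i = m + ∑ i : Fin n, (i : ℕ)) :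
    ((∏ i, (c i).factorial : ℕ) : F) * coeff c (V F n * (∑ i, X i : MvPolynomial (Fin n) F) ^ m)
      = (m.factorial : F) * ∏ i : Fin n, ∏ j ∈ Ioi i, ((c j : F) - c i) := by
  rw [← Matrix.det_vandermonde, Matrix.det_eval_matrixOfPolynomials_eq_det_vandermonde _
      (fun i : Fin n => descPochhammer F i)
      (fun i => descPochhammer_natDegree F i)
      (fun i => monic_descPochhammer F i), ← Matrix.det_transpose, Matrix.det_apply', V_eq, sum_mul,
      coeff_sum, mul_sum, mul_sum]
  refine sum_congr rfl fun σ _ => ?_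
  have := coeff_term (F := F) m c (ex σ) (by rw [sum_ex, h])
  rw [smul_mul_assoc, coeff_smul, smul_eq_mul, mul_left_comm, this, mul_left_comm]
  simp [ex, descPochhammer_eval_eq_descFactorial]

lemma coeff_low {n : ℕ} (m i : ℕ) (c : Fin n →₀ ℕ)
    (h : ∑ i, c i = m + ∑ i : Fin n, (i : ℕ)) (him : i ≠ m) :
    coeff c (V F n * (∑ i, X i : MvPolynomial (Fin n) F) ^ i) = 0 := by
  have hY : (∑ i, X i : MvPolynomial (Fin n) F).IsHomogeneous 1 :=
    IsHomogeneous.sum _ _ _ fun i _ => isHomogeneous_X _ _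
  have := (V_hom (F := F) n).mul (hY.pow i)
  refine this.coeff_eq_zero ?_
  rw [Finsupp.degree_eq_sum]
  omega

lemma core [DecidableEq F] {n : ℕ} (m : ℕ) (A S : Finset F) (c : Fin n → ℕ)
    (h : ∑ i, c i = m + ∑ i : Fin n, (i : ℕ))
    (hcA : ∀ i, c i < A.card)
    (hm : (m.factorial : F) ≠ 0) (hc : ∀ i j, i < j → (c j : F) - c i ≠ 0)
    (hS : ∀ f : Fin n → F, (∀ i, f i ∈ A) → Function.Injective f → ∑ i, f i ∈ S) :
    m + 1 ≤ S.card := by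
  by_contra hlt
  have hle : S.card ≤ m := by omega
  set q : Polynomial F := (∏ s ∈ S, (Polynomial.X - Polynomial.C s)) * Polynomial.X ^ (m - S.card)
    with hq
  have hmon : q.Monic :=
    (Polynomial.monic_prod_of_monic _ _ fun s _ => Polynomial.monic_X_sub_C s).mul
      (Polynomial.monic_X_pow _)
  have hdeg : q.natDegree = m := by
    rw [hq, (Polynomial.monic_prod_of_monic _ _ fun s _ => Polynomial.monic_X_sub_C s).natDegree_mul
      (Polynomial.monic_X_pow _), Polynomial.natDegree_prod_of_monic _ _
        fun s _ => Polynomial.monic_X_sub_C s]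
    simp
    omega
  set Y : MvPolynomial (Fin n) F := ∑ i, X i with hYdef
  have hY : Y.IsHomogeneous 1 := IsHomogeneous.sum _ _ _ fun i _ => isHomogeneous_X _ _
  set P := V F n * Polynomial.aeval Y q with hP
  have hPs : P = ∑ i ∈ range (m + 1), q.coeff i • (V F n * Y ^ i) := by
    rw [hP, Polynomial.aeval_eq_sum_range, hdeg, mul_sum]
    simp
  let t : Fin n →₀ ℕ := Finsupp.equivFunOnFinite.symm c
  have ht : ∀ i, t i = c i := fun i => rfl
  have hts : ∑ i, t i = m + ∑ i : Fin n, (i : ℕ) := h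
  have hcoef : coeff t P ≠ 0 := by
    rw [hPs, coeff_sum, sum_range_succ, sum_eq_zero, zero_add]
    · rw [coeff_smul]
      have h1 : q.coeff m = 1 := by rw [← hdeg]; exact hmon
      rw [h1, one_smul]
      intro h0
      have := coeff_V (F := F) m t hts
      rw [h0, mul_zero] at this
      refine mul_ne_zero hm ?_ this.symm
      refine prod_ne_zero_iff.2 fun i _ => prod_ne_zero_iff.2 fun j hj => hc i j (mem_Ioi.1 hj)
    · intro i hi
      rw [coeff_smul, coeff_low m i t hts (by have := mem_range.1 hi; omega), smul_zero]
  have htd : P.totalDegree = t.degree := by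
    apply le_antisymm
    · rw [hPs]
      refine totalDegree_finsetSum_le fun i hi => ?_
      refine (totalDegree_smul_le _ _).trans ?_
      refine ((V_hom (F := F) n).mul (hY.pow i)).totalDegree_le.trans ?_
      rw [Finsupp.degree_eq_sum, hts]
      have := mem_range.1 hi
      omega
    · have := le_totalDegree (mem_support_iff.2 hcoef)
      rwa [Finsupp.degree_eq_sum, ← Finsupp.sum_fintype t (fun _ e => e) (by simp)]
  obtain ⟨s, hsA, hs⟩ := combinatorial_nullstellensatz_exists_eval_nonzero P t hcoef htd
    (fun _ => A) hcA
  apply hs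
  rw [hP, map_mul]
  by_cases hinj : Function.Injective s
  · have hmem := hS s hsA hinj
    have : eval s (Polynomial.aeval Y q) = q.eval (∑ i, s i) := by
      rw [← MvPolynomial.coe_aeval_eq_eval]
      change aeval s _ = _
      rw [← Polynomial.aeval_algHom_apply]
      simp [hYdef, Polynomial.aeval_def, Polynomial.eval₂_id]
    rw [this, hq, Polynomial.eval_mul, Polynomial.eval_prod, prod_eq_zero hmem
      (by rw [Polynomial.eval_sub, Polynomial.eval_X, Polynomial.eval_C, sub_self]), zero_mul,
      mul_zero]
  · have : eval s (V F n) = (Matrix.vandermonde s).det := by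
      simp [V, Matrix.det_vandermonde]
    rw [this, not_not.1 (mt Matrix.det_vandermonde_ne_zero_iff.1 hinj), zero_mul]

lemma hermite (n : ℕ) (hn : 0 < n) (M : ℕ) : ∑ i ∈ range n, (M + i) / n = M := by
  induction M with
  | zero => 
    refine sum_eq_zero fun i hi => ?_
    rw [zero_add]; exact Nat.div_eq_of_lt (mem_range.1 hi)
  | succ M ih =>
    have h1 := sum_range_succ (fun i => (M + i) / n) n
    have h2 := sum_range_succ' (fun i => (M + i) / n) n
    have h3 : (M + n) / n = M / n + 1 := Nat.add_div_right M hn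
    have h4 : ∑ i ∈ range n, (M + 1 + i) / n = ∑ i ∈ range n, (M + (i + 1)) / n :=
      sum_congr rfl fun i _ => by congr 1; omega
    simp only [add_zero] at h2
    omega

/-- main bound for M with the natural numbers up to `M` nonzero in `F` -/
lemma bound [DecidableEq F] {n : ℕ} (M : ℕ) (A S : Finset F) (hn : n ≤ A.card)
    (hM : M ≤ n * (A.card - n)) (hF : ∀ k : ℕ, 0 < k → k ≤ M → (k : F) ≠ 0)
    (hS : ∀ B ⊆ A, B.card = n → ∑ b ∈ B, b ∈ S) : M + 1 ≤ S.card := by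
  set r := min n M with hr
  obtain ⟨T, hTA, hT⟩ := exists_subset_card_eq (s := A) (n := n - r) (by omega)
  have hcard : (A \ T).card = A.card - (n - r) := by rw [card_sdiff_of_subset hTA, hT]
  set S' := S.image (fun x => x - ∑ b ∈ T, b) with hS'
  refine le_trans ?_ (card_image_le (s := S) (f := fun x => x - ∑ b ∈ T, b))
  have hrM : M ≤ r * (A.card - n) := by
    rcases le_total n M with h | h
    · rwa [hr, min_eq_left h]
    · rw [hr, min_eq_right h]
      rcases Nat.eq_zero_or_pos (A.card - n) with h0 | h0
      · rw [h0] at hM ⊢; simpa using hM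
      · exact Nat.le_mul_of_pos_right _ h0
  refine core (n := r) M (A \ T) S' (fun i => i + (M + i) / r) ?_ ?_ ?_ ?_ ?_
  · rw [sum_add_distrib, add_comm]
    congr 1
    rw [Fin.sum_univ_eq_sum_range (fun i => (M + i) / r)]
    rcases Nat.eq_zero_or_pos r with h0 | h0
    · have : M = 0 := by rw [h0] at hrM; simpa using hrM
      rw [h0, this]; simp
    · exact hermite r h0 M
  · intro i
    have hi := i.2
    have : (M + i) / r < A.card - n + 1 := by
      rw [Nat.div_lt_iff_lt_mul (by omega), add_mul, one_mul, mul_comm]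
      omega
    rw [hcard]
    have : r ≤ n := min_le_left _ _
    omega
  · rw [← prod_range_add_one_eq_factorial, Nat.cast_prod, prod_ne_zero_iff]
    intro k hk
    exact hF _ (by omega) (by have := mem_range.1 hk; omega)
  · intro i j hij
    have hij' : (i : ℕ) < j := hij
    have hj := j.2
    have h1 : (M + i) / r ≤ (M + j) / r := Nat.div_le_div_right (by omega)
    have h2 : (M + j) / r ≤ (M + i) / r + 1 := by
      rw [← Nat.add_div_right _ (by omega)]
      exact Nat.div_le_div_right (by omega)
    have h3 : r ≤ M := min_le_right _ _
    rw [← Nat.cast_sub (by omega)]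
    exact hF _ (by omega) (by omega)
  · intro f hf hinj
    have hB : univ.image f ⊆ A \ T := by
      intro x hx
      obtain ⟨i, _, rfl⟩ := mem_image.1 hx
      exact hf i
    have hdisj : Disjoint (univ.image f) T := 
      disjoint_of_subset_left hB sdiff_disjoint
    have := hS (univ.image f ∪ T) (union_subset (hB.trans sdiff_subset) hTA) (by
      rw [card_union_of_disjoint hdisj, card_image_of_injective _ hinj, hT, card_univ,
        Fintype.card_fin]
      have : r ≤ n := min_le_left _ _
      omega)
    rw [sum_union hdisj, sum_image (fun a _ b _ h => hinj h)] at this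
    exact mem_image.2 ⟨_, this, by simp⟩

end DDH

theorem dias_da_silva_hamidoune {F : Type*} [Field F] [DecidableEq F] {n : ℕ}
    (A : Finset F) (hn : n ≤ A.card) :
    (ringChar F = 0 →
      (n : ℤ) * A.card - n ^ 2 + 1 ≤
        (((Fintype.piFinset fun _ : Fin n => A).filter fun f => Function.Injective f).image
          fun f => ∑ i, f i).card) ∧
    (ringChar F ≠ 0 →
      min ((ringChar F : ℤ)) ((n : ℤ) * A.card - n ^ 2 + 1) ≤
        (((Fintype.piFinset fun _ : Fin n => A).filter fun f => Function.Injective f).image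
          fun f => ∑ i, f i).card) := by
  have hS : ∀ B ⊆ A, B.card = n → ∑ b ∈ B, b ∈
      (((Fintype.piFinset fun _ : Fin n => A).filter fun f => Function.Injective f).image
          fun f => ∑ i, f i) := by
    intro B hB hc
    let e := B.equivFinOfCardEq hc
    refine mem_image.2 ⟨fun i => (e.symm i : F), ?_, ?_⟩
    · rw [mem_filter, Fintype.mem_piFinset]
      exact ⟨fun i => hB (e.symm i).2, Subtype.val_injective.comp e.symm.injective⟩
    · rw [Equiv.sum_comp e.symm (fun x : B => (x : F)), sum_coe_sort B (fun x => x)]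
  generalize (((Fintype.piFinset fun _ : Fin n => A).filter fun f => Function.Injective f).image
          fun f => ∑ i, f i) = S at hS ⊢
  have hcast : (n : ℤ) * A.card - n ^ 2 = ((n * (A.card - n) : ℕ) : ℤ) := by
    push_cast [Nat.cast_sub hn]; ring
  rw [hcast]
  constructor
  · intro h0
    have := DDH.bound (n * (A.card - n)) A S hn le_rfl (fun k hk _ h => by
      have := (ringChar.spec F k).1 h
      rw [h0, zero_dvd_iff] at this
      omega) hS
    exact_mod_cast this
  · intro h0
    have := DDH.bound (min (ringChar F - 1) (n * (A.card - n))) A S hn (min_le_right _ _)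
      (fun k hk hk' h => by
        have := Nat.le_of_dvd hk ((ringChar.spec F k).1 h)
        omega) hS
    omega
end
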